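/- If G is a non-hamiltonian 1-tough graph on n ≥ 3 vertices with σ₃(G) ≥ n, then G has a longest cycle C such that some vertex not on C has degree at least n/3. -/

import Mathlib

open scoped Classical

namespace Paper

noncomputable section

variable {V : Type*}

/-- degree as cardinality of neighbor set -/
def deg (G : SimpleGraph V) (x : V) : ℕ := (G.neighborSet x).ncard

/-- G is 1-tough -/
def OneTough (G : SimpleGraph V) : Prop :=
  ∀ S : Set V, S.Nonempty → Nat.card ((G.induce Sᶜ).ConnectedComponent) ≤ S.ncard

def IsIndepTriple (G : SimpleGraph V) (s : Finset V) : Prop :=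
  s.card = 3 ∧ ∀ x ∈ s, ∀ y ∈ s, x ≠ y → ¬ G.Adj x y

def sigma3 [Fintype V] (G : SimpleGraph V) : ℕ :=
  if ∃ s : Finset V, IsIndepTriple G s then
    sInf {k | ∃ s : Finset V, IsIndepTriple G s ∧ ∑ x ∈ s, deg G x = k}
  else 3 * (Fintype.card V - 1)

def NC2 [Fintype V] (G : SimpleGraph V) : ℕ :=
  if G = ⊤ then Fintype.card V - 1
  else sInf {k | ∃ x y : V, G.dist x y = 2 ∧ (G.neighborSet x ∪ G.neighborSet y).ncard = k}

def circumference (G : SimpleGraph V) : ℕ :=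
  sSup {k | ∃ (a : V) (w : G.Walk a a), w.IsCycle ∧ w.length = k}

def IsLongestCycle (G : SimpleGraph V) {a : V} (c : G.Walk a a) : Prop :=
  c.IsCycle ∧ ∀ (b : V) (w : G.Walk b b), w.IsCycle → w.length ≤ c.length

/-- successor of a vertex along the oriented cycle `c` (identity off the cycle) -/
def cSucc [DecidableEq V] {G : SimpleGraph V} {a : V} (c : G.Walk a a) (x : V) : V :=
  if h : x ∈ c.support.tail then c.support.tail.next x h else x

/-- predecessor of a vertex along the oriented cycle `c` (identity off the cycle) -/
def cPred [DecidableEq V] {G : SimpleGraph V} {a : V} (c : G.Walk a a) (x : V) : V :=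
  if h : x ∈ c.support.tail then c.support.tail.prev x h else x

/-- vertices strictly between `x` and `y` going forward along `c` -/
def arc [DecidableEq V] {G : SimpleGraph V} {a : V} (c : G.Walk a a) (x y : V) : Set V :=
  {z | ∃ i k : ℕ, 0 < i ∧ i < k ∧ k < c.length ∧ (cSucc c)^[k] x = y ∧ z = (cSucc c)^[i] x}

/-- length of the interval of the cycle `c` starting at `b` determined by `B` -/
def intervalLen [DecidableEq V] {G : SimpleGraph V} {a : V} (c : G.Walk a a)
    (B : Set V) (b : V) : ℕ :=
  sInf {k | 0 < k ∧ (cSucc c)^[k] b ∈ B}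

/-- inner vertices of the interval of the cycle `c` starting at `b` determined by `B` -/
def innerVerts [DecidableEq V] {G : SimpleGraph V} {a : V} (c : G.Walk a a)
    (B : Set V) (b : V) : Set V :=
  {x | ∃ i, 0 < i ∧ i < intervalLen c B b ∧ x = (cSucc c)^[i] b}

/-- the union of the neighborhoods of the vertices in `S` -/
def nbhdSet (G : SimpleGraph V) (S : Set V) : Set V := {z | ∃ y ∈ S, G.Adj y z}

/-- a set of vertices is independent -/
def IsIndepSet (G : SimpleGraph V) (S : Set V) : Prop :=
  ∀ x ∈ S, ∀ y ∈ S, ¬ G.Adj x y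

/-- The list `c p, c (p+1), …, c q`. -/
def ivl (c : ℤ → V) (p q : ℤ) : List V := (List.range (q + 1 - p).toNat).map fun i : ℕ => c (p + i)

/-- `l` is a path (in the sense of adjacency only) from `u` to `v`. -/
def LP (G : SimpleGraph V) (u v : V) (l : List V) : Prop :=
  l.IsChain G.Adj ∧ l.head? = some u ∧ l.getLast? = some v

/-- There is a path from `u` to `v` whose multiset of vertices is `M`. -/
def PT (G : SimpleGraph V) (u v : V) (M : Multiset V) : Prop :=
  ∃ l : List V, LP G u v l ∧ (l : Multiset V) = M

/-- `M` is the vertex set of a cycle of length at least three. -/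
def Cl (G : SimpleGraph V) (M : Multiset V) : Prop :=
  M.Nodup ∧ 3 ≤ M.card ∧ ∃ u v, PT G u v M ∧ G.Adj v u

section ivl
variable (c : ℤ → V) {p q r : ℤ}

theorem ivl_nil (h : q < p) : ivl c p q = [] := by
  have : (q + 1 - p).toNat = 0 := by omega
  simp [ivl, this]

theorem ivl_cons (h : p ≤ q) : ivl c p q = c p :: ivl c (p + 1) q := by
  have h1 : (q + 1 - p).toNat = (q + 1 - (p + 1)).toNat + 1 := by omega
  rw [ivl, ivl, h1, List.range_succ_eq_map]
  simp only [List.map_cons, List.map_map, Nat.cast_zero, add_zero, List.cons.injEq, true_and]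
  apply List.map_congr_left
  intro i _
  simp only [Function.comp_apply]
  congr 1
  push_cast; ring

theorem ivl_append (h : p ≤ r + 1) (h' : r ≤ q) : ivl c p q = ivl c p r ++ ivl c (r + 1) q := by
  obtain ⟨k, hk⟩ := Int.le.dest h
  induction k generalizing p with
  | zero =>
    have : p = r + 1 := by simpa using hk
    subst this
    rw [ivl_nil c (show r < r + 1 by omega)]; simp
  | succ k ih =>
    rw [ivl_cons c (show p ≤ q by push_cast at hk; omega),
      ivl_cons c (show p ≤ r by push_cast at hk; omega), List.cons_append,
      ih (by push_cast at hk; omega) (by push_cast at hk; omega)]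

theorem ivl_self : ivl c p p = [c p] := by
  rw [ivl_cons c le_rfl, ivl_nil c (by omega)]

theorem ivl_concat (h : p ≤ q) : ivl c p q = ivl c p (q - 1) ++ [c q] := by
  rw [ivl_append c (r := q - 1) (by omega) (by omega)]
  simp [ivl_self]

theorem mem_ivl {x : V} : x ∈ ivl c p q ↔ ∃ t, p ≤ t ∧ t ≤ q ∧ c t = x := by
  simp only [ivl, List.mem_map, List.mem_range]
  constructor
  · rintro ⟨i, hi, rfl⟩
    exact ⟨p + i, by omega, by omega, rfl⟩
  · rintro ⟨t, h1, h2, rfl⟩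
    exact ⟨(t - p).toNat, by omega, by congr 1; omega⟩

theorem length_ivl : (ivl c p q).length = (q + 1 - p).toNat := by simp [ivl]

theorem infix_ivl (h : p ≤ r) (h' : r + 1 ≤ q) : [c r, c (r + 1)] <:+: ivl c p q := by
  refine ⟨ivl c p (r - 1), ivl c (r + 2) q, ?_⟩
  rw [ivl_append c (r := r - 1) (p := p) (q := q) (by omega) (by omega),
    ivl_cons c (p := r - 1 + 1) (by omega), ivl_cons c (p := r - 1 + 1 + 1) (by omega)]
  have e1 : r - 1 + 1 = r := by ring
  have e2 : r + 1 + 1 = r + 2 := by ring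
  simp [e1, e2]

theorem infix_ivl_three (h : p ≤ r) (h' : r + 2 ≤ q) :
    [c r, c (r + 1), c (r + 2)] <:+: ivl c p q := by
  refine ⟨ivl c p (r - 1), ivl c (r + 3) q, ?_⟩
  rw [ivl_append c (r := r - 1) (p := p) (q := q) (by omega) (by omega),
    ivl_cons c (p := r - 1 + 1) (by omega), ivl_cons c (p := r - 1 + 1 + 1) (by omega),
    ivl_cons c (p := r - 1 + 1 + 1 + 1) (by omega)]
  have e1 : r - 1 + 1 = r := by ring
  have e2 : r + 1 + 1 = r + 2 := by ring
  have e3 : r + 2 + 1 = r + 3 := by ring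
  simp [e1, e2, e3]

theorem head_ivl (h : p ≤ q) : (ivl c p q).head? = some (c p) := by
  rw [ivl_cons c h]; rfl

theorem getLast_ivl (h : p ≤ q) : (ivl c p q).getLast? = some (c q) := by
  rw [ivl_concat c h]; simp

theorem chain_ivl {G : SimpleGraph V} (adj : ∀ t, G.Adj (c t) (c (t + 1))) (p q : ℤ) :
    (ivl c p q).IsChain G.Adj := by
  by_cases h : q < p
  · rw [ivl_nil _ h]; simp
  · obtain ⟨k, hk⟩ := Int.le.dest (show p ≤ q + 1 by omega)
    clear h
    induction k generalizing p with
    | zero => rw [ivl_nil _ (by simp at hk; omega)]; simp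
    | succ k ih =>
      rw [ivl_cons _ (by push_cast at hk; omega)]
      by_cases h : p + 1 ≤ q
      · have := ih (p + 1) (by push_cast at hk; omega)
        rw [ivl_cons _ h] at this ⊢
        exact List.isChain_cons_cons.2 ⟨adj p, this⟩
      · rw [ivl_nil _ (by omega)]; simp

end ivl

section LP
variable {G : SimpleGraph V} {u v u' v' w : V} {l l' : List V} {M M' : Multiset V}

theorem LP.rev (h : LP G u v l) : LP G v u l.reverse := by
  refine ⟨List.isChain_reverse.2 (h.1.imp fun _ _ => SimpleGraph.Adj.symm), ?_, ?_⟩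
  · rw [List.head?_reverse]; exact h.2.2
  · rw [List.getLast?_reverse]; exact h.2.1

theorem LP.app (h : LP G u v l) (a : G.Adj v u') (h' : LP G u' v' l') :
    LP G u v' (l ++ l') := by
  refine ⟨List.isChain_append.2 ⟨h.1, h'.1, ?_⟩, ?_, ?_⟩
  · intro x hx y hy
    rw [h.2.2] at hx; rw [h'.2.1] at hy
    simp only [Option.mem_def, Option.some.injEq] at hx hy
    subst hx; subst hy; exact a
  · rw [List.head?_append, h.2.1]; rfl
  · rw [List.getLast?_append, h'.2.2]; rfl

theorem LP.single (u : V) : LP G u u [u] := ⟨by simp, rfl, rfl⟩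

theorem LP.ne_nil (h : LP G u v l) : l ≠ [] := by
  rintro rfl; simpa using h.2.1

theorem LP.iv {c : ℤ → V} (adj : ∀ t, G.Adj (c t) (c (t + 1))) {p q : ℤ} (h : p ≤ q) :
    LP G (c p) (c q) (ivl c p q) :=
  ⟨chain_ivl c adj p q, head_ivl c h, getLast_ivl c h⟩

theorem LP.pt (h : LP G u v l) : PT G u v l := ⟨l, h, rfl⟩

theorem PT.rev (h : PT G u v M) : PT G v u M := by
  obtain ⟨l, h, rfl⟩ := h
  exact ⟨_, h.rev, by simp⟩

theorem PT.app (h : PT G u v M) (a : G.Adj v u') (h' : PT G u' v' M') : PT G u v' (M + M') := by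
  obtain ⟨l, h, rfl⟩ := h
  obtain ⟨l', h', rfl⟩ := h'
  exact ⟨_, h.app a h', by simp⟩

theorem PT.card_pos (h : PT G u v M) : 1 ≤ M.card := by
  obtain ⟨l, h, rfl⟩ := h
  have := List.length_pos_iff.2 h.ne_nil
  simpa [Nat.one_le_iff_ne_zero, Nat.pos_iff_ne_zero] using this

theorem LP.prefix_of (h : LP G u v (l ++ w :: l')) : LP G u w (l ++ [w]) := by
  refine ⟨?_, ?_, by simp⟩
  · exact (List.isChain_split.1 h.1).1
  · have := h.2.1
    cases l <;> simpa using this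

theorem LP.suffix_of (h : LP G u v (l ++ w :: l')) : LP G w v (w :: l') := by
  refine ⟨(List.isChain_split.1 h.1).2, rfl, ?_⟩
  have := h.2.2
  rw [List.getLast?_append] at this
  simpa [List.getLast?_cons] using this

theorem LP.mem_right (h : LP G u v l) : v ∈ l := List.mem_of_getLast? h.2.2

theorem LP.mem_left (h : LP G u v l) : u ∈ l := List.mem_of_head? h.2.1

end LP

/-- `d` is a vertex of the list `X` which is not marked by `O` and whose successor, if there is
one, is not marked by `P`. -/
def Lost (P O : V → Prop) (X : List V) (d : V) : Prop :=
  ¬ O d ∧ ((∃ d', [d, d'] <:+: X ∧ ¬ P d') ∨ X.getLast? = some d)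

theorem nodup_next {X : List V} (hX : X.Nodup) {d a b : V} (h : [d, a] <:+: X)
    (h' : [d, b] <:+: X) : a = b := by
  induction X with
  | nil => simp at h
  | cons x X ih =>
    have hX' := List.nodup_cons.1 hX
    rw [List.infix_cons_iff] at h h'
    have key : ∀ {a : V}, [d, a] <:+: X → d ∈ X := fun h => h.subset (by simp)
    rcases h with h | h <;> rcases h' with h' | h'
    · cases X with
      | nil => simp at h
      | cons x' X =>
        simp at h h'
        rw [h.2, h'.2]
    · have h1 := key h'
      rw [List.cons_prefix_cons] at h
      rw [h.1] at h1
      exact absurd h1 hX'.1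
    · have h1 := key h
      rw [List.cons_prefix_cons] at h'
      rw [h'.1] at h1
      exact absurd h1 hX'.1
    · refine ih hX'.2 h ?_
      assumption

/-- Counting marks along a list: every slot carries at most one mark. -/
theorem count_slots {P O : V → Prop} {x : V} {X : List V} (hX : (x :: X).Nodup)
    (ex : ∀ d d', [d, d'] <:+: (x :: X) → O d → ¬ P d')
    (D : Finset V) (hD : ∀ d ∈ D, d ∈ x :: X ∧ Lost P O (x :: X) d) :
    X.countP (fun a => P a) + (x :: X).countP (fun a => O a) + D.card ≤ (x :: X).length := by
  induction X generalizing x D with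
  | nil =>
    have : D ⊆ {x} := fun d hd => by simpa using (hD d hd).1
    have h1 := Finset.card_le_card this
    simp only [Finset.card_singleton] at h1
    by_cases hO : O x
    · have : D = ∅ := by
        apply Finset.eq_empty_of_forall_notMem
        intro d hd
        have h2 := hD d hd
        have : d = x := by simpa using h2.1
        subst this
        exact h2.2.1 hO
      subst this
      simp [hO]
    · simp [hO]; exact h1
  | cons x' X ih =>
    have hX' := List.nodup_cons.1 hX
    have h1 := ih (x := x') hX'.2 (fun d d' h => ex d d' (List.infix_cons h)) (D.erase x) (by
      intro d hd
      have hd' := Finset.mem_erase.1 hd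
      have h2 := hD d hd'.2
      refine ⟨by simpa [hd'.1] using h2.1, h2.2.1, ?_⟩
      rcases h2.2.2 with ⟨d', h3, h4⟩ | h3
      · rw [List.infix_cons_iff] at h3
        rcases h3 with h3 | h3
        · rw [List.cons_prefix_cons] at h3
          exact absurd h3.1 hd'.1
        · exact Or.inl ⟨d', h3, h4⟩
      · right
        simpa [List.getLast?_cons_cons] using h3)
    have h2 : D.card ≤ (D.erase x).card + if x ∈ D then 1 else 0 := by
      split_ifs with h
      · rw [Finset.card_erase_of_mem h]; omega
      · rw [Finset.erase_eq_of_notMem h]; omega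
    have h3 : (if P x' then 1 else 0) + (if O x then 1 else 0) + (if x ∈ D then 1 else 0) ≤ 1 := by
      have hinf : [x, x'] <:+: x :: x' :: X := ⟨[], X, by simp⟩
      have hl : x ∈ D → ¬ O x ∧ ¬ P x' := by
        intro h
        obtain ⟨-, h4, h5⟩ := hD x h
        refine ⟨h4, ?_⟩
        rcases h5 with ⟨d', h5, h6⟩ | h5
        · rwa [nodup_next hX h5 hinf] at h6
        · have : x ∈ x' :: X := List.mem_of_getLast? (by simpa [List.getLast?_cons_cons] using h5)
          exact absurd this hX'.1
      have he := ex x x' hinf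
      by_cases hO : O x <;> by_cases hP : P x' <;> by_cases hx : x ∈ D <;> simp_all
    rw [List.countP_cons, List.countP_cons (a := x)]
    rw [List.length_cons]
    simp only [decide_eq_true_eq] at *
    omega

/-- `c` enumerates periodically a longest cycle of length `m`, `H` is a component of the rest of
the graph, and `A` is the set of vertices of the cycle with a neighbour in `H`. -/
structure Fr (G : SimpleGraph V) (m : ℕ) (c : ℤ → V) (H A : Finset V) : Prop where
  three : 3 ≤ m
  per : ∀ t, c (t + m) = c t
  inj : ∀ s t, c s = c t → (m : ℤ) ∣ s - t
  adj : ∀ t, G.Adj (c t) (c (t + 1))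
  mx : ∀ M, Cl G M → M.card ≤ m
  off : ∀ t, c t ∉ H
  memA : ∀ v, v ∈ A ↔ (∃ t, c t = v) ∧ ∃ x ∈ H, G.Adj v x
  conn : ∀ x ∈ H, ∀ y ∈ H, ∃ M, PT G x y M ∧ M.Nodup ∧ ∀ z ∈ M, z ∈ H
  nbr : ∀ x ∈ H, ∀ y, G.Adj x y → y ∈ H ∨ ∃ t, c t = y

/-- The vertices of the cycle, as a multiset. -/
def CM (m : ℕ) (c : ℤ → V) : Multiset V := (ivl c 1 m : List V)

/-- Some longest cycle misses, among the vertices of `c`, only `e`. -/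
def Om (G : SimpleGraph V) (m : ℕ) (c : ℤ → V) (e : V) : Prop :=
  ∃ M, Cl G M ∧ m ≤ M.card ∧ e ∉ M ∧ ∀ t, c t ≠ e → c t ∈ M

/-- The cycle is split into two paths, ending in vertices of `A`. -/
structure Spl (G : SimpleGraph V) (m : ℕ) (c : ℤ → V) (A : Finset V)
    (p a : V) (X : List V) (q b : V) (Y : List V) : Prop where
  hp : LP G p a X
  hq : LP G q b Y
  ha : a ∈ A
  hb : b ∈ A
  eq : (X : Multiset V) + (Y : Multiset V) = CM m c

theorem Spl.symm {G : SimpleGraph V} {m : ℕ} {c : ℤ → V} {A : Finset V}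
    {p a q b : V} {X Y : List V} (h : Spl G m c A p a X q b Y) : Spl G m c A q b Y p a X :=
  ⟨h.hq, h.hp, h.hb, h.ha, by rw [add_comm]; exact h.eq⟩

theorem card_CM (m : ℕ) (c : ℤ → V) : (CM m c).card = m := by
  rw [CM, Multiset.coe_card, length_ivl]; omega

namespace Fr
variable {G : SimpleGraph V} {m : ℕ} {c : ℤ → V} {H A : Finset V} (F : Fr G m c H A)
include F

theorem per_iff (s t : ℤ) : c s = c t ↔ (m : ℤ) ∣ s - t := by
  refine ⟨F.inj s t, fun ⟨k, hk⟩ => ?_⟩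
  have key : ∀ (k : ℕ) (t : ℤ), c (t + m * k) = c t := by
    intro k
    induction k with
    | zero => simp
    | succ k ih => intro t; rw [← ih t, ← F.per (t + m * k)]; congr 1; push_cast; ring
  obtain ⟨n, rfl | rfl⟩ := k.eq_nat_or_neg
  · rw [← key n t]; congr 1; linarith
  · rw [← key n s]; congr 1; linarith

theorem per_sub (t : ℤ) : c (t - m) = c t := by
  rw [← F.per (t - m)]; congr 1; ring

theorem inj_of {s t : ℤ} (h : c s = c t) (h1 : s < t + m) (h2 : t < s + m) : s = t := by
  obtain ⟨k, hk⟩ := F.inj s t h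
  have hm := F.three
  have : k = 0 := by
    by_contra h0
    rcases lt_or_gt_of_ne h0 with h0 | h0 <;> nlinarith
  subst this; linarith

theorem ne_of {s t : ℤ} (h : s < t) (h' : t < s + m) : c s ≠ c t := fun e => by
  have := F.inj_of e (by omega) (by omega); omega

theorem full_succ (α : ℤ) : ((ivl c (α + 1 + 1) (α + 1 + m) : List V) : Multiset V)
    = (ivl c (α + 1) (α + m) : List V) := by
  have hm := F.three
  rw [ivl_cons c (p := α + 1) (by omega), ivl_concat c (p := α + 1 + 1) (by omega), F.per,
    show α + 1 + m - 1 = α + m by ring]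
  exact Multiset.coe_eq_coe.2 (List.perm_append_singleton _ _)

theorem full (α : ℤ) : ((ivl c (α + 1) (α + m) : List V) : Multiset V) = CM m c := by
  have key : ∀ (k : ℕ) (α : ℤ), ((ivl c (α + k + 1) (α + k + m) : List V) : Multiset V)
      = (ivl c (α + 1) (α + m) : List V) := by
    intro k
    induction k with
    | zero => simp
    | succ k ih =>
      intro α
      rw [← ih α, ← F.full_succ (α + k)]
      congr 2 <;> push_cast <;> ring
  rw [CM]
  obtain ⟨n, rfl | rfl⟩ := α.eq_nat_or_neg
  · have := key n 0; simpa using this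
  · have := key n (-n); simp at this; simpa using this.symm

theorem nodup_CM : (CM m c).Nodup := by
  rw [CM, Multiset.coe_nodup, ivl]
  refine List.Nodup.map_on ?_ List.nodup_range
  intro i hi j hj h
  have hi := List.mem_range.1 hi
  have hj := List.mem_range.1 hj
  have := F.inj_of h (by omega) (by omega)
  omega

theorem mem_full (α : ℤ) {x : V} : x ∈ CM m c ↔ ∃ t, α < t ∧ t ≤ α + m ∧ c t = x := by
  rw [← F.full α, Multiset.mem_coe, mem_ivl]
  constructor
  · rintro ⟨t, h1, h2, h3⟩; exact ⟨t, by omega, h2, h3⟩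
  · rintro ⟨t, h1, h2, h3⟩; exact ⟨t, by omega, h2, h3⟩

theorem rep (α s : ℤ) : ∃ t, α < t ∧ t ≤ α + m ∧ c t = c s := by
  have hm := F.three
  have hm0 : (0 : ℤ) < m := by omega
  refine ⟨α + 1 + (s - α - 1) % m, ?_, ?_, ?_⟩
  · have := Int.emod_nonneg (s - α - 1) hm0.ne'; omega
  · have := Int.emod_lt_of_pos (s - α - 1) hm0; omega
  · rw [F.per_iff]
    refine ⟨-((s - α - 1) / m), ?_⟩
    have := Int.emod_add_mul_ediv (s - α - 1) m
    linarith

theorem mem_CM {x : V} : x ∈ CM m c ↔ ∃ t, c t = x := by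
  rw [F.mem_full 0]
  constructor
  · rintro ⟨t, -, -, h⟩; exact ⟨t, h⟩
  · rintro ⟨t, rfl⟩; exact F.rep 0 t

theorem through {a b : V} (ha : a ∈ A) (hb : b ∈ A) : ∃ x y M, PT G x y M ∧ M.Nodup ∧
    (∀ z ∈ M, z ∈ H) ∧ G.Adj a x ∧ G.Adj b y := by
  obtain ⟨-, x, hx, hax⟩ := (F.memA a).1 ha
  obtain ⟨-, y, hy, hby⟩ := (F.memA b).1 hb
  obtain ⟨M, h1, h2, h3⟩ := F.conn x hx y hy
  exact ⟨x, y, M, h1, h2, h3, hax, hby⟩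

theorem join {p a q b : V} {X Y : Multiset V} (hX : PT G p a X) (hY : PT G q b Y)
    (ha : a ∈ A) (hb : b ∈ A) (hXY : (X + Y).Nodup) (hC : ∀ x ∈ X + Y, x ∈ CM m c) :
    ∃ M N, PT G p q M ∧ M.Nodup ∧ X + Y + N = M ∧ 1 ≤ N.card ∧ ∀ z ∈ N, z ∈ H := by
  obtain ⟨x, y, N, h1, h2, h3, h4, h5⟩ := F.through ha hb
  refine ⟨_, N, (hX.app h4 h1).app h5.symm hY.rev, ?_, by abel, h1.card_pos, h3⟩
  have : X + N + Y = X + Y + N := by abel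
  rw [this, Multiset.nodup_add]
  refine ⟨hXY, h2, Multiset.disjoint_left.2 fun {z} hz hz' => ?_⟩
  obtain ⟨t, rfl⟩ := F.mem_CM.1 (hC z hz)
  exact F.off t (h3 _ hz')

theorem sp {p a q b : V} {X Y : Multiset V} (hX : PT G p a X) (hY : PT G q b Y)
    (ha : a ∈ A) (hb : b ∈ A) (h : X + Y = CM m c) : ¬ G.Adj p q := by
  intro hpq
  obtain ⟨M, N, h1, h2, h3, h4, -⟩ := F.join hX hY ha hb (h ▸ F.nodup_CM) (fun x hx => h ▸ hx)
  have hc : M.card = m + N.card := by rw [← h3, h, Multiset.card_add, card_CM m c]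
  have hm := F.three
  have := F.mx M ⟨h2, by omega, p, q, h1, hpq.symm⟩
  omega

theorem om {p a q b e : V} {X Y : Multiset V} (hX : PT G p a X) (hY : PT G q b Y)
    (ha : a ∈ A) (hb : b ∈ A) (h : X + Y + {e} = CM m c) (hpq : G.Adj p q) : Om G m c e := by
  have hnd := F.nodup_CM
  rw [← h, Multiset.nodup_add] at hnd
  obtain ⟨M, N, h1, h2, h3, h4, h5⟩ := F.join hX hY ha hb hnd.1
    (fun x hx => h ▸ Multiset.mem_add.2 (Or.inl hx))
  have hc : M.card + 1 = m + N.card := by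
    rw [← h3, Multiset.card_add, ← card_CM m c, ← h, Multiset.card_add (X + Y) {e},
      Multiset.card_singleton]; omega
  have hm := F.three
  refine ⟨M, ⟨h2, by omega, p, q, h1, hpq.symm⟩, by omega, ?_, ?_⟩
  · rw [← h3, Multiset.mem_add]
    rintro (h6 | h6)
    · exact Multiset.disjoint_left.1 hnd.2.2 h6 (by simp)
    · have : e ∈ CM m c := h ▸ Multiset.mem_add.2 (Or.inr (by simp))
      obtain ⟨t, rfl⟩ := F.mem_CM.1 this
      exact F.off t (h5 _ h6)
  · intro t ht
    have : c t ∈ CM m c := F.mem_CM.2 ⟨t, rfl⟩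
    rw [← h, Multiset.mem_add] at this
    rcases this with h6 | h6
    · rw [← h3, Multiset.mem_add]; exact Or.inl h6
    · exact absurd (by simpa using h6) ht

end Fr

namespace Spl
variable {G : SimpleGraph V} {m : ℕ} {c : ℤ → V} {H A : Finset V} {p a q b : V} {X Y : List V}

theorem nadj (S : Spl G m c A p a X q b Y) (F : Fr G m c H A) : ¬ G.Adj p q :=
  F.sp S.hp.pt S.hq.pt S.ha S.hb S.eq

theorem excl (S : Spl G m c A p a X q b Y) (F : Fr G m c H A) {d d' : V}
    (h : [d, d'] <:+: X) (h1 : G.Adj q d) : ¬ G.Adj p d' := by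
  intro h2
  obtain ⟨l, l', rfl⟩ := h
  have e : l ++ [d, d'] ++ l' = l ++ d :: d' :: l' := by simp
  have e' : l ++ [d, d'] ++ l' = (l ++ [d]) ++ d' :: l' := by simp
  have hp := S.hp
  have h3 : LP G p d (l ++ [d]) := by rw [e] at hp; exact hp.prefix_of
  have h4 : LP G d' a (d' :: l') := by rw [e'] at hp; exact hp.suffix_of
  have h5 := h3.rev.pt.app h2 h4.pt
  refine F.sp h5 S.hq.pt S.ha S.hb ?_ h1.symm
  rw [← S.eq, e]
  simp only [Multiset.coe_reverse, ← Multiset.coe_add, ← Multiset.cons_coe, Multiset.coe_nil,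
    ← Multiset.singleton_add]
  abel

theorem excl_om (S : Spl G m c A p a X q b Y) (F : Fr G m c H A) {d e d' : V}
    (h : [d, e, d'] <:+: X) (h1 : G.Adj q d) (h2 : G.Adj p d') : Om G m c e := by
  obtain ⟨l, l', rfl⟩ := h
  have e1 : l ++ [d, e, d'] ++ l' = l ++ d :: e :: d' :: l' := by simp
  have e2 : l ++ [d, e, d'] ++ l' = (l ++ [d, e]) ++ d' :: l' := by simp
  have hp := S.hp
  have h3 : LP G p d (l ++ [d]) := by rw [e1] at hp; exact hp.prefix_of
  have h4 : LP G d' a (d' :: l') := by rw [e2] at hp; exact hp.suffix_of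
  have h5 := h3.rev.pt.app h2 h4.pt
  refine F.om h5 S.hq.pt S.ha S.hb ?_ h1.symm
  rw [← S.eq, e1]
  simp only [Multiset.coe_reverse, ← Multiset.coe_add, ← Multiset.cons_coe, Multiset.coe_nil,
    ← Multiset.singleton_add]
  abel

/-- Walking along the whole cycle from `q` through `p`. -/
theorem pass (S : Spl G m c A p a X q b Y) (F : Fr G m c H A) (hbp : G.Adj b p) {l l' : List V}
    {d e : V} (hd : d ∈ A) (h : Y ++ X = l ++ d :: e :: l') : ¬ G.Adj q e := by
  have hZ := S.hq.app hbp S.hp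
  have hZ' := hZ
  rw [h] at hZ
  rw [h, show l ++ d :: e :: l' = (l ++ [d]) ++ e :: l' by simp] at hZ'
  refine F.sp hZ.prefix_of.pt hZ'.suffix_of.pt hd S.ha ?_
  rw [← S.eq, add_comm (X : Multiset V), Multiset.coe_add Y, h]
  simp

theorem pass_om (S : Spl G m c A p a X q b Y) (F : Fr G m c H A) (hbp : G.Adj b p)
    {l l' : List V} {d e f : V} (hd : d ∈ A) (h : Y ++ X = l ++ d :: e :: f :: l')
    (hq : G.Adj q f) : Om G m c e := by
  have hZ := S.hq.app hbp S.hp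
  have hZ' := hZ
  rw [h] at hZ
  rw [h, show l ++ d :: e :: f :: l' = (l ++ [d, e]) ++ f :: l' by simp] at hZ'
  refine F.om hZ.prefix_of.pt hZ'.suffix_of.pt hd S.ha ?_ hq
  rw [← S.eq, add_comm (X : Multiset V), Multiset.coe_add Y, h]
  simp only [← Multiset.coe_add, ← Multiset.cons_coe, Multiset.coe_nil, ← Multiset.singleton_add]
  abel

theorem nodup (S : Spl G m c A p a X q b Y) (F : Fr G m c H A) : X.Nodup ∧ Y.Nodup := by
  have := F.nodup_CM
  rw [← S.eq, Multiset.nodup_add] at this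
  exact ⟨Multiset.coe_nodup.1 this.1, Multiset.coe_nodup.1 this.2.1⟩

theorem half (S : Spl G m c A p a X q b Y) (F : Fr G m c H A) (D : Finset V)
    (hD : ∀ d ∈ D, d ∈ X ∧ Lost (G.Adj p) (G.Adj q) X d) :
    X.countP (fun w => G.Adj p w) + X.countP (fun w => G.Adj q w) + D.card ≤ X.length := by
  have h1 := S.hp.2.1
  cases X with
  | nil => simp at h1
  | cons x X =>
    simp only [List.head?_cons, Option.some.injEq] at h1
    subst h1
    have h2 := count_slots (S.nodup F).1 (fun d d' h h1 => S.excl F h h1) D hD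
    rw [List.countP_cons]
    simpa using h2

theorem count [Fintype V] (S : Spl G m c A p a X q b Y) (F : Fr G m c H A)
    (hp : ∀ w, G.Adj p w → ∃ t, c t = w) (hq : ∀ w, G.Adj q w → ∃ t, c t = w) (D : Finset V)
    (hD : ∀ d ∈ D, (d ∈ X ∧ Lost (G.Adj p) (G.Adj q) X d) ∨
      (d ∈ Y ∧ Lost (G.Adj q) (G.Adj p) Y d)) :
    deg G p + deg G q + D.card ≤ m := by
  have h1 := S.half F (D.filter fun d => d ∈ X ∧ Lost (G.Adj p) (G.Adj q) X d)
    (fun d hd => (Finset.mem_filter.1 hd).2)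
  have h2 := S.symm.half F (D.filter fun d => d ∈ Y ∧ Lost (G.Adj q) (G.Adj p) Y d)
    (fun d hd => (Finset.mem_filter.1 hd).2)
  have h3 : D.card ≤ (D.filter fun d => d ∈ X ∧ Lost (G.Adj p) (G.Adj q) X d).card +
      (D.filter fun d => d ∈ Y ∧ Lost (G.Adj q) (G.Adj p) Y d).card := by
    refine le_trans (Finset.card_le_card fun d hd => ?_) (Finset.card_union_le _ _)
    simp only [Finset.mem_union, Finset.mem_filter]
    rcases hD d hd with h | h
    · exact Or.inl ⟨hd, h⟩
    · exact Or.inr ⟨hd, h⟩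
  have hdeg : ∀ v, (∀ w, G.Adj v w → ∃ t, c t = w) →
      deg G v = X.countP (fun w => G.Adj v w) + Y.countP (fun w => G.Adj v w) := by
    intro v hv
    have e : G.neighborSet v = (((CM m c).filter (G.Adj v)).toFinset : Finset V) := by
      ext w
      simp only [SimpleGraph.mem_neighborSet, Finset.mem_coe, Multiset.mem_toFinset,
        Multiset.mem_filter]
      exact ⟨fun h => ⟨F.mem_CM.2 (hv w h), h⟩, fun h => h.2⟩
    rw [deg, e, Set.ncard_coe_finset, Multiset.toFinset_card_of_nodup (F.nodup_CM.filter _),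
      ← Multiset.countP_eq_card_filter, ← S.eq, Multiset.countP_add, Multiset.coe_countP,
      Multiset.coe_countP]
  have h4 : X.length + Y.length = m := by
    rw [← card_CM m c, ← S.eq, Multiset.card_add]; rfl
  rw [hdeg p hp, hdeg q hq]
  omega

end Spl

theorem OneTough.card_image_le [Fintype V] {G : SimpleGraph V} (h : OneTough G) {T : Finset V}
    (hT : T.Nonempty) {β : Type*} (f : V → β)
    (hf : ∀ v w, v ∉ T → w ∉ T → G.Adj v w → f v = f w) (B : Finset β)
    (hB : ∀ b ∈ B, ∃ v, v ∉ T ∧ f v = b) : B.card ≤ T.card := by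
  have h1 := h (T : Set V) (by simpa using hT)
  rw [Set.ncard_coe_finset] at h1
  refine le_trans ?_ h1
  let g : (G.induce (T : Set V)ᶜ).ConnectedComponent → β :=
    SimpleGraph.ConnectedComponent.lift (fun v => f v.1) (by
      intro v w p _
      clear * - hf p
      induction p with
      | nil => rfl
      | @cons v w _ hvw p ih => exact (hf _ _ v.2 w.2 hvw).trans ih)
  have h2 : ∀ b : B, ∃ k, g k = b.1 := by
    rintro ⟨b, hb⟩
    obtain ⟨v, hv, rfl⟩ := hB b hb
    exact ⟨(G.induce (T : Set V)ᶜ).connectedComponentMk ⟨v, by simpa using hv⟩, rfl⟩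
  choose k hk using h2
  have h3 : Function.Injective k := by
    intro a b hab
    apply Subtype.ext
    rw [← hk a, ← hk b, hab]
  have := Nat.card_le_card_of_injective k h3
  simpa using this

theorem Om.mirror {G : SimpleGraph V} {m : ℕ} {c : ℤ → V} {e : V}
    (h : Om G m (fun t => c (-t)) e) : Om G m c e := by
  obtain ⟨M, h1, h2, h3, h4⟩ := h
  exact ⟨M, h1, h2, h3, fun t ht => by simpa using h4 (-t) (by simpa using ht)⟩

theorem Fr.mirror {G : SimpleGraph V} {m : ℕ} {c : ℤ → V} {H A : Finset V}
    (F : Fr G m c H A) : Fr G m (fun t => c (-t)) H A where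
  three := F.three
  per t := by
    simp only [show -(t + (m : ℤ)) = -t - m by ring]
    exact F.per_sub _
  inj s t h := by
    have := F.inj _ _ h
    rw [show -s - -t = -(s - t) by ring, dvd_neg] at this
    exact this
  adj t := by
    have := F.adj (-(t + 1))
    rw [show -(t + 1) + 1 = -t by ring] at this
    exact this.symm
  mx := F.mx
  off t := F.off _
  memA v := by
    rw [F.memA]
    refine and_congr_left fun _ => ⟨fun ⟨t, h⟩ => ⟨-t, by simpa using h⟩, fun ⟨t, h⟩ => ⟨-t, h⟩⟩
  conn := F.conn
  nbr x hx y h := (F.nbr x hx y h).imp id fun ⟨t, h⟩ => ⟨-t, by simpa using h⟩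

/-- The situation in which all vertices off the cycle form one component. -/
structure Mn [Fintype V] (G : SimpleGraph V) (m : ℕ) (c : ℤ → V) (H A : Finset V) : Prop
    extends Fr G m c H A where
  all : ∀ v, v ∈ H ∨ ∃ t, c t = v
  two : 2 ≤ A.card
  tough : OneTough G
  ki : ∀ s t, c s ∉ A → c t ∉ A → c s ≠ c t → ¬ G.Adj (c s) (c t) →
    m + 1 ≤ deg G (c s) + deg G (c t) + A.card
  om1 : ∀ t, c t ∉ A → Om G m c (c t) →
    H.card = 1 ∧ 3 * deg G (c t) ≤ m ∧ 3 * A.card ≤ m ∧ deg G (c t) ≤ A.card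

theorem Mn.mirror [Fintype V] {G : SimpleGraph V} {m : ℕ} {c : ℤ → V} {H A : Finset V}
    (F : Mn G m c H A) : Mn G m (fun t => c (-t)) H A where
  toFr := F.toFr.mirror
  all v := (F.all v).imp id fun ⟨t, h⟩ => ⟨-t, by simpa using h⟩
  two := F.two
  tough := F.tough
  ki s t := F.ki _ _
  om1 t h h' := F.om1 _ h h'.mirror

namespace Fr
variable {G : SimpleGraph V} {m : ℕ} {c : ℤ → V} {H A : Finset V} (F : Fr G m c H A)
include F

theorem exists_pred {T : Finset V} {τ : ℤ} (hτ : c τ ∈ T) (s : ℤ) (hs : c s ∉ T) :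
    ∃ α, s - m < α ∧ α < s ∧ c α ∈ T ∧ ∀ r, α < r → r ≤ s → c r ∉ T := by
  obtain ⟨τ', h1, h2, h3⟩ := F.rep (s - m) τ
  rw [← h3] at hτ
  let B := (Finset.Ioc (s - m) s).filter fun r => c r ∈ T
  have hB : B.Nonempty := ⟨τ', by
    simp only [B, Finset.mem_filter, Finset.mem_Ioc]; exact ⟨by omega, hτ⟩⟩
  obtain ⟨α, hα, hmax⟩ : ∃ α ∈ B, ∀ r ∈ B, r ≤ α := ⟨B.max' hB, B.max'_mem hB, B.le_max'⟩
  simp only [B, Finset.mem_filter, Finset.mem_Ioc] at hα hmax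
  refine ⟨α, hα.1.1, ?_, hα.2, fun r h4 h5 h6 => ?_⟩
  · rcases lt_or_eq_of_le hα.1.2 with h | rfl
    · exact h
    · exact absurd hα.2 hs
  · have := hmax r ⟨⟨by omega, h5⟩, h6⟩
    omega

theorem exists_succ {T : Finset V} {τ : ℤ} (hτ : c τ ∈ T) (s : ℤ) (hs : c s ∉ T) :
    ∃ α, s < α ∧ α < s + m ∧ c α ∈ T ∧ ∀ r, s ≤ r → r < α → c r ∉ T := by
  obtain ⟨α, h1, h2, h3, h4⟩ := F.mirror.exists_pred (T := T) (τ := -τ) (by simpa using hτ) (-s)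
    (by simpa using hs)
  exact ⟨-α, by omega, by omega, h3, fun r h5 h6 => by simpa using h4 (-r) (by omega) (by omega)⟩

theorem pred_unique {T : Finset V} {α β s t : ℤ} (h : c s = c t) (h1 : α < s) (h2 : β < t)
    (h3 : c α ∈ T) (h4 : c β ∈ T) (h5 : ∀ r, α < r → r ≤ s → c r ∉ T)
    (h6 : ∀ r, β < r → r ≤ t → c r ∉ T) : c α = c β := by
  obtain ⟨k, hk⟩ := F.inj _ _ h
  have e : c (β + m * k) = c β := (F.per_iff _ _).2 ⟨k, by ring⟩
  have e' : c (α - m * k) = c α := (F.per_iff _ _).2 ⟨-k, by ring⟩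
  rcases lt_trichotomy α (β + m * k) with h7 | h7 | h7
  · exact absurd (e ▸ h4) (h5 _ h7 (by omega))
  · rw [h7, e]
  · exact absurd (e' ▸ h3) (h6 (α - m * k) (by omega) (by omega))

end Fr

/-- If deleting `T` separates the cycle into `T.card` segments, then, besides `H`, some edge joins
two different segments. -/
theorem Mn.crossing [Fintype V] {G : SimpleGraph V} {m : ℕ} {c : ℤ → V} {H A : Finset V}
    (F : Mn G m c H A) {T : Finset V} (hT : ∀ v ∈ T, ∃ t, c t = v) (hAT : A ⊆ T)
    (hc : ∀ t, c t ∈ T → c (t + 1) ∉ T) :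
    ∃ α β s t : ℤ, α < s ∧ s < β ∧ β < t ∧ t < α + m ∧ c α ∈ T ∧ c β ∈ T ∧
      (∀ r, α < r → r ≤ s → c r ∉ T) ∧ (∀ r, β < r → r ≤ t → c r ∉ T) ∧ G.Adj (c s) (c t) := by
  have hA : A.Nonempty := Finset.card_pos.1 (by have := F.two; omega)
  obtain ⟨a0, ha0⟩ := hA
  obtain ⟨τ, hτ⟩ := hT a0 (hAT ha0)
  have hτT : c τ ∈ T := hτ ▸ hAT ha0
  have hex : ∀ v, v ∉ T → v ∉ H → ∃ a, ∃ α s, c α = a ∧ c s = v ∧ α < s ∧ c α ∈ T ∧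
      ∀ r, α < r → r ≤ s → c r ∉ T := by
    intro v hv hvH
    obtain ⟨s, rfl⟩ := (F.all v).resolve_left hvH
    obtain ⟨α, -, h2, h3, h4⟩ := F.exists_pred hτT s hv
    exact ⟨_, α, s, rfl, rfl, h2, h3, h4⟩
  choose! g hg using hex
  let f : V → Option V := fun v => if v ∈ H then none else some (g v)
  by_contra hcon
  have hf : ∀ v w, v ∉ T → w ∉ T → G.Adj v w → f v = f w := by
    intro v w hv hw hvw
    by_cases h1 : v ∈ H
    · by_cases h2 : w ∈ H
      · simp [f, h1, h2]
      · obtain ⟨t, rfl⟩ := (F.all w).resolve_left h2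
        exact absurd (hAT ((F.memA _).2 ⟨⟨t, rfl⟩, v, h1, hvw.symm⟩)) hw
    · by_cases h2 : w ∈ H
      · obtain ⟨t, rfl⟩ := (F.all v).resolve_left h1
        exact absurd (hAT ((F.memA _).2 ⟨⟨t, rfl⟩, w, h2, hvw⟩)) hv
      · simp only [f, h1, h2, if_false, Option.some.injEq]
        by_contra hne
        obtain ⟨α, s, hα, hs, h3, h4, h5⟩ := hg v hv h1
        obtain ⟨β, t, hβ, ht, h6, h7, h8⟩ := hg w hw h2
        obtain ⟨β', h9, h10, h11⟩ := F.rep α β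
        have hk := F.inj _ _ h11
        obtain ⟨k, hk⟩ := hk
        have e : ∀ r, c (r + m * k) = c r := fun r => (F.per_iff _ _).2 ⟨k, by ring⟩
        have e2 : ∀ r, c (r - m * k) = c r := fun r => (F.per_iff _ _).2 ⟨-k, by ring⟩
        have h12 : β' ≠ α + m := by
          rintro rfl
          rw [F.per, hα, hβ] at h11
          exact hne h11
        refine hcon ⟨α, β', s, t + m * k, h3, ?_, by omega, ?_, h4, h11 ▸ h7, h5, ?_, ?_⟩
        · by_contra h13
          exact h5 β' h9 (by omega) (h11 ▸ h7)
        · by_contra h13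
          refine h8 (α + m - m * k) (by omega) (by omega) ?_
          rw [e2, F.per]; exact h4
        · intro r h13 h14
          rw [← e2 r]
          exact h8 _ (by omega) (by omega)
        · rw [e, hs, ht]; exact hvw
  have h1 := F.tough.card_image_le ⟨_, hτT⟩ f hf (insert none (T.image some)) (by
    intro b hb
    rw [Finset.mem_insert] at hb
    rcases hb with rfl | hb
    · obtain ⟨-, x, hx, -⟩ := (F.memA a0).1 ha0
      refine ⟨x, fun hxT => ?_, by simp [f, hx]⟩
      obtain ⟨t, rfl⟩ := hT x hxT
      exact F.off t hx
    · obtain ⟨a, ha, rfl⟩ := Finset.mem_image.1 hb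
      obtain ⟨α, rfl⟩ := hT a ha
      refine ⟨c (α + 1), hc α ha, ?_⟩
      have h2 := F.off (α + 1)
      simp only [f, h2, if_false, Option.some.injEq]
      obtain ⟨β, t, hβ, ht, h6, h7, h8⟩ := hg _ (hc α ha) h2
      rw [← hβ]
      refine F.pred_unique ht h6 (by omega : α < α + 1) h7 ha h8 fun r h9 h10 => ?_
      rw [show r = α + 1 by omega]; exact hc α ha)
  rw [Finset.card_insert_of_notMem (by simp), Finset.card_image_of_injective _
    (Option.some_injective V)] at h1
  omega

/-- For the pair of paths `c (α + 1), …, c β` and `c (β + 1), …, c α`, the slot at `t` on the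
first one carries no mark. -/
def BL (G : SimpleGraph V) (c : ℤ → V) (α β t : ℤ) : Prop :=
  α < t ∧ t < β ∧ ¬ G.Adj (c (β + 1)) (c t) ∧ ¬ G.Adj (c (α + 1)) (c (t + 1))

/-- The slot at `t` of the pair `α, β` carries no mark. -/
def LI (G : SimpleGraph V) (m : ℕ) (c : ℤ → V) (α β t : ℤ) : Prop :=
  BL G c α β t ∨ BL G c β (α + m) t

theorem BL.lost {G : SimpleGraph V} {c : ℤ → V} {α β t : ℤ} (h : BL G c α β t) :
    c t ∈ ivl c (α + 1) β ∧
      Lost (G.Adj (c (α + 1))) (G.Adj (c (β + 1))) (ivl c (α + 1) β) (c t) :=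
  ⟨(mem_ivl c).2 ⟨t, by have := h.1; omega, h.2.1.le, rfl⟩, h.2.2.1,
    Or.inl ⟨_, infix_ivl c (by have := h.1; omega) (by have := h.2.1; omega), h.2.2.2⟩⟩

namespace Fr
variable {G : SimpleGraph V} {m : ℕ} {c : ℤ → V} {H A : Finset V} (F : Fr G m c H A)
include F

theorem memA_add {α : ℤ} (h : c α ∈ A) : c (α + m) ∈ A := by rwa [F.per]

theorem per_add (α i : ℤ) : c (α + m + i) = c (α + i) := by
  rw [show α + m + i = α + i + m by ring, F.per]

theorem basic {α β : ℤ} (hα : c α ∈ A) (hβ : c β ∈ A) (h : α < β) (h' : β < α + m) :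
    Spl G m c A (c (α + 1)) (c β) (ivl c (α + 1) β)
      (c (β + 1)) (c (α + m)) (ivl c (β + 1) (α + m)) :=
  ⟨LP.iv F.adj (by omega), LP.iv F.adj (by omega), hβ, F.memA_add hα, by
    rw [← F.full α, ivl_append c (p := α + 1) (r := β) (q := α + m) (by omega) (by omega),
      Multiset.coe_add]⟩

theorem uu {α β : ℤ} (hα : c α ∈ A) (hβ : c β ∈ A) (h : α < β) (h' : β < α + m) :
    ¬ G.Adj (c (α + 1)) (c (β + 1)) :=
  (F.basic hα hβ h h').nadj F

theorem no_two {α : ℤ} (hα : c α ∈ A) : c (α + 1) ∉ A := by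
  intro h
  have hm := F.three
  refine F.sp (X := (ivl c (α + 2) (α + m) : List V)) (Y := ([c (α + 1)] : List V))
    (LP.iv F.adj (by omega)).pt (LP.single _).pt (F.memA_add hα) h ?_ (?_ : G.Adj (c (α + 2)) _)
  · rw [← F.full α, ivl_cons c (p := α + 1) (by omega), show α + 1 + 1 = α + 2 by ring]
    simp only [← Multiset.cons_coe, Multiset.coe_nil, ← Multiset.singleton_add]
    abel
  · have := F.adj (α + 1)
    rw [show α + 1 + 1 = α + 2 by ring] at this
    exact this.symm

theorem om_single {α : ℤ} (hα : c α ∈ A) (h : c (α + 2) ∈ A) : Om G m c (c (α + 1)) := by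
  have hm := F.three
  refine F.om (X := (ivl c (α + 3) (α + m) : List V)) (Y := ([c (α + 2)] : List V))
    (LP.iv F.adj (by omega)).pt (LP.single _).pt (F.memA_add hα) h ?_ (?_ : G.Adj (c (α + 3)) _)
  · rw [← F.full α, ivl_cons c (p := α + 1) (by omega), show α + 1 + 1 = α + 2 by ring,
      ivl_cons c (p := α + 2) (by omega), show α + 2 + 1 = α + 3 by ring]
    simp only [← Multiset.cons_coe, Multiset.coe_nil, ← Multiset.singleton_add]
    abel
  · have := F.adj (α + 2)
    rw [show α + 2 + 1 = α + 3 by ring] at this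
    exact this.symm

theorem lt_of_lt {α β : ℤ} (hα : c α ∈ A) (hβ : c β ∈ A) (h : α < β) : α + 2 ≤ β := by
  by_contra h1
  have : β = α + 1 := by omega
  exact F.no_two hα (this ▸ hβ)

theorem r2 {α β : ℤ} (hα : c α ∈ A) (hβ : c β ∈ A) (h : α < β) (h' : β < α + m)
    (ho : ¬ Om G m c (c (α + 1))) : ¬ G.Adj (c (β + 1)) (c (α + 2)) := by
  intro hadj
  have h2 := F.lt_of_lt hα hβ h
  refine ho (F.om (X := (ivl c (α + 2) β : List V)) (Y := (ivl c (β + 1) (α + m) : List V))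
    (LP.iv F.adj (by omega)).pt (LP.iv F.adj (by omega)).pt hβ (F.memA_add hα) ?_ hadj.symm)
  rw [← F.full α, ivl_cons c (p := α + 1) (by omega), show α + 1 + 1 = α + 2 by ring,
    ivl_append c (p := α + 2) (r := β) (q := α + m) (by omega) (by omega)]
  simp only [← Multiset.cons_coe, ← Multiset.coe_add, ← Multiset.singleton_add]
  abel

theorem r2' {α β : ℤ} (hα : c α ∈ A) (hβ : c β ∈ A) (h : α < β) (h' : β < α + m)
    (ho : ¬ Om G m c (c (β + 1))) : ¬ G.Adj (c (α + 1)) (c (β + 2)) := by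
  have := F.r2 hβ (F.memA_add hα) h' (by omega) ho
  rwa [F.per_add] at this

theorem structural {α β t : ℤ} (hα : c α ∈ A) (hβ : c β ∈ A) (h' : β < α + m)
    (ht : c t ∈ A) (h1 : α < t) (h2 : t < β) (ho : ¬ Om G m c (c (t + 1))) :
    BL G c α β (t + 1) := by
  have h3 := F.lt_of_lt ht hβ h2
  refine ⟨by omega, by omega, fun h => F.uu ht hβ h2 (by omega) h.symm, ?_⟩
  rw [show t + 1 + 1 = t + 2 by ring]
  exact F.r2' hα ht h1 (by omega) ho

theorem pair_count_aux [Fintype V] {α β : ℤ} (hα : c α ∈ A) (hβ : c β ∈ A) (h : α < β)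
    (h' : β < α + m)
    (hp : ∀ w, G.Adj (c (α + 1)) w → ∃ t, c t = w) (hq : ∀ w, G.Adj (c (β + 1)) w → ∃ t, c t = w)
    (E : Finset ℤ) (hE : ∀ t ∈ E, LI G m c α β t) :
    deg G (c (α + 1)) + deg G (c (β + 1)) + E.card ≤ m := by
  have hEb : ∀ t ∈ E, α < t ∧ t < α + m := by
    intro t ht
    rcases hE t ht with h1 | h1 <;> have := h1.1 <;> have := h1.2.1 <;> constructor <;> omega
  have hc : (E.image c).card = E.card := Finset.card_image_of_injOn fun s hs t ht hst => by
    have h1 := hEb s hs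
    have h2 := hEb t ht
    exact F.inj_of hst (by omega) (by omega)
  rw [← hc]
  refine (F.basic hα hβ h h').count F hp hq _ fun d hd => ?_
  obtain ⟨t, ht, rfl⟩ := Finset.mem_image.1 hd
  rcases hE t ht with h1 | h1
  · exact Or.inl (h1.lost)
  · right
    have := h1.lost
    rwa [F.per_add] at this

theorem pair_count [Fintype V] {α β : ℤ} (hα : c α ∈ A) (hβ : c β ∈ A) (h : α < β)
    (h' : β < α + m)
    (hp : ∀ w, G.Adj (c (α + 1)) w → ∃ t, c t = w) (hq : ∀ w, G.Adj (c (β + 1)) w → ∃ t, c t = w)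
    (Λ : Finset ℤ) (hΛ : ∀ t ∈ Λ, α < t ∧ t < α + m ∧ t ≠ β ∧ c t ∈ A ∧ ¬ Om G m c (c (t + 1)))
    (E : Finset ℤ) (hE : ∀ t ∈ E, LI G m c α β t ∧ t - 1 ∉ Λ) :
    deg G (c (α + 1)) + deg G (c (β + 1)) + Λ.card + E.card ≤ m := by
  have h1 : Disjoint (Λ.image (· + 1)) E := Finset.disjoint_left.2 fun t ht ht' => by
    obtain ⟨s, hs, rfl⟩ := Finset.mem_image.1 ht
    have := (hE _ ht').2
    simp only [add_sub_cancel_right] at this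
    exact this hs
  have h2 := F.pair_count_aux hα hβ h h' hp hq (Λ.image (· + 1) ∪ E) (by
    intro t ht
    rcases Finset.mem_union.1 ht with ht | ht
    · obtain ⟨s, hs, rfl⟩ := Finset.mem_image.1 ht
      obtain ⟨h3, h4, h5, h6, h7⟩ := hΛ s hs
      rcases lt_or_gt_of_ne h5 with h8 | h8
      · exact Or.inl (F.structural hα hβ h' h6 h3 h8 h7)
      · exact Or.inr (F.structural hβ (F.memA_add hα) (by omega) h6 h8 h4 h7)
    · exact (hE t ht).1)
  rw [Finset.card_union_of_disjoint h1, Finset.card_image_of_injective _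
    (add_left_injective (1 : ℤ))] at h2
  omega

/-- The indices of the vertices of `A` in one period, apart from the end of the period. -/
theorem card_index {α : ℤ} (hα : c α ∈ A) :
    ((Finset.Ioo α (α + m)).filter fun t => c t ∈ A).card + 1 = A.card := by
  have hm := F.three
  have h1 : (insert (α + (m : ℤ)) ((Finset.Ioo α (α + m)).filter fun t => c t ∈ A)).image c =
      A := by
    ext v
    simp only [Finset.mem_image, Finset.mem_insert, Finset.mem_filter, Finset.mem_Ioo]
    constructor
    · rintro ⟨t, rfl | ⟨-, h⟩, rfl⟩
      · exact F.memA_add hα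
      · exact h
    · intro hv
      obtain ⟨⟨s, rfl⟩, -⟩ := (F.memA v).1 hv
      obtain ⟨t, h1, h2, h3⟩ := F.rep α s
      refine ⟨t, ?_, h3⟩
      rcases eq_or_lt_of_le h2 with h4 | h4
      · exact Or.inl h4
      · exact Or.inr ⟨⟨h1, h4⟩, h3 ▸ hv⟩
  have h2 := congrArg Finset.card h1
  rw [Finset.card_image_of_injOn, Finset.card_insert_of_notMem (by simp)] at h2
  · exact h2
  intro s hs t ht hst
  simp only [Finset.coe_insert, Set.mem_insert_iff, Finset.mem_coe, Finset.mem_filter,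
    Finset.mem_Ioo] at hs ht
  exact F.inj_of hst (by omega) (by omega)

theorem index_eq {α β t : ℤ} (hA : A.card = 2) (hα : c α ∈ A) (hβ : c β ∈ A) (h1 : α < β)
    (h2 : β < α + m) (h3 : α < t) (h4 : t < α + m) (ht : c t ∈ A) : t = β := by
  have h5 := F.card_index hα
  exact Finset.card_le_one.1 (show ((Finset.Ioo α (α + m)).filter fun t => c t ∈ A).card ≤ 1
    by omega) t (by simp [*]) β (by simp [*])

theorem same {s t : ℤ} (h : c s = c t) (i : ℤ) : c (s + i) = c (t + i) := by
  rw [F.per_iff] at h ⊢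
  rwa [show s + i - (t + i) = s - t by ring]

end Fr

namespace Mn
variable [Fintype V] {G : SimpleGraph V} {m : ℕ} {c : ℤ → V} {H A : Finset V}
  (F : Mn G m c H A)
include F

theorem nbrC {t : ℤ} (h : c t ∉ A) (w : V) (hw : G.Adj (c t) w) : ∃ s, c s = w := by
  refine (F.all w).resolve_left fun hwH => h ?_
  exact (F.memA _).2 ⟨⟨t, rfl⟩, w, hwH, hw⟩

/-- One step of the insertion argument: if the block `B`, consisting of `c (β + 1), …, c b`, fits
between `c t` and `c (t + 1)`, then the next vertex is adjacent to `c t` or to `c (t + 1)`. -/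
theorem insert_step {α β t b : ℤ} (hα : c α ∈ A) (hβ : c β ∈ A) (h' : β < α + m)
    (h1 : α < t) (h2 : t < β) (h3 : ∀ r, α < r → r ≤ t → c r ∉ A)
    (hb : β < b) (hb' : b + 1 < α + m) (h4 : ∀ r, β < r → r ≤ b + 1 → c r ∉ A)
    (Λ : Finset ℤ) (hΛ : ∀ t ∈ Λ, α < t ∧ t < α + m ∧ t ≠ β ∧ c t ∈ A ∧ ¬ Om G m c (c (t + 1)))
    (hnum : ¬ G.Adj (c (α + 1)) (c (b + 1)) →
      m < deg G (c (α + 1)) + deg G (c (b + 1)) + Λ.card + 2)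
    (hu : G.Adj (c (β + 1)) (c (t + 1))) {B : List V} {f g : V} (hB : LP G f g B)
    (hBe : (B : Multiset V) = (ivl c (β + 1) b : List V)) (hf : G.Adj (c t) f)
    (hg : G.Adj g (c (t + 1))) (huf : ¬ G.Adj (c (α + 1)) f) :
    ¬ G.Adj (c (α + 1)) (c (b + 1)) ∧
      (G.Adj (c (b + 1)) (c t) ∨ G.Adj (c (b + 1)) (c (t + 1))) := by
  have hS : Spl G m c A (c (α + 1)) (c β) (ivl c (α + 1) t ++ (B ++ ivl c (t + 1) β))
      (c (b + 1)) (c (α + m)) (ivl c (b + 1) (α + m)) := by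
    refine ⟨(LP.iv F.adj (by omega)).app hf (hB.app hg (LP.iv F.adj (by omega))),
      LP.iv F.adj (by omega), hβ, F.memA_add hα, ?_⟩
    rw [← F.full α, ivl_append c (p := α + 1) (r := t) (q := α + m) (by omega) (by omega),
      ivl_append c (p := t + 1) (r := β) (q := α + m) (by omega) (by omega),
      ivl_append c (p := β + 1) (r := b) (q := α + m) (by omega) (by omega)]
    simp only [← Multiset.coe_add, hBe]
    abel
  have hbp : G.Adj (c (α + m)) (c (α + 1)) := by rw [F.per]; exact F.adj α
  have hn := hS.nadj F.toFr
  refine ⟨hn, ?_⟩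
  by_contra hcon
  push Not at hcon
  obtain ⟨hc1, hc2⟩ := hcon
  have hΛt : ∀ s ∈ Λ, t + 1 ≤ s ∧ (s < β ∨ b + 1 < s) := by
    intro s hs
    obtain ⟨h5, h6, h7, h8, -⟩ := hΛ s hs
    refine ⟨?_, ?_⟩
    · by_contra h9
      exact h3 s h5 (by omega) h8
    · by_contra h9
      exact h4 s (by omega) (by omega) h8
  have hinj : Set.InjOn c (insert t (insert (t + 1) (Λ.image (· + 1))) : Finset ℤ) := by
    have hr : ∀ s ∈ insert t (insert (t + 1) (Λ.image (· + 1))), α < s ∧ s ≤ α + m := by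
      intro s hs
      simp only [Finset.mem_insert, Finset.mem_image] at hs
      rcases hs with rfl | rfl | ⟨s, hs, rfl⟩
      · omega
      · omega
      · have := hΛ s hs; omega
    intro s hs s' hs' hss
    have := hr s hs
    have := hr s' hs'
    exact F.inj_of hss (by omega) (by omega)
  have hcard : ((insert t (insert (t + 1) (Λ.image (· + 1)))).image c).card = Λ.card + 2 := by
    rw [Finset.card_image_of_injOn hinj, Finset.card_insert_of_notMem,
      Finset.card_insert_of_notMem, Finset.card_image_of_injective _ (add_left_injective (1 : ℤ))]
    · intro h
      obtain ⟨s, hs, h⟩ := Finset.mem_image.1 h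
      have := hΛt s hs
      omega
    · simp only [Finset.mem_insert, Finset.mem_image, not_or]
      refine ⟨by omega, ?_⟩
      rintro ⟨s, hs, h⟩
      have := hΛt s hs
      omega
  have hcnt := hS.count F.toFr (F.nbrC (F.no_two hα)) (F.nbrC (h4 _ (by omega) le_rfl))
    ((insert t (insert (t + 1) (Λ.image (· + 1)))).image c) ?_
  · have := hnum hn
    omega
  intro d hd
  obtain ⟨s, hs, rfl⟩ := Finset.mem_image.1 hd
  simp only [Finset.mem_insert, Finset.mem_image] at hs
  have hinf : ∀ L : List V, L <:+: ivl c (t + 1) β →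
      L <:+: ivl c (α + 1) t ++ (B ++ ivl c (t + 1) β) := fun L hL =>
    hL.trans ⟨ivl c (α + 1) t ++ B, [], by simp⟩
  rcases hs with rfl | rfl | ⟨s, hs, rfl⟩
  · left
    refine ⟨List.mem_append_left _ ((mem_ivl c).2 ⟨s, by omega, le_rfl, rfl⟩), hc1,
      Or.inl ⟨f, ?_, huf⟩⟩
    obtain ⟨B', rfl⟩ : ∃ B', B = f :: B' := by
      have := hB.2.1
      cases B with
      | nil => simp at this
      | cons x B' => exact ⟨B', by simpa using this⟩
    refine ⟨ivl c (α + 1) (s - 1), B' ++ ivl c (s + 1) β, ?_⟩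
    rw [ivl_concat c (p := α + 1) (q := s) (by omega)]
    simp
  · left
    refine ⟨by simp [mem_ivl]; right; right; exact ⟨t + 1, by omega, by omega, rfl⟩, hc2, ?_⟩
    by_cases h5 : t + 1 = β
    · right
      rw [List.getLast?_append, List.getLast?_append, getLast_ivl c (by omega), ← h5]; rfl
    · left
      refine ⟨c (t + 1 + 1), hinf _ (infix_ivl c le_rfl (by omega)), ?_⟩
      exact (F.basic hα hβ (by omega) h').excl F.toFr
        (infix_ivl c (r := t + 1) (by omega) (by omega)) hu
  · obtain ⟨h5, h6, h7, h8, h9⟩ := hΛ s hs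
    obtain ⟨h10, h11⟩ := hΛt s hs
    have h12 : s < β ∨ β < s := by omega
    rcases h12 with h12 | h12
    · left
      have h13 := F.lt_of_lt h8 hβ h12
      refine ⟨by simp [mem_ivl]; right; right; exact ⟨s + 1, by omega, by omega, rfl⟩, ?_,
        Or.inl ⟨c (s + 1 + 1), hinf _ (infix_ivl c (by omega) (by omega)), ?_⟩⟩
      · refine hS.pass F.toFr hbp (d := c s) (l := ivl c (b + 1) (α + m) ++ (ivl c (α + 1) t ++
          (B ++ ivl c (t + 1) (s - 1)))) (l' := ivl c (s + 2) β) h8 ?_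
        rw [ivl_append c (p := t + 1) (r := s - 1) (q := β) (by omega) (by omega),
          show s - 1 + 1 = s by ring, ivl_cons c (p := s) (q := β) (by omega),
          ivl_cons c (p := s + 1) (q := β) (by omega), show s + 1 + 1 = s + 2 by ring]
        simp
      · rw [show s + 1 + 1 = s + 2 by ring]
        exact F.r2' hα h8 h5 h6 h9
    · right
      have h13 := F.lt_of_lt h8 (F.memA_add hα) h6
      refine ⟨by simp only [mem_ivl]; exact ⟨s + 1, by omega, by omega, rfl⟩, ?_,
        Or.inl ⟨c (s + 1 + 1), infix_ivl c (by omega) (by omega), ?_⟩⟩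
      · exact F.uu hα h8 h5 h6
      · rw [show s + 1 + 1 = s + 2 by ring]
        intro h14
        refine h9 (hS.pass_om F.toFr hbp (d := c s) (f := c (s + 2)) (l := ivl c (b + 1) (s - 1))
          (l' := ivl c (s + 3) (α + m) ++ (ivl c (α + 1) t ++ (B ++ ivl c (t + 1) β))) h8 ?_ h14)
        rw [ivl_append c (p := b + 1) (r := s - 1) (q := α + m) (by omega) (by omega),
          show s - 1 + 1 = s by ring, ivl_cons c (p := s) (q := α + m) (by omega),
          ivl_cons c (p := s + 1) (q := α + m) (by omega), show s + 1 + 1 = s + 2 by ring,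
          ivl_cons c (p := s + 2) (q := α + m) (by omega), show s + 2 + 1 = s + 3 by ring]
        simp

/-- The first vertex of a segment is not adjacent to two consecutive vertices of another one. -/
theorem r3_aux {α β t : ℤ} (hα : c α ∈ A) (hβ : c β ∈ A) (h' : β < α + m)
    (h1 : α < t) (h2 : t < β) (h3 : ∀ r, α < r → r ≤ t → c r ∉ A)
    (Λ : Finset ℤ) (hΛ : ∀ t ∈ Λ, α < t ∧ t < α + m ∧ t ≠ β ∧ c t ∈ A ∧ ¬ Om G m c (c (t + 1)))
    (hnum : ∀ b, β < b → b < α + m → (∀ r, β < r → r ≤ b → c r ∉ A) →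
      ¬ G.Adj (c (α + 1)) (c b) → m < deg G (c (α + 1)) + deg G (c b) + Λ.card + 2)
    (hu : G.Adj (c (β + 1)) (c t)) (hu' : G.Adj (c (β + 1)) (c (t + 1))) : False := by
  have hβ1 := F.no_two hβ
  obtain ⟨γ, h4, -, h5, h6⟩ := F.exists_succ hα (β + 1) hβ1
  have h7 : γ ≤ α + m := by
    by_contra h
    exact h6 (α + m) (by omega) (by omega) (F.memA_add hα)
  have key : ∀ n : ℕ, β + 1 + n < γ → ∃ B f g, LP G f g B ∧
      (B : Multiset V) = (ivl c (β + 1) (β + 1 + n) : List V) ∧ G.Adj (c t) f ∧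
      G.Adj g (c (t + 1)) ∧ ¬ G.Adj (c (α + 1)) f := by
    intro n
    induction n with
    | zero =>
      intro _
      exact ⟨[c (β + 1)], _, _, LP.single _, by simp [ivl_self], hu.symm, hu',
        F.uu hα hβ (by omega) h'⟩
    | succ n ih =>
      intro hn
      obtain ⟨B, f, g, hB, hBe, hf, hg, huf⟩ := ih (by push_cast at hn; omega)
      have hn' : β + 1 + n + 1 < γ := by push_cast at hn; omega
      obtain ⟨h8, h9⟩ := F.insert_step hα hβ h' h1 h2 h3 (b := β + 1 + n) (by omega) (by omega)
        (fun r h10 h11 => h6 r (by omega) (by omega)) Λ hΛ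
        (hnum _ (by omega) (by omega) fun r h10 h11 => h6 r (by omega) (by omega)) hu' hB hBe hf hg
        huf
      have hcast : β + 1 + ((n + 1 : ℕ) : ℤ) = β + 1 + n + 1 := by push_cast; ring
      have hL : LP G (c (β + 1)) (c (β + 1 + n + 1)) (ivl c (β + 1) (β + 1 + n + 1)) :=
        LP.iv F.adj (by omega)
      rw [hcast]
      rcases h9 with h9 | h9
      · exact ⟨_, _, _, hL.rev, by simp, h9.symm, hu', h8⟩
      · exact ⟨_, _, _, hL, rfl, hu.symm, h9, F.uu hα hβ (by omega) h'⟩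
  have h8 := F.lt_of_lt hβ h5 (by omega)
  obtain ⟨B, f, g, hB, hBe, hf, hg, -⟩ := key (γ - β - 2).toNat (by omega)
  have hc : β + 1 + ((γ - β - 2).toNat : ℤ) = γ - 1 := by omega
  rw [hc] at hBe
  refine F.sp ((LP.iv F.adj (show α + 1 ≤ t by omega)).app hf
    (hB.app hg (LP.iv F.adj (show t + 1 ≤ β by omega)))).pt (LP.iv F.adj h7).pt.rev hβ h5 ?_
    (?_ : G.Adj (c (α + 1)) (c (α + m)))
  · rw [← F.full α, ivl_append c (p := α + 1) (r := t) (q := α + m) (by omega) (by omega),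
      ivl_append c (p := t + 1) (r := β) (q := α + m) (by omega) (by omega),
      ivl_append c (p := β + 1) (r := γ - 1) (q := α + m) (by omega) (by omega),
      show γ - 1 + 1 = γ by ring]
    simp only [← Multiset.coe_add, hBe]
    abel
  · rw [F.per]; exact (F.adj α).symm

end Mn

namespace Fr
variable {G : SimpleGraph V} {m : ℕ} {c : ℤ → V} {H A : Finset V} (F : Fr G m c H A)
include F

/-- The vertices of `A`, their neighbours on the cycle and the remaining vertices are counted. -/
theorem three_mul_le (Z E : Finset V) (hZ : ∀ t, c t ∈ A → c (t + 2) ∈ A → c (t + 1) ∈ Z)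
    (hE : ∀ v ∈ E, ∃ t, c t = v ∧ c t ∉ A ∧ c (t - 1) ∉ A ∧ c (t + 1) ∉ A) :
    3 * A.card + E.card ≤ m + Z.card := by
  have hex : ∀ v ∈ A, ∃ t, c t = v := fun v hv => ((F.memA v).1 hv).1
  choose! f hf using hex
  have hsh : ∀ (i : ℤ), Set.InjOn (fun v => c (f v + i)) A := by
    intro i v hv w hw h
    have h1 := F.inj _ _ h
    rw [add_sub_add_right_eq_sub] at h1
    have := (F.per_iff _ _).2 h1
    rwa [hf v hv, hf w hw] at this
  have hmem : ∀ (i : ℤ) v, v ∈ A.image (fun v => c (f v + i)) → ∃ t, c t = v ∧ c (t - i) ∈ A := by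
    intro i v hv
    obtain ⟨w, hw, rfl⟩ := Finset.mem_image.1 hv
    exact ⟨_, rfl, by rw [add_sub_cancel_right, hf w hw]; exact hw⟩
  set U := A.image (fun v => c (f v + 1)) with hU
  set W := A.image (fun v => c (f v + -1)) with hW
  have cU : U.card = A.card := Finset.card_image_of_injOn (hsh 1)
  have cW : W.card = A.card := Finset.card_image_of_injOn (hsh (-1))
  have h1 : Disjoint A U := Finset.disjoint_left.2 fun v hv hv' => by
    obtain ⟨t, rfl, h⟩ := hmem 1 v hv'
    have := F.no_two h
    rw [sub_add_cancel] at this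
    exact this hv
  have h2 : Disjoint A W := Finset.disjoint_left.2 fun v hv hv' => by
    obtain ⟨t, rfl, h⟩ := hmem (-1) v hv'
    exact F.no_two hv (by rwa [sub_neg_eq_add] at h)
  have h3 : Disjoint (A ∪ U) (W \ Z) := by
    refine Finset.disjoint_left.2 fun v hv hv' => ?_
    obtain ⟨h4, h5⟩ := Finset.mem_sdiff.1 hv'
    rcases Finset.mem_union.1 hv with hv | hv
    · exact Finset.disjoint_left.1 h2 hv h4
    · obtain ⟨t, rfl, h⟩ := hmem 1 v hv
      obtain ⟨s, hs, h'⟩ := hmem (-1) _ h4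
      have := hZ (t - 1) h (by
        have := F.same hs 1
        rw [sub_neg_eq_add, this] at h'
        rwa [show t - 1 + 2 = t + 1 by ring])
      rw [sub_add_cancel] at this
      exact h5 this
  have h4 : Disjoint (A ∪ U ∪ W \ Z) E := by
    refine Finset.disjoint_left.2 fun v hv hv' => ?_
    obtain ⟨t, rfl, h5, h6, h7⟩ := hE v hv'
    rcases Finset.mem_union.1 hv with hv | hv
    · rcases Finset.mem_union.1 hv with hv | hv
      · exact h5 hv
      · obtain ⟨s, hs, h⟩ := hmem 1 _ hv
        have := F.same hs (-1)
        rw [sub_eq_add_neg, this] at h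
        exact h6 h
    · obtain ⟨s, hs, h⟩ := hmem (-1) _ (Finset.mem_sdiff.1 hv).1
      have := F.same hs 1
      rw [sub_neg_eq_add, this] at h
      exact h7 h
  have h5 : (A ∪ U ∪ W \ Z ∪ E) ⊆ (CM m c).toFinset := by
    intro v hv
    rw [Multiset.mem_toFinset, F.mem_CM]
    simp only [Finset.mem_union, Finset.mem_sdiff] at hv
    rcases hv with ((hv | hv) | hv) | hv
    · exact ((F.memA v).1 hv).1
    · obtain ⟨t, h, -⟩ := hmem 1 v hv; exact ⟨t, h⟩
    · obtain ⟨t, h, -⟩ := hmem (-1) v hv.1; exact ⟨t, h⟩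
    · obtain ⟨t, h, -⟩ := hE v hv; exact ⟨t, h⟩
  have h6 := Finset.card_le_card h5
  rw [Multiset.toFinset_card_of_nodup F.nodup_CM, card_CM, Finset.card_union_of_disjoint h4,
    Finset.card_union_of_disjoint h3, Finset.card_union_of_disjoint h1, cU] at h6
  have h7 := Finset.le_card_sdiff Z W
  omega

end Fr

/-- No end of a segment can be omitted. -/
structure Rg [Fintype V] (G : SimpleGraph V) (m : ℕ) (c : ℤ → V) (H A : Finset V) : Prop
    extends Mn G m c H A where
  noU : ∀ t, c t ∈ A → ¬ Om G m c (c (t + 1))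
  noW : ∀ t, c t ∈ A → ¬ Om G m c (c (t - 1))

theorem Rg.mirror [Fintype V] {G : SimpleGraph V} {m : ℕ} {c : ℤ → V} {H A : Finset V}
    (F : Rg G m c H A) : Rg G m (fun t => c (-t)) H A where
  toMn := F.toMn.mirror
  noU t h ho := F.noW (-t) h (by rw [show -t - 1 = -(t + 1) by ring]; exact ho.mirror)
  noW t h ho := F.noU (-t) h (by rw [show -t + 1 = -(t - 1) by ring]; exact ho.mirror)

/-- Beyond `lo`, only slots at first vertices of segments are lost on the first path. -/
def Tight (G : SimpleGraph V) (c : ℤ → V) (A : Finset V) (α β lo : ℤ) : Prop :=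
  ∀ t, lo < t → BL G c α β t → c (t - 1) ∈ A

namespace Rg
variable [Fintype V] {G : SimpleGraph V} {m : ℕ} {c : ℤ → V} {H A : Finset V}
  (F : Rg G m c H A)
include F

theorem two_notMem {α : ℤ} (hα : c α ∈ A) : c (α + 2) ∉ A := fun h =>
  F.noU α hα (F.om_single hα h)

theorem lt3 {α β : ℤ} (hα : c α ∈ A) (hβ : c β ∈ A) (h : α < β) : α + 3 ≤ β := by
  by_contra h1
  have := F.lt_of_lt hα hβ h
  have : β = α + 2 := by omega
  exact F.two_notMem hα (this ▸ hβ)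

theorem exists_index {α β : ℤ} (hα : c α ∈ A) (hβ : c β ∈ A) (h : α < β) (h' : β < α + m) :
    ∃ Λ : Finset ℤ, (∀ t ∈ Λ, α < t ∧ t < α + m ∧ t ≠ β ∧ c t ∈ A ∧ ¬ Om G m c (c (t + 1))) ∧
      Λ.card + 2 = A.card := by
  refine ⟨((Finset.Ioo α (α + m)).filter fun t => c t ∈ A).erase β, ?_, ?_⟩
  · intro t ht
    simp only [Finset.mem_erase, Finset.mem_filter, Finset.mem_Ioo] at ht
    exact ⟨ht.2.1.1, ht.2.1.2, ht.1, ht.2.2, F.noU t ht.2.2⟩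
  · rw [← F.card_index hα, Finset.card_erase_of_mem (by simp [h, h', hβ])]
    have : 0 < ((Finset.Ioo α (α + (m : ℤ))).filter fun t => c t ∈ A).card :=
      Finset.card_pos.2 ⟨β, by simp [h, h', hβ]⟩
    omega

theorem ki_pair {α β : ℤ} (hα : c α ∈ A) (hβ : c β ∈ A) (h : α < β) (h' : β < α + m) :
    m + 1 ≤ deg G (c (α + 1)) + deg G (c (β + 1)) + A.card :=
  F.ki _ _ (F.no_two hα) (F.no_two hβ) (F.ne_of (by omega) (by omega)) (F.uu hα hβ h h')

theorem excess {α β s t : ℤ} (hα : c α ∈ A) (hβ : c β ∈ A) (h : α < β) (h' : β < α + m)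
    (hs : LI G m c α β s) (ht : LI G m c α β t) (hs' : c (s - 1) ∉ A) (ht' : c (t - 1) ∉ A) :
    s = t := by
  by_contra hst
  obtain ⟨Λ, h1, h2⟩ := F.exists_index hα hβ h h'
  have h3 := F.pair_count hα hβ h h' (F.nbrC (F.no_two hα)) (F.nbrC (F.no_two hβ)) Λ h1 {s, t} (by
    intro r hr
    simp only [Finset.mem_insert, Finset.mem_singleton] at hr
    rcases hr with rfl | rfl
    · exact ⟨hs, fun h => hs' (h1 _ h).2.2.2.1⟩
    · exact ⟨ht, fun h => ht' (h1 _ h).2.2.2.1⟩)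
  have h4 := F.ki_pair hα hβ h h'
  rw [Finset.card_pair hst] at h3
  omega

theorem r3 {α β t : ℤ} (hα : c α ∈ A) (hβ : c β ∈ A) (h' : β < α + m)
    (h1 : α < t) (h2 : t < β) (h3 : ∀ r, α < r → r ≤ t → c r ∉ A)
    (hu : G.Adj (c (β + 1)) (c t)) : ¬ G.Adj (c (β + 1)) (c (t + 1)) := by
  obtain ⟨Λ, h4, h5⟩ := F.exists_index hα hβ (by omega) h'
  refine fun hu' => F.r3_aux hα hβ h' h1 h2 h3 Λ h4 (fun b h6 h7 h8 h9 => ?_) hu hu'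
  have h10 : α + 1 < b := by omega
  have := F.ki _ _ (F.no_two hα) (h8 b h6 le_rfl) (F.ne_of h10 (by omega)) h9
  omega

theorem r1 {α β t : ℤ} (hα : c α ∈ A) (hβ : c β ∈ A) (h' : β < α + m)
    (h1 : α < t) (h2 : t + 2 ≤ β) (h3 : c (t + 1) ∉ A)
    (hu : G.Adj (c (β + 1)) (c t)) : ¬ G.Adj (c (α + 1)) (c (t + 2)) := by
  intro hv
  have S := F.basic hα hβ (by omega) h'
  have ho := S.excl_om F.toFr (infix_ivl_three c (by omega) h2) hu hv
  obtain ⟨h4, h5, h6, h7⟩ := F.om1 _ h3 ho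
  have h8 : ¬ G.Adj (c (α + 1)) (c (t + 1)) :=
    S.excl F.toFr (infix_ivl c (by omega) (by omega)) hu
  have h9 : ¬ G.Adj (c (β + 1)) (c (t + 1)) := fun h =>
    S.excl F.toFr (infix_ivl c (r := t + 1) (by omega) (by omega)) h
      (by rwa [show t + 1 + 1 = t + 2 by ring])
  have h10 := F.ki _ _ (F.no_two hα) h3 (F.ne_of (by omega) (by omega)) h8
  have h11 := F.ki _ _ (F.no_two hβ) h3 (F.ne_of (s := t + 1) (by omega) (by omega)).symm h9
  obtain ⟨Λ, h12, h13⟩ := F.exists_index hα hβ (by omega) h'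
  have h14 := F.pair_count hα hβ (by omega) h' (F.nbrC (F.no_two hα)) (F.nbrC (F.no_two hβ)) Λ h12 ∅
    (by simp)
  have h15 := F.three_mul_le ∅ {c (t + 1)} (fun s hs hs' => absurd hs' (F.two_notMem hs)) (by
    intro v hv
    rw [Finset.mem_singleton] at hv
    refine ⟨t + 1, hv.symm, h3, fun h => ?_, fun h => ?_⟩
    · rw [add_sub_cancel_right] at h; exact F.noU t h ho
    · exact F.noW _ h (by rwa [add_sub_cancel_right]))
  simp only [Finset.card_singleton, Finset.card_empty] at h14 h15
  omega

theorem bad_lost {α β t : ℤ} (hα : c α ∈ A) (hβ : c β ∈ A) (h' : β < α + m)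
    (h1 : α < t) (h2 : t < β) (h3 : ∀ r, α < r → r ≤ t → c r ∉ A)
    (hbad : ¬ G.Adj (c (α + 1)) (c (t + 1))) :
    ∃ s, t ≤ s ∧ s ≤ t + 1 ∧ BL G c α β s ∧ c (s - 1) ∉ A := by
  have ht : t ≠ α + 1 := by
    rintro rfl; exact hbad (F.adj _)
  by_cases hu : G.Adj (c (β + 1)) (c t)
  · have hu' := F.r3 hα hβ h' h1 h2 h3 hu
    have h4 : t + 1 < β := by
      by_contra h4
      have : t + 1 = β := by omega
      rw [this] at hu'
      exact hu' (F.adj β).symm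
    refine ⟨t + 1, by omega, le_rfl, ⟨by omega, h4, hu', ?_⟩, ?_⟩
    · by_cases h5 : c (t + 1) ∈ A
      · exact F.uu hα h5 (by omega) (by omega)
      · rw [show t + 1 + 1 = t + 2 by ring]
        exact F.r1 hα hβ h' h1 (by omega) h5 hu
    · rw [add_sub_cancel_right]; exact h3 t h1 le_rfl
  · exact ⟨t, le_rfl, by omega, ⟨h1, h2, hu, hbad⟩, h3 _ (by omega) (by omega)⟩

theorem bad_tight {α β t : ℤ} (hα : c α ∈ A) (hβ : c β ∈ A) (h' : β < α + m)
    (h1 : α < t) (h2 : t < β) (h3 : ∀ r, α < r → r ≤ t → c r ∉ A)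
    (hbad : ¬ G.Adj (c (α + 1)) (c (t + 1))) :
    Tight G c A α β (t + 1) ∧ Tight G c A β (α + m) β := by
  obtain ⟨s, h4, h5, h6, h7⟩ := F.bad_lost hα hβ h' h1 h2 h3 hbad
  refine ⟨fun r h8 h9 => ?_, fun r h8 h9 => ?_⟩
  · by_contra h10
    have := F.excess hα hβ (by omega) h' (Or.inl h6) (Or.inl h9) h7 h10
    omega
  · by_contra h10
    have := F.excess hα hβ (by omega) h' (Or.inl h6) (Or.inr h9) h7 h10
    omega

theorem size_two {α β t lo : ℤ} (hα : c α ∈ A) (hβ : c β ∈ A) (h' : β < α + m)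
    (hT : Tight G c A α β lo) (ht : c t ∈ A) (h1 : α < t) (h2 : t < β) (hlo : lo ≤ t + 1) :
    c (t + 3) ∈ A := by
  by_contra h3
  have h4 := F.lt3 ht hβ h2
  have h6 := F.two_notMem ht
  have h5 := F.no_two ht
  have h7 : t + 3 ≠ β := fun h => h3 (h ▸ hβ)
  have hseg : ∀ r, t < r → r ≤ t + 3 → c r ∉ A := by
    intro r hr hr'
    obtain rfl | rfl | rfl : r = t + 1 ∨ r = t + 2 ∨ r = t + 3 := by omega
    exacts [h5, h6, h3]
  have hfar : ¬ G.Adj (c (β + 1)) (c (t + 2)) := F.r2 ht hβ h2 (by omega) (F.noU t ht)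
  have hnear : G.Adj (c (α + 1)) (c (t + 3)) := by
    by_contra h
    have := hT (t + 2) (by omega) ⟨by omega, by omega, hfar, by
      rwa [show t + 2 + 1 = t + 3 by ring]⟩
    rw [show t + 2 - 1 = t + 1 by ring] at this
    exact h5 this
  have hnear' : ¬ G.Adj (c (α + 1)) (c (t + 4)) := by
    have := F.r3 (t := t + 3) ht (F.memA_add hα) (by omega) (by omega) (by omega) hseg
    rw [F.per_add, show t + 3 + 1 = t + 4 by ring] at this
    exact this hnear
  have hfar' : G.Adj (c (β + 1)) (c (t + 3)) := by
    by_contra h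
    have := hT (t + 3) (by omega) ⟨by omega, by omega, h, by
      rwa [show t + 3 + 1 = t + 4 by ring]⟩
    rw [show t + 3 - 1 = t + 2 by ring] at this
    exact h6 this
  have hfar2 := F.r3 (t := t + 3) ht hβ (by omega) (by omega) (by omega) hseg hfar'
  rw [show t + 3 + 1 = t + 4 by ring] at hfar2
  have h8 : t + 4 ≠ β := by
    rintro h
    rw [h] at hfar2
    exact hfar2 (F.adj β).symm
  have := hT (t + 4) (by omega) ⟨by omega, by omega, hfar2, ?_⟩
  · rw [show t + 4 - 1 = t + 3 by ring] at this
    exact h3 this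
  · by_cases h9 : c (t + 4) ∈ A
    · exact F.uu hα h9 (by omega) (by omega)
    · have := F.r1 (t := t + 3) hα hβ h' (by omega) (by omega)
        (by rwa [show t + 3 + 1 = t + 4 by ring]) hfar'
      rwa [show t + 4 + 1 = t + 3 + 2 by ring]

theorem good {α β : ℤ} (hα : c α ∈ A) (hβ : c β ∈ A) (h : α < β) (h' : β < α + m)
    (hT : Tight G c A α β α) (r : ℤ) (hr : α + 2 ≤ r) (hr' : r ≤ β)
    (hseg : ∀ s, α < s → s < r → c s ∉ A) :
    G.Adj (c (α + 1)) (c r) ∧ ∀ s, α < s → s < r → ¬ G.Adj (c (β + 1)) (c s) := by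
  obtain ⟨n, hn⟩ := Int.le.dest hr
  induction n generalizing r with
  | zero =>
    have : r = α + 2 := by simpa using hn.symm
    subst this
    refine ⟨by rw [show α + 2 = α + 1 + 1 by ring]; exact F.adj _, fun s hs hs' => ?_⟩
    obtain rfl : s = α + 1 := by omega
    exact fun h1 => F.uu hα hβ h h' h1.symm
  | succ n ih =>
    have hn1 : α + 2 ≤ r - 1 := by push_cast at hn; omega
    obtain ⟨h1, h2⟩ := ih (r - 1) hn1 (by omega) (fun s hs hs' => hseg s hs (by omega))
      (by push_cast at hn; omega)
    have h3 : ¬ G.Adj (c (β + 1)) (c (r - 1)) := by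
      intro h3
      have h4 : ¬ G.Adj (c (α + 1)) (c r) := by
        have := (F.basic hα hβ h h').excl F.toFr (infix_ivl c (r := r - 1) (by omega) (by omega)) h3
        rwa [sub_add_cancel] at this
      have h5 : ¬ G.Adj (c (β + 1)) (c r) := by
        have := F.r3 (t := r - 1) hα hβ h' (by omega) (by omega)
          (fun s hs hs' => hseg s hs (by omega)) h3
        rwa [sub_add_cancel] at this
      have h6 : r ≠ β := by
        rintro rfl
        exact h5 (F.adj _).symm
      refine hseg (r - 1) (by omega) (by omega) (hT r (by omega) ⟨by omega, by omega, h5, ?_⟩)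
      by_cases h7 : c r ∈ A
      · exact F.uu hα h7 (by omega) (by omega)
      · have := F.r1 (t := r - 1) hα hβ h' (by omega) (by omega) (by rwa [sub_add_cancel]) h3
        rwa [show r - 1 + 2 = r + 1 by ring] at this
    refine ⟨?_, fun s hs hs' => ?_⟩
    · by_contra h4
      refine hseg (r - 1 - 1) (by omega) (by omega)
        (hT (r - 1) (by omega) ⟨by omega, by omega, h3, by rwa [sub_add_cancel]⟩)
    · rcases eq_or_lt_of_le (show s ≤ r - 1 by omega) with rfl | h5
      · exact h3
      · exact h2 s hs h5

end Rg

theorem Fr.split {G : SimpleGraph V} {m : ℕ} {c : ℤ → V} {H A : Finset V} (F : Fr G m c H A)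
    {α β s z : ℤ} (hα : c α ∈ A) (hβ : c β ∈ A) (h1 : α < s) (h2 : s < β) (h3 : β < z)
    (h4 : z < α + m) (hs : G.Adj (c (α + 1)) (c (s + 1))) (hz : G.Adj (c (β + 1)) (c (z + 1))) :
    ¬ G.Adj (c s) (c z) := by
  refine F.sp ((LP.iv F.adj (show α + 1 ≤ s by omega)).rev.app hs
    (LP.iv F.adj (show s + 1 ≤ β by omega))).pt ((LP.iv F.adj (show β + 1 ≤ z by omega)).rev.app hz
    (LP.iv F.adj (show z + 1 ≤ α + m by omega))).pt hβ (F.memA_add hα) ?_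
  rw [← F.full α, ivl_append c (p := α + 1) (r := s) (q := α + m) (by omega) (by omega),
    ivl_append c (p := s + 1) (r := β) (q := α + m) (by omega) (by omega),
    ivl_append c (p := β + 1) (r := z) (q := α + m) (by omega) (by omega)]
  simp only [← Multiset.coe_add, Multiset.coe_reverse]
  abel

namespace Rg
variable [Fintype V] {G : SimpleGraph V} {m : ℕ} {c : ℤ → V} {H A : Finset V}
  (F : Rg G m c H A)
include F

/-- With only two segments, the detour through an edge `c t, c z` loses at most one slot. -/
theorem detour {α β γ t z : ℤ} (hA : A.card = 2) (hα : c α ∈ A) (hβ : c β ∈ A)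
    (h1 : α < t) (h2 : t + 1 < β) (h3 : c (t + 1) ∉ A)
    (hbad : ¬ G.Adj (c (α + 1)) (c (t + 1))) (hz : β < z) (hzγ : z < γ) (hγ : γ ≤ α + m)
    (hadj : G.Adj (c t) (c z)) (hz1 : G.Adj (c (β + 1)) (c (z + 1)))
    (hu : ∀ s, β < s → s < γ → ¬ G.Adj (c (α + 1)) (c s)) {r s r' s' : ℤ} (hrs : r < s)
    (hr : β < r) (hs : s < γ) (hr' : β < r' ∧ r' < γ) (hs' : β < s' ∧ s' < γ)
    (hrr : [c r, c r'] <:+: (ivl c (β + 1) z).reverse ++ ivl c (z + 1) (α + m))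
    (hss : [c s, c s'] <:+: (ivl c (β + 1) z).reverse ++ ivl c (z + 1) (α + m))
    (hpr : ¬ G.Adj (c (t + 1)) (c r)) : G.Adj (c (t + 1)) (c s) := by
  by_contra hps
  have S : Spl G m c A (c (t + 1)) (c β) (ivl c (t + 1) β) (c (α + 1)) (c (α + m))
      (ivl c (α + 1) t ++ ((ivl c (β + 1) z).reverse ++ ivl c (z + 1) (α + m))) := by
    refine ⟨LP.iv F.adj (by omega), (LP.iv F.adj (by omega)).app hadj
      ((LP.iv F.adj (by omega)).rev.app hz1 (LP.iv F.adj (by omega))), hβ, F.memA_add hα, ?_⟩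
    rw [← F.full α, ivl_append c (p := α + 1) (r := t) (q := α + m) (by omega) (by omega),
      ivl_append c (p := t + 1) (r := β) (q := α + m) (by omega) (by omega),
      ivl_append c (p := β + 1) (r := z) (q := α + m) (by omega) (by omega)]
    simp only [← Multiset.coe_add, Multiset.coe_reverse]
    abel
  have hinf : ∀ L : List V, L <:+: (ivl c (β + 1) z).reverse ++ ivl c (z + 1) (α + m) →
      L <:+: ivl c (α + 1) t ++ ((ivl c (β + 1) z).reverse ++ ivl c (z + 1) (α + m)) := fun L hL =>
    hL.trans ⟨ivl c (α + 1) t, [], by simp⟩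
  have h4 := S.count F.toFr (F.nbrC h3) (F.nbrC (F.no_two hα)) {c r, c s} (by
    intro d hd
    simp only [Finset.mem_insert, Finset.mem_singleton] at hd
    right
    rcases hd with rfl | rfl
    · exact ⟨(hinf _ hrr).subset (by simp), hpr, Or.inl ⟨_, hinf _ hrr, hu _ hr'.1 hr'.2⟩⟩
    · exact ⟨(hinf _ hss).subset (by simp), hps, Or.inl ⟨_, hinf _ hss, hu _ hs'.1 hs'.2⟩⟩)
  rw [Finset.card_pair (F.ne_of hrs (by omega))] at h4
  have h5 := F.ki _ _ (F.no_two hα) h3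
    (F.ne_of (s := α + 1) (t := t + 1) (by omega) (by omega)) hbad
  omega

theorem size_two_of_card_two {α β t z : ℤ} (hA : A.card = 2) (hα : c α ∈ A) (hβ : c β ∈ A)
    (h1 : α < t) (h2 : t < β) (h3 : ∀ r, α < r → r ≤ t → c r ∉ A) (h4 : c (t + 1) ∉ A)
    (hz : β < z) (hz' : z < α + m) (h5 : ∀ r, β < r → r ≤ z → c r ∉ A)
    (hadj : G.Adj (c t) (c z)) (hbad : ¬ G.Adj (c (α + 1)) (c (t + 1))) : c (β + 3) ∈ A := by
  by_contra hβ3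
  have h' : β < α + m := by omega
  have ht1 : t + 1 < β := by
    rcases eq_or_lt_of_le (show t + 1 ≤ β by omega) with h | h
    · exact absurd (h ▸ hβ) h4
    · exact h
  obtain ⟨γ, hγ1, -, hγ2, hγ3⟩ := F.exists_succ hα (β + 1) (F.no_two hβ)
  have hγ4 : γ ≤ α + m := by
    by_contra h
    exact hγ3 (α + m) (by omega) (by omega) (F.memA_add hα)
  have hγ5 := F.lt3 hβ hγ2 (by omega)
  have hγ6 : β + 4 ≤ γ := by
    rcases eq_or_lt_of_le hγ5 with h | h
    · exact absurd (h ▸ hγ2) hβ3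
    · omega
  have hzγ : z < γ := by
    by_contra h
    exact h5 γ (by omega) (by omega) hγ2
  have hγs : ∀ r, β < r → r < γ → c r ∉ A := fun r hr hr' => hγ3 r (by omega) hr'
  obtain ⟨hT1, hT2⟩ := F.bad_tight hα hβ h' h1 h2 h3 hbad
  have hgood : ∀ r, β + 2 ≤ r → r ≤ γ → G.Adj (c (β + 1)) (c r) ∧
      ∀ s, β < s → s < r → ¬ G.Adj (c (α + 1)) (c s) := by
    intro r hr hr'
    have := F.good hβ (F.memA_add hα) h' (by omega) hT2 r hr (by omega)
      (fun s hs hs' => hγs s hs (by omega))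
    rwa [F.per_add] at this
  have hu := (hgood γ (by omega) le_rfl).2
  have h3' : ∀ r, α < r → r ≤ t + 1 → c r ∉ A := fun r hr hr' => by
    rcases eq_or_lt_of_le hr' with rfl | h
    · exact h4
    · exact h3 r hr (by omega)
  have htα : t ≠ α + 1 := by
    rintro rfl; exact hbad (F.adj _)
  have hy : ¬ G.Adj (c (β + 1)) (c (t + 1)) := by
    intro hy
    have h6 : ¬ G.Adj (c (β + 1)) (c t) := fun h => F.r3 hα hβ h' h1 h2 h3 h hy
    have h7 : ¬ G.Adj (c (β + 1)) (c (t + 2)) := by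
      have := F.r3 (t := t + 1) hα hβ h' (by omega) ht1 h3' hy
      rwa [show t + 1 + 1 = t + 2 by ring] at this
    have h8 : t + 2 ≠ β := by
      intro h
      rw [h] at h7
      exact h7 (F.adj β).symm
    have := F.excess (s := t) (t := t + 2) hα hβ (by omega) h' (Or.inl ⟨h1, h2, h6, hbad⟩)
      (Or.inl ⟨by omega, by omega, h7, ?_⟩) (h3 _ (by omega) (by omega))
      (by rwa [show t + 2 - 1 = t + 1 by ring])
    · omega
    · by_cases h9 : c (t + 2) ∈ A
      · exact F.uu hα h9 (by omega) (by omega)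
      · have := F.r1 (t := t + 1) hα hβ h' (by omega) (by omega)
          (by rwa [show t + 1 + 1 = t + 2 by ring]) hy
        rwa [show t + 2 + 1 = t + 1 + 2 by ring]
  have hrev : ∀ z r : ℤ, β + 2 ≤ r → r ≤ z →
      [c r, c (r - 1)] <:+: (ivl c (β + 1) z).reverse ++ ivl c (z + 1) (α + m) := by
    intro z r hr hr'
    have h6 := infix_ivl c (p := β + 1) (q := z) (r := r - 1) (by omega) (by omega)
    rw [sub_add_cancel] at h6
    obtain ⟨l, l', e⟩ := h6
    refine List.IsInfix.trans ⟨l'.reverse, l.reverse, ?_⟩ ⟨[], _, rfl⟩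
    rw [← e]
    simp
  have hfwd : ∀ z r : ℤ, z + 1 ≤ r → r + 1 ≤ α + m →
      [c r, c (r + 1)] <:+: (ivl c (β + 1) z).reverse ++ ivl c (z + 1) (α + m) := fun z r hr hr' =>
    (infix_ivl c hr hr').trans ⟨(ivl c (β + 1) z).reverse, [], by simp⟩
  have hturn : ∀ z : ℤ, β < z → z < α + m →
      [c (β + 1), c (z + 1)] <:+: (ivl c (β + 1) z).reverse ++ ivl c (z + 1) (α + m) := by
    intro z hz hz'
    rw [ivl_cons c (p := β + 1) (by omega), ivl_cons c (p := z + 1) (by omega)]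
    exact ⟨(ivl c (β + 1 + 1) z).reverse, ivl c (z + 1 + 1) (α + m), by simp⟩
  have hpr : ¬ G.Adj (c (t + 1)) (c (β + 1)) := fun h => hy h.symm
  obtain ⟨r, hr, hr', hadj'⟩ : ∃ r, β < r ∧ r < γ ∧ G.Adj (c (t + 1)) (c r) := by
    have hz1 := (hgood (z + 1) (by omega) (by omega)).1
    rcases eq_or_lt_of_le (show z ≤ γ - 1 by omega) with h6 | h6
    · by_cases h7 : G.Adj (c (t + 1)) (c (β + 2))
      · exact ⟨_, by omega, by omega, h7⟩
      · exact ⟨β + 3, by omega, by omega, F.detour hA hα hβ h1 ht1 h4 hbad hz hzγ hγ4 hadj hz1 hu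
          (r := β + 2) (r' := β + 2 - 1) (s' := β + 3 - 1) (by omega) (by omega) (by omega)
          (by omega) (by omega) (hrev _ _ le_rfl (by omega)) (hrev _ _ (by omega) (by omega)) h7⟩
    · rcases eq_or_lt_of_le (show β + 1 ≤ z by omega) with h7 | h7
      · exact ⟨β + 2, by omega, by omega, F.detour hA hα hβ h1 ht1 h4 hbad hz hzγ hγ4 hadj hz1 hu
          (r := β + 1) (r' := z + 1) (s' := β + 2 + 1) (by omega) (by omega) (by omega)
          (by omega) (by omega) (hturn _ hz hz') (hfwd _ _ (by omega) (by omega)) hpr⟩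
      · exact ⟨z, hz, hzγ, F.detour hA hα hβ h1 ht1 h4 hbad hz hzγ hγ4 hadj hz1 hu
          (r := β + 1) (r' := z + 1) (s' := z - 1) (by omega) (by omega) (by omega)
          (by omega) (by omega) (hturn _ hz hz') (hrev _ _ (by omega) le_rfl) hpr⟩
  have hu2 : ¬ G.Adj (c (α + 1)) (c (t + 2)) := by
    intro hu2
    rw [show t + 2 = t + 1 + 1 by ring] at hu2
    exact F.split hα hβ (by omega) ht1 hr (by omega) hu2 (hgood (r + 1) (by omega) (by omega)).1
      hadj'
  have hyt : G.Adj (c (β + 1)) (c t) := by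
    by_contra h6
    have := F.excess (s := t) (t := t + 1) hα hβ (by omega) h' (Or.inl ⟨h1, h2, h6, hbad⟩)
      (Or.inl ⟨by omega, by omega, hy, by rwa [show t + 1 + 1 = t + 2 by ring]⟩)
      (h3 _ (by omega) (by omega)) (by rw [add_sub_cancel_right]; exact h3 t h1 le_rfl)
    omega
  have h6 : G.Adj (c (t + 1)) (c (β + 2)) :=
    F.detour hA hα hβ h1 ht1 h4 hbad (z := β + 1) (by omega) (by omega) hγ4 hyt.symm
      (by have := F.adj (β + 1); exact this) hu
      (r := β + 1) (r' := β + 1 + 1) (s' := β + 2 + 1) (by omega) (by omega) (by omega)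
      (by omega) (by omega) (hturn _ (by omega) (by omega)) (hfwd _ _ (by omega) (by omega)) hpr
  have h7 := (hgood (γ - 1) (by omega) (by omega)).1
  refine F.sp ((LP.iv F.adj (show α + 1 ≤ t by omega)).app hyt.symm ((LP.single _).app h7
    ((LP.iv F.adj (show β + 2 ≤ γ - 1 by omega)).rev.app h6.symm
      (LP.iv F.adj (show t + 1 ≤ β by omega))))).pt (LP.iv F.adj hγ4).pt.rev hβ hγ2 ?_
    (?_ : G.Adj (c (α + 1)) (c (α + m)))
  · rw [← F.full α, ivl_append c (p := α + 1) (r := t) (q := α + m) (by omega) (by omega),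
      ivl_append c (p := t + 1) (r := β) (q := α + m) (by omega) (by omega),
      ivl_cons c (p := β + 1) (q := α + m) (by omega), show β + 1 + 1 = β + 2 by ring,
      ivl_append c (p := β + 2) (r := γ - 1) (q := α + m) (by omega) (by omega), sub_add_cancel]
    simp only [← Multiset.coe_add, Multiset.coe_reverse, ← Multiset.cons_coe, Multiset.coe_nil,
      ← Multiset.singleton_add]
    abel
  · rw [F.per]; exact (F.adj α).symm

end Rg

theorem deg_add_le [Fintype V] {G : SimpleGraph V} {v : V} {X B : Finset V}
    (hX : ∀ w, G.Adj v w → w ∈ X) (hB : ∀ b ∈ B, b ∈ X ∧ ¬ G.Adj v b) :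
    deg G v + B.card ≤ X.card := by
  have h : deg G v = (X.filter fun w => G.Adj v w).card := by
    rw [deg, Set.ncard_eq_toFinset_card']
    congr 1
    ext w
    simp only [Set.mem_toFinset, SimpleGraph.mem_neighborSet, Finset.mem_filter]
    exact ⟨fun h => ⟨hX w h, h⟩, fun h => h.2⟩
  rw [h, ← Finset.card_union_of_disjoint]
  · refine Finset.card_le_card fun w hw => ?_
    rcases Finset.mem_union.1 hw with hw | hw
    · exact (Finset.mem_filter.1 hw).1
    · exact (hB w hw).1
  · exact Finset.disjoint_left.2 fun w hw hw' => (hB w hw').2 (Finset.mem_filter.1 hw).2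

/-- All segments of the cycle, except possibly the one between `α` and `β`, have two vertices. -/
structure Fi [Fintype V] (G : SimpleGraph V) (m : ℕ) (c : ℤ → V) (H A : Finset V) (α β : ℤ) : Prop
    extends Rg G m c H A where
  hα : c α ∈ A
  hβ : c β ∈ A
  lt : α < β
  lt' : β < α + m
  seg : ∀ r, α < r → r < β → c r ∉ A
  len : ∀ t, α < t → t < α + m → c t ∈ A → c (t + 3) ∈ A

namespace Fi
variable [Fintype V] {G : SimpleGraph V} {m : ℕ} {c : ℤ → V} {H A : Finset V} {α β : ℤ}
  (F : Fi G m c H A α β)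
include F

theorem len_sub {t : ℤ} (h : β < t) (h' : t ≤ α + m) (ht : c t ∈ A) : c (t - 3) ∈ A := by
  have h1 : c (t - 1) ∉ A := fun h1 => F.no_two h1 (by rwa [sub_add_cancel])
  obtain ⟨κ, -, hκ, hκ1, hκ2⟩ := F.exists_pred F.hβ (t - 1) h1
  have h2 : β ≤ κ := by
    by_contra h2
    exact hκ2 β (by omega) (by omega) F.hβ
  have := F.lt
  have h3 := F.len κ (by omega) (by omega) hκ1
  have h4 := F.lt3 hκ1 ht (by omega)
  have h5 : t - 1 < κ + 3 := by
    by_contra h5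
    exact hκ2 _ (by omega) (by omega) h3
  rwa [show t - 3 = κ by omega]

theorem mirror : Fi G m (fun t => c (-t)) H A (-β) (-α) where
  toRg := F.toRg.mirror
  hα := by simpa using F.hβ
  hβ := by simpa using F.hα
  lt := by have := F.lt; omega
  lt' := by have := F.lt'; omega
  seg := fun r h h' => F.seg (-r) (by omega) (by omega)
  len := fun t h h' ht => by
    have h1 : -t ≤ α := by
      by_contra h1
      exact F.seg (-t) (by omega) (by omega) ht
    have := F.len_sub (t := -t + m) (by omega) (by omega) (by rwa [F.per])
    rw [show -t + (m : ℤ) - 3 = -(t + 3) + m by ring, F.per] at this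
    exact this

theorem end_end {κ t σ τ : ℤ} (hκ : c κ ∈ A) (ht : c t ∈ A) (hκ' : c (κ + 3) ∈ A)
    (ht' : c (t + 3) ∈ A) (h : κ < t) (h' : t < κ + m) (hσ : σ = κ + 1 ∨ σ = κ + 2)
    (hτ : τ = t + 1 ∨ τ = t + 2) : ¬ G.Adj (c σ) (c τ) := by
  rcases hσ with rfl | rfl <;> rcases hτ with rfl | rfl
  · exact F.uu hκ ht h h'
  · exact F.r2' hκ ht h h' (F.noU t ht)
  · exact fun h1 => F.r2 hκ ht h h' (F.noU κ hκ) h1.symm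
  · have := F.toFr.mirror.uu (α := -(t + 3)) (β := -(κ + 3)) (by simpa using ht')
      (by simpa using hκ') (by omega) (by omega)
    rw [show -(-(t + 3) + 1) = t + 2 by ring, show -(-(κ + 3) + 1) = κ + 2 by ring] at this
    exact fun h1 => this h1.symm

theorem pos {r : ℤ} (h' : r ≤ α + m) (hr : c r ∉ A) :
    r < β ∨ ∃ κ, β ≤ κ ∧ κ < α + m ∧ c κ ∈ A ∧ (r = κ + 1 ∨ r = κ + 2) := by
  by_cases h1 : r < β
  · exact Or.inl h1
  right
  obtain ⟨κ, -, hκ, hκ1, hκ2⟩ := F.exists_pred F.hβ r hr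
  have h2 : β ≤ κ := by
    by_contra h2
    exact hκ2 β (by omega) (by omega) F.hβ
  have := F.lt
  refine ⟨κ, h2, by omega, hκ1, ?_⟩
  have h3 := F.len κ (by omega) (by omega) hκ1
  by_contra h5
  exact hκ2 (κ + 3) (by omega) (by omega) h3

theorem first_nadj {t τ : ℤ} (ht : c t ∈ A) (h : α < t) (h' : t < α + m)
    (hτ : τ = t + 1 ∨ τ = t + 2) : ¬ G.Adj (c (α + 1)) (c τ) := by
  rcases hτ with rfl | rfl
  · exact F.uu F.hα ht h h'
  · exact F.r2' F.hα ht h h' (F.noU t ht)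

theorem first_nbr {w : V} (h : G.Adj (c (α + 1)) w) :
    w ∈ A ∨ ∃ r, α + 1 < r ∧ r < β ∧ c r = w := by
  obtain ⟨s, rfl⟩ := F.nbrC (F.no_two F.hα) w h
  obtain ⟨r, h1, h2, h3⟩ := F.rep α s
  rw [← h3] at h ⊢
  by_cases hr : c r ∈ A
  · exact Or.inl hr
  right
  rcases F.pos h2 hr with h4 | ⟨κ, h4, h5, h6, h7⟩
  · refine ⟨r, ?_, h4, rfl⟩
    rcases eq_or_lt_of_le (show α + 1 ≤ r by omega) with rfl | h5
    · exact absurd h (G.loopless.irrefl _)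
    · exact h5
  · have := F.lt
    exact absurd h (F.first_nadj h6 (by omega) h5 h7)

theorem other_nbr {t τ : ℤ} (ht : c t ∈ A) (h : α < t) (h' : t < α + m)
    (hτ : τ = t + 1 ∨ τ = t + 2) {w : V} (hw : G.Adj (c τ) w) :
    w = c (2 * t + 3 - τ) ∨ w ∈ A ∨ ∃ r, α < r ∧ r < β ∧ c r = w := by
  have ht3 := F.len t h h' ht
  have hτA : c τ ∉ A := by
    rcases hτ with rfl | rfl
    · exact F.no_two ht
    · exact F.two_notMem ht
  obtain ⟨s, rfl⟩ := F.nbrC hτA w hw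
  obtain ⟨r, h1, h2, h3⟩ := F.rep α s
  rw [← h3] at hw ⊢
  by_cases hr : c r ∈ A
  · exact Or.inr (Or.inl hr)
  rcases F.pos h2 hr with h4 | ⟨κ, h4, h5, h6, h7⟩
  · exact Or.inr (Or.inr ⟨r, h1, h4, rfl⟩)
  have h8 := F.lt
  have hκ3 := F.len κ (by omega) h5 h6
  rcases lt_trichotomy κ t with h9 | h9 | h9
  · exact absurd hw.symm (F.end_end h6 ht hκ3 ht3 h9 (by omega) h7 hτ)
  · left
    by_cases h10 : r = τ
    · subst h10; exact absurd hw (G.loopless.irrefl _)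
    · congr 1; omega
  · exact absurd hw (F.end_end ht h6 ht3 hκ3 h9 (by omega) hτ h7)

theorem le_m : 3 * A.card + (β - α - 3).toNat ≤ m := by
  have hlt' := F.lt'
  have h4 := F.three_mul_le ∅ ((Finset.Ioo (α + 1) (β - 1)).image c)
    (fun t h1 h2 => absurd h2 (F.two_notMem h1)) (fun v hv => by
      obtain ⟨r, hr, rfl⟩ := Finset.mem_image.1 hv
      rw [Finset.mem_Ioo] at hr
      exact ⟨r, rfl, F.seg _ (by omega) (by omega), F.seg _ (by omega) (by omega),
        F.seg _ (by omega) (by omega)⟩)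
  have h5 : ((Finset.Ioo (α + 1) (β - 1)).image c).card = (β - α - 3).toNat := by
    rw [Finset.card_image_of_injOn, Int.card_Ioo]
    · congr 1; ring
    · intro r hr s hs hrs
      rw [Finset.mem_coe, Finset.mem_Ioo] at hr hs
      exact F.inj_of hrs (by omega) (by omega)
  rwa [h5, Finset.card_empty] at h4

theorem num {t τ : ℤ} (ht : c t ∈ A) (h : α < t) (h' : t < α + m)
    (hτ : τ = t + 1 ∨ τ = t + 2) (B M : Finset V) (Z : Finset V)
    (hB : ∀ v ∈ B, (v ∈ A ∨ ∃ r, α + 1 < r ∧ r < β ∧ c r = v) ∧ ¬ G.Adj (c (α + 1)) v)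
    (hM : ∀ v ∈ M, v ∈ A ∧ ¬ G.Adj (c τ) v)
    (hZ : ∀ r, α < r → r < β → G.Adj (c τ) (c r) → c r ∈ Z) : B.card + M.card ≤ 1 + Z.card := by
  have hτA : c τ ∉ A := by
    rcases hτ with rfl | rfl
    · exact F.no_two ht
    · exact F.two_notMem ht
  have hlt := F.lt3 F.hα F.hβ F.lt
  have hlt' := F.lt'
  have hτm : τ < α + m := by
    have h1 := F.lt3 ht (F.memA_add F.hα) h'
    omega
  have h1 := deg_add_le (v := c (α + 1)) (X := A ∪ (Finset.Ioo (α + 1) β).image c) (B := B)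
    (fun w hw => by
      rcases F.first_nbr hw with h1 | ⟨r, h1, h2, h3⟩
      · exact Finset.mem_union_left _ h1
      · exact Finset.mem_union_right _ (Finset.mem_image.2 ⟨r, Finset.mem_Ioo.2 ⟨h1, h2⟩, h3⟩))
    (fun v hv => by
      refine ⟨?_, (hB v hv).2⟩
      rcases (hB v hv).1 with h1 | ⟨r, h1, h2, h3⟩
      · exact Finset.mem_union_left _ h1
      · exact Finset.mem_union_right _ (Finset.mem_image.2 ⟨r, Finset.mem_Ioo.2 ⟨h1, h2⟩, h3⟩))
  have h2 := deg_add_le (v := c τ) (X := insert (c (2 * t + 3 - τ)) (A ∪ Z)) (B := M)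
    (fun w hw => by
      simp only [Finset.mem_insert, Finset.mem_union]
      rcases F.other_nbr ht h h' hτ hw with h1 | h1 | ⟨r, h1, h2, h3⟩
      · exact Or.inl h1
      · exact Or.inr (Or.inl h1)
      · subst h3; exact Or.inr (Or.inr (hZ r h1 h2 hw)))
    (fun v hv => ⟨by simp [(hM v hv).1], (hM v hv).2⟩)
  have h3 := F.ki (α + 1) τ (F.no_two F.hα) hτA
    (F.ne_of (by omega) (by omega)) (F.first_nadj ht h h' hτ)
  have h4 := F.le_m
  have h6 : ((Finset.Ioo (α + 1) β).image c).card ≤ (β - α - 2).toNat :=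
    Finset.card_image_le.trans (by rw [Int.card_Ioo]; omega)
  have h7 := Finset.card_union_le A ((Finset.Ioo (α + 1) β).image c)
  have h8 := (Finset.card_insert_le (c (2 * t + 3 - τ)) (A ∪ Z)).trans
    (Nat.add_le_add_right (Finset.card_union_le A Z) 1)
  omega

end Fi

namespace Fi
variable [Fintype V] {G : SimpleGraph V} {m : ℕ} {c : ℤ → V} {H A : Finset V} {α β : ℤ}
  (F : Fi G m c H A α β)
include F

theorem last_nadj {t τ : ℤ} (ht : c t ∈ A) (h : α < t) (h' : t < α + m)
    (hτ : τ = t + 1 ∨ τ = t + 2) : ¬ G.Adj (c (β - 1)) (c τ) := by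
  have hβ : β ≤ t := by
    by_contra hβ
    exact F.seg t h (by omega) ht
  have h3 := F.len t h h' ht
  have h4 := F.lt3 ht (F.memA_add F.hα) h'
  have h5 := F.lt
  have := F.mirror.first_nadj (t := -(t + 3) + m) (τ := -τ + m)
    (by rw [show -(-(t + 3) + (m : ℤ)) = t + 3 - m by ring, F.per_sub]; exact h3)
    (by omega) (by omega) (by omega)
  rwa [show -(-β + 1) = β - 1 by ring, show -(-τ + (m : ℤ)) = τ - m by ring, F.per_sub] at this

theorem start {t y : ℤ} (ht : c t ∈ A) (h : α < t) (h' : t < α + m) (hy : α < y) (hy' : y < β)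
    (hadj : G.Adj (c (t + 1)) (c y)) : α + 3 ≤ y ∧ y + 2 ≤ β ∧
      ¬ G.Adj (c (α + 1)) (c (y + 1)) ∧ ¬ G.Adj (c (α + 1)) (c (y + 2)) ∧
      ∀ z, α < z → z < β → G.Adj (c (t + 1)) (c z) → z = y := by
  have hβ : β ≤ t := by
    by_contra hβ
    exact F.seg t h (by omega) ht
  have key : ∀ y, α < y → y < β → G.Adj (c (t + 1)) (c y) → α + 3 ≤ y ∧ y + 2 ≤ β ∧
      ¬ G.Adj (c (α + 1)) (c (y + 1)) ∧ ¬ G.Adj (c (α + 1)) (c (y + 2)) := by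
    intro y hy hy' hadj
    have h1 : y ≠ α + 1 := by
      rintro rfl; exact F.uu F.hα ht h h' hadj.symm
    have h2 : y ≠ α + 2 := by
      rintro rfl; exact F.r2 F.hα ht h h' (F.noU _ F.hα) hadj
    have h3 : y ≠ β - 1 := by
      rintro rfl; exact F.last_nadj ht h h' (Or.inl rfl) hadj.symm
    refine ⟨by omega, by omega, ?_, F.r1 F.hα ht h' hy (by omega) (F.seg _ (by omega) (by omega))
      hadj⟩
    exact (F.basic F.hα ht h h').excl F.toFr (infix_ivl c (by omega) (by omega)) hadj
  have bl : ∀ y, α < y → y < β → G.Adj (c (t + 1)) (c y) → LI G m c α t (y + 1) := by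
    intro y hy hy' hadj
    have h1 := key y hy hy' hadj
    refine Or.inl ⟨by omega, by omega, ?_, by rw [show y + 1 + 1 = y + 2 by ring]; exact h1.2.2.2⟩
    exact F.r3 F.hα ht h' hy (by omega) (fun r hr hr' => F.seg r hr (by omega)) hadj
  have h1 := key y hy hy' hadj
  refine ⟨h1.1, h1.2.1, h1.2.2.1, h1.2.2.2, fun z hz hz' hadj' => ?_⟩
  have := F.excess F.hα ht h h' (bl y hy hy' hadj) (bl z hz hz' hadj')
    (by rw [add_sub_cancel_right]; exact F.seg _ hy hy')
    (by rw [add_sub_cancel_right]; exact F.seg _ hz hz')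
  omega

theorem hub {t₀ y₀ : ℤ} (ht₀ : c t₀ ∈ A) (h₀ : α < t₀) (h₀' : t₀ < α + m) (hy₀ : α < y₀)
    (hy₀' : y₀ < β) (hadj₀ : G.Adj (c (t₀ + 1)) (c y₀)) :
    ∃ y, α + 3 ≤ y ∧ y + 2 ≤ β ∧
      ¬ G.Adj (c (α + 1)) (c (y + 1)) ∧ ¬ G.Adj (c (α + 1)) (c (y + 2)) ∧
      (∀ v, (v ∈ A ∨ ∃ r, α + 1 < r ∧ r < β ∧ c r = v) → v ≠ c (y + 1) → v ≠ c (y + 2) →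
        G.Adj (c (α + 1)) v) ∧
      ∀ t, c t ∈ A → α < t → t < α + m → G.Adj (c (t + 1)) (c y) ∧
        (∀ z, α < z → z < β → G.Adj (c (t + 1)) (c z) → z = y) ∧
        (∀ a ∈ A, G.Adj (c (t + 1)) a) ∧ ∃ z, α < z ∧ z < β ∧ G.Adj (c (t + 2)) (c z) := by
  have hlt' := F.lt'
  have hB : ∀ {t y : ℤ}, c t ∈ A → α < t → t < α + m → α < y → y < β →
      G.Adj (c (t + 1)) (c y) → ∀ v ∈ ({c (y + 1), c (y + 2)} : Finset V),
      (v ∈ A ∨ ∃ r, α + 1 < r ∧ r < β ∧ c r = v) ∧ ¬ G.Adj (c (α + 1)) v := by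
    intro t y ht h h' hy hy' hadj v hv
    obtain ⟨h1, h2, h3, h4, -⟩ := F.start ht h h' hy hy' hadj
    simp only [Finset.mem_insert, Finset.mem_singleton] at hv
    rcases hv with rfl | rfl
    · exact ⟨Or.inr ⟨_, by omega, by omega, rfl⟩, h3⟩
    · refine ⟨?_, h4⟩
      rcases eq_or_lt_of_le h2 with h5 | h5
      · left; rw [h5]; exact F.hβ
      · exact Or.inr ⟨_, by omega, h5, rfl⟩
  have hB2 : ∀ {y : ℤ}, α < y → y < β → ({c (y + 1), c (y + 2)} : Finset V).card = 2 :=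
    fun hy hy' => Finset.card_pair (F.ne_of (by omega) (by omega))
  have hex : ∀ t τ, c t ∈ A → α < t → t < α + m → (τ = t + 1 ∨ τ = t + 2) →
      ∃ z, α < z ∧ z < β ∧ G.Adj (c τ) (c z) := by
    intro t τ ht h h' hτ
    by_contra! hno
    have := F.num ht h h' hτ {c (y₀ + 1), c (y₀ + 2)} ∅ ∅ (hB ht₀ h₀ h₀' hy₀ hy₀' hadj₀)
      (by simp) (fun r hr hr' hadj => absurd hadj (hno r hr hr'))
    rw [hB2 hy₀ hy₀'] at this
    simp at this
  obtain ⟨h1, h2, h3, h4, h5⟩ := F.start ht₀ h₀ h₀' hy₀ hy₀' hadj₀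
  have hall : ∀ v, (v ∈ A ∨ ∃ r, α + 1 < r ∧ r < β ∧ c r = v) → v ≠ c (y₀ + 1) →
      v ≠ c (y₀ + 2) → G.Adj (c (α + 1)) v := by
    intro v hv hv1 hv2
    by_contra hadj
    have := F.num ht₀ h₀ h₀' (Or.inl rfl) (insert v {c (y₀ + 1), c (y₀ + 2)}) ∅ {c y₀} (by
      intro w hw
      rcases Finset.mem_insert.1 hw with rfl | hw
      · exact ⟨hv, hadj⟩
      · exact hB ht₀ h₀ h₀' hy₀ hy₀' hadj₀ w hw)
      (by simp) (fun r hr hr' hadj => by rw [h5 r hr hr' hadj]; simp)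
    rw [Finset.card_insert_of_notMem (by simp [hv1, hv2]), hB2 hy₀ hy₀'] at this
    simp at this
  refine ⟨y₀, h1, h2, h3, h4, hall, fun t ht h h' => ?_⟩
  obtain ⟨y, hy, hy', hadj⟩ := hex t (t + 1) ht h h' (Or.inl rfl)
  obtain ⟨g1, g2, g3, g4, g5⟩ := F.start ht h h' hy hy' hadj
  have hyy : y = y₀ := by
    have k1 : ∀ w, (w = y + 1 ∨ w = y + 2) → w = y₀ + 1 ∨ w = y₀ + 2 := by
      intro w hw
      have hw1 := hB ht h h' hy hy' hadj (c w) (by rcases hw with rfl | rfl <;> simp)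
      by_contra! hne
      refine hw1.2 (hall _ hw1.1 (fun e => hne.1 ?_) (fun e => hne.2 ?_)) <;>
        exact F.inj_of e (by omega) (by omega)
    have := k1 _ (Or.inl rfl)
    have := k1 _ (Or.inr rfl)
    omega
  subst hyy
  refine ⟨hadj, g5, fun a ha => ?_, hex t (t + 2) ht h h' (Or.inr rfl)⟩
  by_contra hna
  have := F.num ht h h' (Or.inl rfl) {c (y + 1), c (y + 2)} {a} {c y}
    (hB ht h h' hy hy' hadj) (by simpa using ⟨ha, hna⟩)
    (fun r hr hr' hadj => by rw [g5 r hr hr' hadj]; simp)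
  rw [hB2 hy hy'] at this
  simp at this

end Fi

namespace Fi
variable [Fintype V] {G : SimpleGraph V} {m : ℕ} {c : ℤ → V} {H A : Finset V} {α β : ℤ}
  (F : Fi G m c H A α β)
include F

theorem hub' {t₀ y₀ : ℤ} (ht₀ : c t₀ ∈ A) (h₀ : α < t₀) (h₀' : t₀ < α + m) (hy₀ : α < y₀)
    (hy₀' : y₀ < β) (hadj₀ : G.Adj (c (t₀ + 2)) (c y₀)) :
    ∃ y, α + 2 ≤ y ∧ y + 3 ≤ β ∧
      ¬ G.Adj (c (β - 1)) (c (y - 1)) ∧ ¬ G.Adj (c (β - 1)) (c (y - 2)) ∧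
      (∀ r, y ≤ r → r < β - 1 → G.Adj (c (β - 1)) (c r)) ∧
      ∀ t, c t ∈ A → α < t → t < α + m → G.Adj (c (t + 2)) (c y) ∧
        (∀ z, α < z → z < β → G.Adj (c (t + 2)) (c z) → z = y) ∧
        ∀ a ∈ A, G.Adj (c (t + 2)) a := by
  have key : ∀ t, c t ∈ A → α < t → t < α + m → c (-(-(t + 3) + (m : ℤ))) ∈ A ∧
      -β < -(t + 3) + (m : ℤ) ∧ -(t + 3) + (m : ℤ) < -β + m ∧
      c (-(-(t + 3) + (m : ℤ) + 1)) = c (t + 2) := by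
    intro t ht h h'
    have hβ : β ≤ t := by
      by_contra hβ
      exact F.seg t h (by omega) ht
    have h3 := F.len t h h' ht
    have h4 := F.lt3 ht (F.memA_add F.hα) h'
    have h5 := F.lt
    refine ⟨?_, by omega, by omega, ?_⟩
    · rw [show -(-(t + 3) + (m : ℤ)) = t + 3 - m by ring, F.per_sub]; exact h3
    · rw [show -(-(t + 3) + (m : ℤ) + 1) = t + 2 - m by ring, F.per_sub]
  obtain ⟨k1, k2, k3, k4⟩ := key t₀ ht₀ h₀ h₀'
  have hlt' := F.lt'
  obtain ⟨y, h1, h2, h3, h4, h5, h6⟩ := F.mirror.hub (y₀ := -y₀) k1 k2 k3 (by omega) (by omega)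
    (by rw [k4, neg_neg]; exact hadj₀)
  refine ⟨-y, by omega, by omega, ?_, ?_, fun r hr hr' => ?_, fun t ht h h' => ?_⟩
  · rwa [show -(-β + 1) = β - 1 by ring, show -(y + 1) = -y - 1 by ring] at h3
  · rwa [show -(-β + 1) = β - 1 by ring, show -(y + 2) = -y - 2 by ring] at h4
  · have := h5 (c r) (Or.inr ⟨-r, by omega, by omega, by simp⟩)
      (F.ne_of (by omega) (by omega)).symm (F.ne_of (by omega) (by omega)).symm
    rwa [show -(-β + 1) = β - 1 by ring] at this
  · obtain ⟨k1, k2, k3, k4⟩ := key t ht h h'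
    obtain ⟨g1, g2, g3, -⟩ := h6 _ k1 k2 k3
    rw [k4] at g1 g2 g3
    refine ⟨g1, fun z hz hz' hadj => ?_, g3⟩
    have := g2 (-z) (by omega) (by omega) (by rwa [neg_neg])
    omega

theorem cross_one {y z : ℤ} (h : α < z) (h' : z < y) (hy : y < β)
    (hz : G.Adj (c (α + 1)) (c (z + 1))) (hu : G.Adj (c (β + 1)) (c y)) :
    ¬ G.Adj (c (y + 1)) (c z) := by
  have hlt' := F.lt'
  refine F.sp (LP.iv F.adj (show y + 1 ≤ β by omega)).pt
    (((LP.iv F.adj (show α + 1 ≤ z by omega)).rev.app hz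
      (LP.iv F.adj (show z + 1 ≤ y by omega))).app hu.symm
        (LP.iv F.adj (show β + 1 ≤ α + m by omega))).pt F.hβ (F.memA_add F.hα) ?_
  rw [← F.full α, ivl_append c (p := α + 1) (r := z) (q := α + m) (by omega) (by omega),
    ivl_append c (p := z + 1) (r := y) (q := α + m) (by omega) (by omega),
    ivl_append c (p := y + 1) (r := β) (q := α + m) (by omega) (by omega)]
  simp only [← Multiset.coe_add, Multiset.coe_reverse]
  abel

theorem left_len {y : ℤ} (hy : α + 3 ≤ y) (hy' : y + 2 ≤ β)
    (hN : ∀ t τ, c t ∈ A → α < t → t < α + m → (τ = t + 1 ∨ τ = t + 2) →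
      ∀ z, α < z → z < β → G.Adj (c τ) (c z) → z = y)
    (hu : G.Adj (c (β + 1)) (c y)) (hall : ∀ r, α + 1 < r → r ≤ y → G.Adj (c (α + 1)) (c r)) :
    y = α + 3 := by
  have hlt := F.lt
  have hlt' := F.lt'
  have h1 := deg_add_le (v := c (β + 1)) (X := insert (c (2 * β + 3 - (β + 1))) (A ∪ {c y}))
    (B := ∅) (fun w hw => by
      simp only [Finset.mem_insert, Finset.mem_union, Finset.mem_singleton]
      rcases F.other_nbr F.hβ hlt hlt' (Or.inl rfl) hw with h1 | h1 | ⟨r, h1, h2, h3⟩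
      · exact Or.inl h1
      · exact Or.inr (Or.inl h1)
      · subst h3
        rw [hN β _ F.hβ hlt hlt' (Or.inl rfl) r h1 h2 hw]
        exact Or.inr (Or.inr rfl)) (by simp)
  have h2 := deg_add_le (v := c (y + 1)) (X := A ∪ ((Finset.Ico y β).erase (y + 1)).image c)
    (B := ∅) (fun w hw => by
      obtain ⟨s, rfl⟩ := F.nbrC (F.seg (y + 1) (by omega) (by omega)) w hw
      obtain ⟨r, h1, h2, h3⟩ := F.rep α s
      rw [← h3] at hw ⊢
      by_cases hr : c r ∈ A
      · exact Finset.mem_union_left _ hr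
      rcases F.pos h2 hr with h4 | ⟨κ, h4, h5, h6, h7⟩
      · refine Finset.mem_union_right _ (Finset.mem_image_of_mem _ ?_)
        rw [Finset.mem_erase, Finset.mem_Ico]
        refine ⟨?_, ?_, h4⟩
        · rintro rfl; exact G.loopless.irrefl _ hw
        · by_contra hry
          exact F.cross_one h1 (by omega) (by omega) (hall _ (by omega) (by omega)) hu hw
      · have := hN κ r h6 (by omega) h5 h7 (y + 1) (by omega) (by omega) hw.symm
        omega) (by simp)
  have h3 := F.ki (y + 1) (β + 1) (F.seg _ (by omega) (by omega)) (F.no_two F.hβ)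
    (F.ne_of (by omega) (by omega)) (fun hadj => by
      have := hN β _ F.hβ hlt hlt' (Or.inl rfl) (y + 1) (by omega) (by omega) hadj.symm
      omega)
  have h4 := F.le_m
  have h5 := (Finset.card_insert_le (c (2 * β + 3 - (β + 1))) (A ∪ {c y})).trans
    (Nat.add_le_add_right (Finset.card_union_le A {c y}) 1)
  have h6 := Finset.card_union_le A (((Finset.Ico y β).erase (y + 1)).image c)
  have h7 : (((Finset.Ico y β).erase (y + 1)).image c).card ≤ (β - y).toNat - 1 :=
    Finset.card_image_le.trans (by
      rw [Finset.card_erase_of_mem (by rw [Finset.mem_Ico]; omega), Int.card_Ico])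
  rw [Finset.card_singleton] at h5
  rw [Finset.card_empty] at h1 h2
  omega

theorem no_first {t₀ y₀ : ℤ} (ht₀ : c t₀ ∈ A) (h₀ : α < t₀) (h₀' : t₀ < α + m) (hy₀ : α < y₀)
    (hy₀' : y₀ < β) : ¬ G.Adj (c (t₀ + 1)) (c y₀) := by
  intro hadj₀
  have hlt := F.lt
  have hlt' := F.lt'
  obtain ⟨y, h1, h2, h3, h4, hall, hu⟩ := F.hub ht₀ h₀ h₀' hy₀ hy₀' hadj₀
  obtain ⟨z, hz, hz', hadjz⟩ := (hu t₀ ht₀ h₀ h₀').2.2.2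
  obtain ⟨y', h1', h2', h3', h4', hall', hw⟩ := F.hub' ht₀ h₀ h₀' hz hz' hadjz
  obtain ⟨u1, u2, u3, -⟩ := hu β F.hβ hlt hlt'
  obtain ⟨w1, w2, w3⟩ := hw β F.hβ hlt hlt'
  have hβ3 := F.len β hlt hlt' F.hβ
  have hm3 := F.lt3 F.hβ (F.memA_add F.hα) hlt'
  have hsplit : CM m c = (ivl c (α + 1) β : List V) +
      (([c (β + 1), c (β + 2)] : List V) : Multiset V) + (ivl c (β + 3) (α + m) : List V) := by
    rw [← F.full α, ivl_append c (p := α + 1) (r := β) (q := α + m) (by omega) (by omega),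
      ivl_cons c (p := β + 1) (by omega), ivl_cons c (p := β + 1 + 1) (by omega),
      show β + 1 + 1 = β + 2 by ring, show β + 2 + 1 = β + 3 by ring]
    simp only [← Multiset.coe_add, ← Multiset.cons_coe, Multiset.coe_nil,
      ← Multiset.singleton_add]
    abel
  have S : Spl G m c A (c (α + 1)) (c β) (ivl c (α + 1) β) (c (β + 2)) (c (α + m))
      ([c (β + 2), c (β + 1)] ++ ivl c (β + 3) (α + m)) := by
    refine ⟨LP.iv F.adj (by omega), ?_, F.hβ, F.memA_add F.hα, ?_⟩
    · have := F.adj (β + 1)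
      rw [show β + 1 + 1 = β + 2 by ring] at this
      exact LP.app (v := c (β + 1)) ⟨by simpa using this.symm, rfl, rfl⟩ (u3 _ hβ3)
        (LP.iv F.adj (by omega))
    · rw [hsplit]
      simp only [← Multiset.coe_add, ← Multiset.cons_coe, Multiset.coe_nil,
        ← Multiset.singleton_add]
      abel
  have hy1 : ¬ G.Adj (c (α + 1)) (c (y' + 1)) :=
    S.excl F.toFr (infix_ivl c (by omega) (by omega)) w1
  have hyy : y' = y ∨ y' = y + 1 := by
    by_contra! hne
    exact hy1 (hall _ (Or.inr ⟨_, by omega, by omega, rfl⟩)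
      (fun e => hne.1 (by have := F.inj_of e (by omega) (by omega); omega))
      (fun e => hne.2 (by have := F.inj_of e (by omega) (by omega); omega)))
  rcases hyy with rfl | rfl
  swap
  · have e1 := (LP.iv F.adj (show β + 3 ≤ α + m by omega)).pt
    have e2 := (LP.iv F.adj (show α + 1 ≤ y by omega)).pt
    have e3 := e1.app (by rw [F.per]; exact F.adj α) e2
    have e4 : PT G (c (β + 1)) (c β) (({c (β + 1)} : Multiset V) + ({c (β + 2)} : Multiset V) +
        (ivl c (y + 1) β : List V)) := by
      have := F.adj (β + 1)
      rw [show β + 1 + 1 = β + 2 by ring] at this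
      exact ((LP.single (c (β + 1))).pt.app this (LP.single (c (β + 2))).pt).app w1
        (LP.iv F.adj (by omega)).pt
    refine F.sp e3.rev e4 hβ3 F.hβ ?_ u1.symm
    rw [hsplit, ivl_append c (p := α + 1) (r := y) (q := β) (by omega) (by omega)]
    simp only [← Multiset.coe_add, ← Multiset.cons_coe, Multiset.coe_nil, ← Multiset.singleton_add]
    abel
  have hN : ∀ t τ, c t ∈ A → α < t → t < α + m → (τ = t + 1 ∨ τ = t + 2) →
      ∀ z, α < z → z < β → G.Adj (c τ) (c z) → z = y' := by
    rintro t τ ht h h' (rfl | rfl)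
    · exact (hu t ht h h').2.1
    · exact (hw t ht h h').2.1
  have hleft : ∀ r, α + 1 < r → r ≤ y' → G.Adj (c (α + 1)) (c r) := fun r hr hr' =>
    hall _ (Or.inr ⟨r, hr, by omega, rfl⟩) (F.ne_of (by omega) (by omega))
      (F.ne_of (by omega) (by omega))
  have hyα := F.left_len h1 h2 hN u1 hleft
  have hα3 := F.len_sub (t := α + m) (by omega) le_rfl (F.memA_add F.hα)
  have hα3' : α < α + m - 3 := by omega
  have hyw : G.Adj (c (α - 1)) (c y') := by
    have := (hw _ hα3 hα3' (by omega)).1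
    rwa [show α + (m : ℤ) - 3 + 2 = α - 1 + m by ring, F.per] at this
  have hyβ : -y' = -β + 3 := by
    refine F.mirror.left_len (by omega) (by omega) ?_
      (by rw [show -(-α + 1) = α - 1 by ring, neg_neg]; exact hyw) ?_
    · intro t τ ht h h' hτ z hz hz' hadj
      have k0 : -t ≤ α := by
        by_contra k0
        exact F.seg (-t) (by omega) (by omega) ht
      have k1 := F.len_sub (t := -t + m) (by omega) (by omega) (by rw [F.per]; exact ht)
      have k2 := F.len_sub (t := -t + m) (by omega) (by omega) (by rw [F.per]; exact ht)
      have k3 := F.lt3 F.hβ (show c (-t + m) ∈ A by rw [F.per]; exact ht) (by omega)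
      have := hN _ (-τ + m) k1 (by omega) (by omega) (by omega) (-z) (by omega) (by omega)
        (by rw [F.per]; exact hadj)
      omega
    · intro r hr hr'
      rw [show -(-β + 1) = β - 1 by ring]
      exact hall' (-r) (by omega) (by omega)
  have hleft2 : ∀ z, α < z → z < y' → ¬ G.Adj (c (y' + 1)) (c z) := fun z hz hz' =>
    F.cross_one hz hz' (by omega) (hleft _ (by omega) (by omega)) u1
  have hright2 : ∀ z, y' < z → z < β → ¬ G.Adj (c (y' - 1)) (c z) := fun z hz hz' hadj => by
    refine F.mirror.cross_one (y := -y') (z := -z) (by omega) (by omega) (by omega) ?_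
      (by rw [show -(-α + 1) = α - 1 by ring, neg_neg]; exact hyw)
      (by rw [neg_neg, show -(-y' + 1) = y' - 1 by ring]; exact hadj)
    rw [show -(-β + 1) = β - 1 by ring, show -(-z + 1) = z - 1 by ring]
    exact hall' _ (by omega) (by omega)
  have hLR : ∀ r s, α < r → r < y' → y' < s → s < β → ¬ G.Adj (c r) (c s) := by
    intro r s hr hr' hs hs' hadj
    rcases eq_or_lt_of_le (show r ≤ y' - 1 by omega) with rfl | k1
    · exact hright2 s hs hs' hadj
    rcases eq_or_lt_of_le (show y' + 1 ≤ s by omega) with rfl | k2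
    · exact hleft2 r hr hr' hadj.symm
    · rw [show r = α + 1 by omega, show s = y' + 2 by omega] at hadj
      exact h4 hadj
  have hyA := F.seg y' (by omega) (by omega)
  obtain ⟨a, b, s, t, k1, k2, k3, k4, k5, k6, k7, k8, k9⟩ := F.crossing (T := insert (c y') A)
    (fun v hv => by
      rcases Finset.mem_insert.1 hv with rfl | hv
      · exact ⟨_, rfl⟩
      · exact ((F.memA v).1 hv).1)
    (Finset.subset_insert _ _)
    (fun t ht ht' => by
      rw [Finset.mem_insert] at ht ht'
      have e1 : ∀ i, c (t + i) = c y' → c t = c (y' - i) := fun i e => by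
        rw [F.per_iff] at e ⊢
        rwa [show t - (y' - i) = t + i - y' by ring]
      have e2 : c t = c y' → c (t + 1) = c (y' + 1) := fun e => by
        rw [F.per_iff] at e ⊢
        rwa [show t + 1 - (y' + 1) = t - y' by ring]
      rcases ht with ht | ht <;> rcases ht' with ht' | ht'
      · rw [e2 ht] at ht'
        exact F.ne_of (by omega) (by omega) ht'.symm
      · rw [e2 ht] at ht'
        exact F.seg _ (by omega) (by omega) ht'
      · rw [e1 1 ht'] at ht
        exact F.seg _ (by omega) (by omega) ht
      · exact F.no_two ht ht')
  have hab : c a ≠ c b := F.ne_of (by omega) (by omega)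
  have hcl : ∀ p σ, p < σ → c p ∈ insert (c y') A →
      (∀ r, p < r → r ≤ σ → c r ∉ insert (c y') A) → ∃ σ', c σ' = c σ ∧
        ((α < σ' ∧ σ' < y' ∧ c p = c α) ∨ (y' < σ' ∧ σ' < β ∧ c p = c y') ∨
        ∃ κ, β ≤ κ ∧ κ < α + m ∧ c κ ∈ A ∧ (σ' = κ + 1 ∨ σ' = κ + 2) ∧ c p = c κ) := by
    intro p σ hp hpT hpσ
    have hσT := hpσ σ hp le_rfl
    obtain ⟨σ', s1, s2, s3⟩ := F.rep α σ
    rw [← s3] at hσT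
    have hσA : c σ' ∉ A := fun h => hσT (Finset.mem_insert_of_mem h)
    have hσy : σ' ≠ y' := fun h => hσT (by rw [h]; exact Finset.mem_insert_self _ _)
    refine ⟨σ', s3, ?_⟩
    have hU : ∀ κ, c κ ∈ insert (c y') A → κ < σ' →
        (∀ r, κ < r → r ≤ σ' → c r ∉ A ∧ r ≠ y' ∧ y' - m < r ∧ r < y' + m) → c p = c κ := by
      refine fun κ g g' g'' => F.pred_unique s3.symm hp g' hpT g hpσ fun r hr hr' h => ?_
      obtain ⟨q1, q2, q3, q4⟩ := g'' r hr hr'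
      rcases Finset.mem_insert.1 h with h | h
      · have := F.inj_of h (by omega) (by omega)
        omega
      · exact q1 h
    rcases F.pos s2 hσA with h | ⟨κ, h1, h2, h3, h4⟩
    · rcases lt_or_gt_of_ne hσy with h' | h'
      · exact Or.inl ⟨s1, h', hU α (Finset.mem_insert_of_mem F.hα) s1 fun r hr hr' =>
          ⟨F.seg r hr (by omega), by omega, by omega, by omega⟩⟩
      · exact Or.inr (Or.inl ⟨h', h, hU y' (Finset.mem_insert_self _ _) h' fun r hr hr' =>
          ⟨F.seg r (by omega) (by omega), by omega, by omega, by omega⟩⟩)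
    · refine Or.inr (Or.inr ⟨κ, h1, h2, h3, h4, hU κ (Finset.mem_insert_of_mem h3) (by omega)
        fun r hr hr' => ⟨?_, by omega, by omega, by omega⟩⟩)
      rcases (show r = κ + 1 ∨ r = κ + 2 by omega) with rfl | rfl
      · exact F.no_two h3
      · exact F.two_notMem h3
  obtain ⟨s', hs, hs'⟩ := hcl a s k1 k5 k7
  obtain ⟨t', ht, ht'⟩ := hcl b t k3 k6 k8
  rw [← hs, ← ht] at k9
  rcases hs' with ⟨p1, p2, p3⟩ | ⟨p1, p2, p3⟩ | ⟨κ, p1, p2, p4, p5, p3⟩ <;>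
    rcases ht' with ⟨q1, q2, q3⟩ | ⟨q1, q2, q3⟩ | ⟨κ', q1, q2, q4, q5, q3⟩
  · exact hab (p3.trans q3.symm)
  · exact hLR _ _ p1 p2 q1 q2 k9
  · have := hN κ' t' q4 (by omega) q2 q5 s' (by omega) (by omega) k9.symm
    omega
  · exact hLR _ _ q1 q2 p1 p2 k9.symm
  · exact hab (p3.trans q3.symm)
  · have := hN κ' t' q4 (by omega) q2 q5 s' (by omega) (by omega) k9.symm
    omega
  · have := hN κ s' p4 (by omega) p2 p5 t' (by omega) (by omega) k9
    omega
  · have := hN κ s' p4 (by omega) p2 p5 t' (by omega) (by omega) k9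
    omega
  · have e1 := F.len κ (by omega) p2 p4
    have e2 := F.len κ' (by omega) q2 q4
    rcases lt_trichotomy κ κ' with h | rfl | h
    · exact F.end_end p4 q4 e1 e2 h (by omega) p5 q5 k9
    · exact hab (p3.trans q3.symm)
    · exact F.end_end q4 p4 e2 e1 h (by omega) q5 p5 k9.symm

end Fi

theorem Fi.no_edge [Fintype V] {G : SimpleGraph V} {m : ℕ} {c : ℤ → V} {H A : Finset V} {α β : ℤ}
    (F : Fi G m c H A α β) {t τ y : ℤ} (ht : c t ∈ A) (h : α < t) (h' : t < α + m)
    (hτ : τ = t + 1 ∨ τ = t + 2) (hy : α < y) (hy' : y < β) : ¬ G.Adj (c τ) (c y) := by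
  rcases hτ with rfl | rfl
  · exact F.no_first ht h h' hy hy'
  · have hβ : β ≤ t := by
      by_contra hβ
      exact F.seg t h (by omega) ht
    have h3 := F.len t h h' ht
    have h4 := F.lt3 ht (F.memA_add F.hα) h'
    have h5 := F.lt
    have := F.mirror.no_first (t₀ := -(t + 3) + m) (y₀ := -y)
      (by rw [show -(-(t + 3) + (m : ℤ)) = t + 3 - m by ring, F.per_sub]; exact h3)
      (by omega) (by omega) (by omega) (by omega)
    rwa [show -(-(t + 3) + (m : ℤ) + 1) = t + 2 - m by ring, F.per_sub, neg_neg] at this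

theorem Fi.false [Fintype V] {G : SimpleGraph V} {m : ℕ} {c : ℤ → V} {H A : Finset V} {α β : ℤ}
    (F : Fi G m c H A α β) : False := by
  have hlt := F.lt
  have hlt' := F.lt'
  obtain ⟨a, b, s, t, k1, k2, k3, k4, k5, k6, k7, k8, k9⟩ := F.crossing
    (fun v hv => ((F.memA v).1 hv).1) subset_rfl (fun t ht => F.no_two ht)
  have hab : c a ≠ c b := F.ne_of (by omega) (by omega)
  have hcl : ∀ p σ, p < σ → c p ∈ A → (∀ r, p < r → r ≤ σ → c r ∉ A) → ∃ σ', c σ' = c σ ∧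
      ((α < σ' ∧ σ' < β ∧ c p = c α) ∨
        ∃ κ, β ≤ κ ∧ κ < α + m ∧ c κ ∈ A ∧ (σ' = κ + 1 ∨ σ' = κ + 2) ∧ c p = c κ) := by
    intro p σ hp hpA hpσ
    have hσA := hpσ σ hp le_rfl
    obtain ⟨σ', s1, s2, s3⟩ := F.rep α σ
    rw [← s3] at hσA
    refine ⟨σ', s3, ?_⟩
    rcases F.pos s2 hσA with h | ⟨κ, h1, h2, h3, h4⟩
    · exact Or.inl ⟨s1, h, F.pred_unique s3.symm hp s1 hpA F.hα hpσ fun r hr hr' =>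
        F.seg r hr (by omega)⟩
    · refine Or.inr ⟨κ, h1, h2, h3, h4, F.pred_unique s3.symm hp (by omega) hpA h3 hpσ
        fun r hr hr' => ?_⟩
      rcases (show r = κ + 1 ∨ r = κ + 2 by omega) with rfl | rfl
      · exact F.no_two h3
      · exact F.two_notMem h3
  obtain ⟨s', hs, hs'⟩ := hcl a s k1 k5 k7
  obtain ⟨t', ht, ht'⟩ := hcl b t k3 k6 k8
  rw [← hs, ← ht] at k9
  rcases hs' with ⟨p1, p2, p3⟩ | ⟨κ, p1, p2, p4, p5, p3⟩ <;>
    rcases ht' with ⟨q1, q2, q3⟩ | ⟨κ', q1, q2, q4, q5, q3⟩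
  · exact hab (p3.trans q3.symm)
  · exact F.no_edge q4 (by omega) q2 q5 p1 p2 k9.symm
  · exact F.no_edge p4 (by omega) p2 p5 q1 q2 k9
  · have e1 := F.len κ (by omega) p2 p4
    have e2 := F.len κ' (by omega) q2 q4
    rcases lt_trichotomy κ κ' with h | rfl | h
    · exact F.end_end p4 q4 e1 e2 h (by omega) p5 q5 k9
    · exact hab (p3.trans q3.symm)
    · exact F.end_end q4 p4 e2 e1 h (by omega) q5 p5 k9.symm

namespace Rg
variable [Fintype V] {G : SimpleGraph V} {m : ℕ} {c : ℤ → V} {H A : Finset V}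
  (F : Rg G m c H A)
include F

theorem false_of_len {α : ℤ} (hα : c α ∈ A)
    (len : ∀ t, α < t → t < α + m → c t ∈ A → c (t + 3) ∈ A) : False := by
  have hm := F.three
  obtain ⟨β, h1, h2, h3, h4⟩ := F.exists_succ hα (α + 1) (F.no_two hα)
  have h5 := F.card_index hα
  have h6 := F.two
  obtain ⟨t, ht⟩ := Finset.card_pos.1 (show 0 <
    ((Finset.Ioo α (α + m)).filter fun t => c t ∈ A).card by omega)
  rw [Finset.mem_filter, Finset.mem_Ioo] at ht
  have h7 : β ≤ t := by
    by_contra h7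
    exact h4 t (by omega) (by omega) ht.2
  exact Fi.false (α := α) (β := β) ⟨F, hα, h3, by omega, by omega,
    fun r hr hr' => h4 r (by omega) hr', len⟩

theorem no_bad {α β s t : ℤ} (hα : c α ∈ A) (hβ : c β ∈ A) (h1 : α < s) (h2 : s < β) (h3 : β < t)
    (h4 : t < α + m) (hs : ∀ r, α < r → r ≤ s → c r ∉ A) (ht : ∀ r, β < r → r ≤ t → c r ∉ A)
    (hadj : G.Adj (c s) (c t)) : G.Adj (c (α + 1)) (c (s + 1)) := by
  by_contra hbad
  have htwo := F.two
  rcases Nat.lt_or_ge 2 A.card with hA | hA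
  · refine F.false_of_len hα fun r hr hr' hrA => ?_
    have h5 := F.card_index hα
    have h6 : 1 < ((Finset.Ioo α (α + m)).filter fun t => c t ∈ A).card := by omega
    obtain ⟨b, hb, hbr⟩ := Finset.exists_mem_ne h6 r
    rw [Finset.mem_filter, Finset.mem_Ioo] at hb
    obtain ⟨⟨b1, b2⟩, b3⟩ := hb
    have hsb : ∀ r, α < r → c r ∈ A → s < r := fun r hr hrA => by
      by_contra h
      exact hs r hr (by omega) hrA
    have b4 := hsb b b1 b3
    have r4 := hsb r hr hrA
    obtain ⟨T1, T2⟩ := F.bad_tight hα b3 b2 h1 b4 hs hbad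
    rcases lt_or_gt_of_ne hbr with h | h
    · exact F.size_two b3 (F.memA_add hα) (by omega) T2 hrA h hr' (by omega)
    · exact F.size_two hα b3 b2 T1 hrA hr h (by omega)
  · have hA2 : A.card = 2 := by omega
    have hm := F.three
    by_cases hs1 : c (s + 1) ∈ A
    · have e := F.index_eq hA2 hα hβ (by omega) (by omega) (by omega) (by omega) hs1
      have ht1 : t ≠ β + 1 := by
        rintro rfl
        exact F.r3 hα hβ (by omega) h1 h2 hs hadj.symm (by rw [e]; exact (F.adj β).symm)
      have hαm := F.memA_add hα
      have hγ : ∀ r, β < r → r < α + m → c r ∉ A := fun r hr hr' hrA => by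
        have := F.index_eq hA2 hα hβ (by omega) (by omega) (by omega) hr' hrA
        omega
      have h6 := F.mirror.size_two_of_card_two (α := -(α + m)) (β := -β) (t := -t) (z := -s) hA2
        (by rw [neg_neg]; exact hαm) (by rw [neg_neg]; exact hβ) (by omega) (by omega)
        (fun r hr hr' => hγ _ (by omega) (by omega)) (hγ _ (by omega) (by omega)) (by omega)
        (by omega) (fun r hr hr' => hs _ (by omega) (by omega))
        (by rw [neg_neg, neg_neg]; exact hadj.symm) (by
          have S := F.toFr.mirror.basic (α := -(α + m)) (β := -β) (by rw [neg_neg]; exact hαm)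
            (by rw [neg_neg]; exact hβ) (by omega) (by omega)
          refine S.excl F.toFr.mirror (infix_ivl (fun t => c (-t)) (by omega) (by omega)) ?_
          rw [neg_neg, show -(-β + 1) = s by omega]
          exact hadj)
      rw [show -(-β + 3) = β - 3 by ring] at h6
      have h7 := F.lt3 hα hβ (by omega)
      have h8 : β - 3 = α := by
        by_contra h8
        have := F.index_eq hA2 hα hβ (by omega) (by omega) (by omega) (by omega) h6
        omega
      refine F.false_of_len hβ fun r hr hr' hrA => ?_
      have : r = α + m := by
        by_contra hne
        have e1 := F.index_eq hA2 hβ hαm (by omega) (by omega) hr hr' hrA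
        omega
      rw [this, F.per_add, show α + 3 = β by omega]
      exact hβ
    · have h6 := F.size_two_of_card_two hA2 hα hβ h1 h2 hs hs1 h3 h4 ht hadj hbad
      refine F.false_of_len hα fun r hr hr' hrA => ?_
      rwa [F.index_eq hA2 hα hβ (by omega) (by omega) hr hr' hrA]

theorem false : False := by
  obtain ⟨α, β, s, t, k1, k2, k3, k4, k5, k6, k7, k8, k9⟩ := F.crossing
    (fun v hv => ((F.memA v).1 hv).1) subset_rfl (fun t ht => F.no_two ht)
  refine F.split k5 k6 k1 k2 k3 k4 (F.no_bad k5 k6 k1 k2 k3 k4 k7 k8 k9) ?_ k9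
  refine F.no_bad (β := α + m) (t := s + m) k6 (F.memA_add k5) k3 k4 (by omega) (by omega) k8 ?_
    (by rw [F.per]; exact k9.symm)
  intro r hr hr'
  rw [← F.per_sub r]
  exact k7 _ (by omega) (by omega)

end Rg

/-- The first vertex of the segment after `c α` can be omitted. -/
structure Ug [Fintype V] (G : SimpleGraph V) (m : ℕ) (c : ℤ → V) (H A : Finset V) (α : ℤ) : Prop
    extends Mn G m c H A where
  hα : c α ∈ A
  hom : Om G m c (c (α + 1))

theorem Mn.om_adj [Fintype V] {G : SimpleGraph V} {m : ℕ} {c : ℤ → V} {H A : Finset V}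
    (F : Mn G m c H A) {s t : ℤ} (hs : c s ∉ A) (ht : c t ∉ A) (hst : c s ≠ c t)
    (os : Om G m c (c s)) (ot : Om G m c (c t)) : G.Adj (c s) (c t) := by
  by_contra h
  have h1 := F.ki _ _ hs ht hst h
  have h2 := F.om1 _ hs os
  have h3 := F.om1 _ ht ot
  omega

namespace Ug
variable [Fintype V] {G : SimpleGraph V} {m : ℕ} {c : ℤ → V} {H A : Finset V} {α : ℤ}
  (F : Ug G m c H A α)
include F

theorem one_notMem : c (α + 1) ∉ A := F.no_two F.hα

theorem deg_le : deg G (c (α + 1)) ≤ A.card := (F.om1 _ F.one_notMem F.hom).2.2.2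

theorem le_m : 3 * A.card ≤ m := (F.om1 _ F.one_notMem F.hom).2.2.1

theorem noU {t : ℤ} (ht : c t ∈ A) (h : c t ≠ c α) : ¬ Om G m c (c (t + 1)) := by
  intro ho
  obtain ⟨s, h1, h2, h3⟩ := F.rep α t
  rw [← F.same h3 1] at ho
  rw [← h3] at ht h
  have h4 : s ≠ α + m := fun h4 => h (by rw [h4, F.per])
  exact F.uu F.hα ht h1 (by omega) (F.om_adj F.one_notMem (F.no_two ht)
    (F.ne_of (by omega) (by omega)) F.hom ho)

theorem eq_of_om {t : ℤ} (ht : c t ∈ A) (h : Om G m c (c (t + 1))) : c t = c α := by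
  by_contra h1
  exact F.noU ht h1 h

theorem two_notMem {t : ℤ} (ht : c t ∈ A) (h : c t ≠ c α) : c (t + 2) ∉ A := fun h1 =>
  F.noU ht h (F.om_single ht h1)

theorem ww {s t : ℤ} (hs : c s ∈ A) (ht : c t ∈ A) (h : s < t) (h' : t < s + m) :
    ¬ G.Adj (c (s - 1)) (c (t - 1)) := by
  have := F.toFr.mirror.uu (α := -t) (β := -s) (by rwa [neg_neg]) (by rwa [neg_neg])
    (by omega) (by omega)
  rw [show -(-t + 1) = t - 1 by ring, show -(-s + 1) = s - 1 by ring] at this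
  exact fun h => this h.symm

theorem two_notMem_left {t : ℤ} (ht : c t ∈ A) : c (t - 1) ∉ A := by
  have := F.toFr.mirror.no_two (α := -t) (by rwa [neg_neg])
  rwa [show -(-t + 1) = t - 1 by ring] at this

/-- With two segments, the vertices outside `A` which are not adjacent to the omitted vertex have
at most one more nonneighbour. -/
theorem few {r p q : ℤ} (hA : A.card = 2) (hr : c r ∉ A) (h1 : c r ≠ c (α + 1))
    (h2 : ¬ G.Adj (c (α + 1)) (c r)) (hp : ¬ G.Adj (c r) (c p)) (hq : ¬ G.Adj (c r) (c q))
    (hpr : c p ≠ c r) (hqr : c q ≠ c r) (hp1 : c p ≠ c (α + 1)) (hq1 : c q ≠ c (α + 1)) :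
    c p = c q := by
  by_contra hpq
  have h3 := F.ki _ _ F.one_notMem hr h1.symm h2
  have h4 := F.deg_le
  have h5 := deg_add_le (G := G) (v := c r) (X := (CM m c).toFinset)
    (B := {c r, c (α + 1), c p, c q}) (by
      intro w hw
      rw [Multiset.mem_toFinset, F.mem_CM]
      exact F.nbrC hr w hw) (by
      intro b hb
      rw [Multiset.mem_toFinset, F.mem_CM]
      simp only [Finset.mem_insert, Finset.mem_singleton] at hb
      rcases hb with rfl | rfl | rfl | rfl
      · exact ⟨⟨_, rfl⟩, G.irrefl⟩
      · exact ⟨⟨_, rfl⟩, fun h => h2 h.symm⟩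
      · exact ⟨⟨_, rfl⟩, hp⟩
      · exact ⟨⟨_, rfl⟩, hq⟩)
  rw [Multiset.toFinset_card_of_nodup F.nodup_CM, card_CM, Finset.card_insert_of_notMem,
    Finset.card_insert_of_notMem, Finset.card_pair hpq] at h5
  · omega
  · simp [hp1.symm, hq1.symm]
  · simp [h1, hpr.symm, hqr.symm]

theorem nbr_of_card_two (hA : A.card = 2) {w : V} (h : G.Adj (c (α + 1)) w) :
    w = c α ∨ w = c (α + 2) := by
  by_contra hw
  rw [not_or] at hw
  have h1 := F.deg_le
  have hm := F.three
  have h2 : ({c α, c (α + 2), w} : Finset V).card ≤ deg G (c (α + 1)) := by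
    rw [deg, ← Set.ncard_coe_finset]
    refine Set.ncard_le_ncard ?_ (Set.toFinite _)
    intro v hv
    simp only [Finset.coe_insert, Finset.coe_singleton, Set.mem_insert_iff,
      Set.mem_singleton_iff] at hv
    rcases hv with rfl | rfl | rfl
    · exact (F.adj α).symm
    · have := F.adj (α + 1)
      rwa [add_assoc] at this
    · exact h
  rw [Finset.card_insert_of_notMem, Finset.card_pair (Ne.symm hw.2)] at h2
  · omega
  · have := F.ne_of (s := α) (t := α + 2) (by omega) (by omega)
    simp [this, Ne.symm hw.1]

theorem false_of_card_two (hA : A.card = 2) : False := by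
  have hm := F.le_m
  have hN := fun w => F.nbr_of_card_two hA (w := w)
  obtain ⟨β, hβ⟩ : ((Finset.Ioo α (α + (m : ℤ))).filter fun t => c t ∈ A).Nonempty := by
    have := F.card_index F.hα
    exact Finset.card_pos.1 (by omega)
  simp only [Finset.mem_filter, Finset.mem_Ioo] at hβ
  obtain ⟨⟨h1, h2⟩, hβ⟩ := hβ
  have hα := F.hα
  have idx : ∀ t, α < t → t < α + m → c t ∈ A → t = β := fun t ha hb hc =>
    F.index_eq hA hα hβ h1 h2 ha hb hc
  have hαm := F.memA_add hα
  have hβα : c β ≠ c α := (F.ne_of h1 h2).symm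
  have h3 := F.lt_of_lt hα hβ h1
  have h4 := F.lt_of_lt hβ hαm h2
  have h5 := F.two_notMem hβ hβα
  have hcross : ∃ s t : ℤ, α < s ∧ s < β ∧ β < t ∧ t < α + m ∧ G.Adj (c s) (c t) := by
    obtain ⟨α', β', s, t, k1, k2, k3, k4, k5, k6, k7, k8, k9⟩ := F.crossing
      (fun v hv => ((F.memA v).1 hv).1) subset_rfl (fun t ht => F.no_two ht)
    obtain ⟨s', s1, s2, s3⟩ := F.rep α s
    obtain ⟨t', t1, t2, t3⟩ := F.rep α t
    have e1 : c s' ∉ A := s3 ▸ k7 s k1 le_rfl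
    have e2 : c t' ∉ A := t3 ▸ k8 t k3 le_rfl
    have ne : c α' ≠ c β' := F.ne_of (by omega) (by omega)
    have s4 : s' ≠ α + m := by rintro rfl; exact e1 hαm
    have t4 : t' ≠ α + m := by rintro rfl; exact e2 hαm
    have s5 : s' ≠ β := by rintro rfl; exact e1 hβ
    have t5 : t' ≠ β := by rintro rfl; exact e2 hβ
    have seg : ∀ τ, τ = α ∨ τ = β → ∀ r, τ < r → r < (if τ = α then β else α + m) → c r ∉ A := by
      rintro τ (rfl | rfl) r hr hr' hrA
      · rw [if_pos rfl] at hr'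
        have := idx r hr (by omega) hrA
        omega
      · rw [if_neg (by omega)] at hr'
        have := idx r (by omega) hr' hrA
        omega
    have same : ∀ τ, τ = α ∨ τ = β → τ < s' → τ < t' → s' < (if τ = α then β else α + m) →
        t' < (if τ = α then β else α + m) → False := by
      intro τ hτ a1 a2 a3 a4
      have hτA : c τ ∈ A := by rcases hτ with rfl | rfl <;> assumption
      exact ne ((F.pred_unique s3.symm k1 a1 k5 hτA k7
        (fun r hr hr' => seg τ hτ r hr (by omega))).trans
        (F.pred_unique t3 a2 k3 hτA k6 (fun r hr hr' => seg τ hτ r hr (by omega)) k8))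
    have e := same α (Or.inl rfl)
    have e' := same β (Or.inr rfl)
    rw [if_pos rfl] at e
    rw [if_neg (by omega)] at e'
    rw [← s3, ← t3] at k9
    rcases lt_or_gt_of_ne s5 with a | a <;> rcases lt_or_gt_of_ne t5 with b | b
    · exact (e (by omega) (by omega) a b).elim
    · exact ⟨s', t', by omega, a, b, by omega, k9⟩
    · exact ⟨t', s', by omega, b, a, by omega, k9.symm⟩
    · exact (e' a b (by omega) (by omega)).elim
  obtain ⟨s, t, s1, s2, t1, t2, hst⟩ := hcross
  have hs1 : s ≠ α + 1 := by
    rintro rfl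
    rcases hN _ hst with h | h
    · exact F.ne_of (s := α) (t := t) (by omega) (by omega) h.symm
    · exact F.ne_of (s := α + 2) (t := t) (by omega) (by omega) h.symm
  have hne : ∀ {p q : ℤ}, α ≤ p → p < q → q < α + m → c p ≠ c q := fun ha hb hc =>
    F.ne_of hb (by omega)
  have w1A : c (α + m - 1) ∉ A := F.two_notMem_left hαm
  have vA : c (β + 1) ∉ A := F.no_two hβ
  have far : ∀ r, β < r → r < α + m → ¬ G.Adj (c (α + 1)) (c r) := by
    intro r hr hr' h
    rcases hN _ h with h | h
    · exact hne (p := α) (q := r) le_rfl (by omega) hr' h.symm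
    · exact hne (p := α + 2) (q := r) (by omega) (by omega) hr' h.symm
  have w1w0 : ¬ G.Adj (c (α + m - 1)) (c (β - 1)) := fun h => F.ww hβ hαm h2 (by omega) h.symm
  have w1β : G.Adj (c (α + m - 1)) (c β) := by
    by_contra h
    refine hne (p := β - 1) (q := β) (by omega) (by omega) (by omega)
      (F.few hA w1A ?_ (far _ (by omega) (by omega)) w1w0 h ?_ ?_ ?_ ?_)
    · exact (hne (by omega) (by omega) (by omega)).symm
    · exact hne (by omega) (by omega) (by omega)
    · exact hne (by omega) (by omega) (by omega)
    · exact (hne (by omega) (by omega) (by omega)).symm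
    · exact (hne (by omega) (by omega) (by omega)).symm
  have full : ((ivl c α (α + m - 1) : List V) : Multiset V) = CM m c := by
    have := F.full (α - 1)
    rwa [show α - 1 + 1 = α by ring, show α - 1 + m = α + m - 1 by ring] at this
  have vw0 : ¬ G.Adj (c (β - 1)) (c (β + 1)) := by
    refine F.sp (LP.iv F.adj (show α ≤ β - 1 by omega)).rev.pt
      ((LP.iv F.adj (show β + 1 ≤ α + m - 1 by omega)).app w1β (LP.single _)).pt hα hβ ?_
    rw [← full, ivl_append c (p := α) (r := β - 1) (q := α + m - 1) (by omega) (by omega),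
      ivl_append c (p := β - 1 + 1) (r := β) (q := α + m - 1) (by omega) (by omega),
      sub_add_cancel, ivl_self]
    simp only [← Multiset.coe_add, Multiset.coe_reverse]
    abel
  have vall : ∀ r, α + 1 < r → r < α + m → r ≠ β - 1 → r ≠ β + 1 → G.Adj (c (β + 1)) (c r) := by
    intro r a1 a2 a3 a4
    by_contra h
    refine a3 (F.inj_of (F.few hA vA ?_ (far _ (by omega) (by omega)) h
      (fun h => vw0 h.symm) ?_ ?_ ?_ ?_) (by omega) (by omega))
    · exact (hne (by omega) (by omega) (by omega)).symm
    · exact fun h => a4 (F.inj_of h (by omega) (by omega))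
    · exact hne (by omega) (by omega) (by omega)
    · exact (hne (by omega) (by omega) (by omega)).symm
    · exact (hne (by omega) (by omega) (by omega)).symm
  have wall : ∀ r, α + 1 < r → r < α + m - 1 → r ≠ β - 1 → G.Adj (c (α + m - 1)) (c r) := by
    intro r a1 a2 a3
    by_contra h
    refine a3 (F.inj_of (F.few hA w1A ?_ (far _ (by omega) (by omega)) h
      w1w0 ?_ ?_ ?_ ?_) (by omega) (by omega))
    · exact (hne (by omega) (by omega) (by omega)).symm
    · exact hne (by omega) (by omega) (by omega)
    · exact hne (by omega) (by omega) (by omega)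
    · exact (hne (by omega) (by omega) (by omega)).symm
    · exact (hne (by omega) (by omega) (by omega)).symm
  have vne : β + 1 ≠ α + m - 1 := fun h => h5 (by rwa [show β + 2 = α + m by omega])
  obtain h6 | rfl | rfl | rfl : α + 5 ≤ β ∨ β = α + 4 ∨ β = α + 3 ∨ β = α + 2 := by omega
  · refine F.sp (LP.iv F.adj (show α ≤ α + 2 by omega)).rev.pt
      ((LP.iv F.adj (show β + 1 ≤ α + m - 1 by omega)).app (wall (α + 3) (by omega) (by omega)
      (by omega)) (LP.iv F.adj (show α + 3 ≤ β by omega))).pt hα hβ ?_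
      (vall (α + 2) (by omega) (by omega) (by omega) (by omega)).symm
    rw [← full, ivl_append c (p := α) (r := α + 2) (q := α + m - 1) (by omega) (by omega),
      ivl_append c (p := α + 2 + 1) (r := β) (q := α + m - 1) (by omega) (by omega),
      show α + 2 + 1 = α + 3 by ring]
    simp only [← Multiset.coe_add, Multiset.coe_reverse]
    abel
  · rw [show α + 4 - 1 = α + 3 by ring] at *
    have w0A : c (α + 3) ∉ A := fun h => by have := idx _ (by omega) (by omega) h; omega
    refine vne (F.inj_of (F.few (r := α + 3) hA w0A ?_ ?_ vw0 (fun h => w1w0 h.symm)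
      ?_ ?_ ?_ ?_) (by omega) (by omega))
    · exact (hne (by omega) (by omega) (by omega)).symm
    · intro h
      rcases hN _ h with h | h
      · exact hne (p := α) (q := α + 3) le_rfl (by omega) (by omega) h.symm
      · exact hne (p := α + 2) (q := α + 3) (by omega) (by omega) (by omega) h.symm
    · exact (hne (by omega) (by omega) (by omega)).symm
    · exact (hne (by omega) (by omega) (by omega)).symm
    · exact (hne (by omega) (by omega) (by omega)).symm
    · exact (hne (by omega) (by omega) (by omega)).symm
  · rw [show α + 3 - 1 = α + 2 by ring] at *
    obtain rfl : s = α + 2 := by omega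
    have t3 : t ≠ α + 3 + 1 := by rintro rfl; exact vw0 hst
    have t4 : t ≠ α + m - 1 := by rintro rfl; exact w1w0 hst.symm
    have hX : LP G (c (α + 2)) (c α) (ivl c α (α + 2)).reverse := (LP.iv F.adj (by omega)).rev
    refine F.sp hX.pt ((LP.iv F.adj (show t ≤ α + m - 1 by omega)).app
      (wall (t - 1) (by omega) (by omega) (by omega))
      (LP.iv F.adj (show α + 3 ≤ t - 1 by omega)).rev).pt hα hβ ?_ hst
    rw [← full, ivl_append c (p := α) (r := α + 2) (q := α + m - 1) (by omega) (by omega),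
      ivl_append c (p := α + 2 + 1) (r := t - 1) (q := α + m - 1) (by omega) (by omega),
      show α + 2 + 1 = α + 3 by ring, sub_add_cancel]
    simp only [← Multiset.coe_add, Multiset.coe_reverse]
    abel
  · omega

end Ug

/-- The positions with both neighbours on the cycle outside `A`. -/
def Ex (c : ℤ → V) (A : Finset V) (t : ℤ) : Prop := c t ∉ A ∧ c (t - 1) ∉ A ∧ c (t + 1) ∉ A

namespace Ug
variable [Fintype V] {G : SimpleGraph V} {m : ℕ} {c : ℤ → V} {H A : Finset V} {α : ℤ}
  (F : Ug G m c H A α)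
include F

theorem exists_index {i j : ℤ} (hi : c i ∈ A) (hj : c j ∈ A) (h : i < j) (h' : j < i + m)
    (hiα : c i ≠ c α) (hjα : c j ≠ c α) :
    ∃ Λ : Finset ℤ, (∀ t ∈ Λ, i < t ∧ t < i + m ∧ t ≠ j ∧ c t ∈ A ∧ ¬ Om G m c (c (t + 1))) ∧
      (∀ t ∈ Λ, c t ≠ c α) ∧ Λ.card + 3 = A.card := by
  obtain ⟨τ, h1, h2, h3⟩ := F.rep i α
  have hτm : τ ≠ i + m := by
    rintro rfl
    exact hiα (by rw [← h3, F.per])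
  have hτj : τ ≠ j := by
    rintro rfl
    exact hjα h3
  have key : ∀ t, i < t → t < i + m → t ≠ τ → c t ≠ c α := fun t ha hb hc h =>
    hc (F.inj_of (h.trans h3.symm) (by omega) (by omega))
  refine ⟨(((Finset.Ioo i (i + m)).filter fun t => c t ∈ A).erase j).erase τ, ?_, ?_, ?_⟩
  · intro t ht
    simp only [Finset.mem_erase, Finset.mem_filter, Finset.mem_Ioo] at ht
    obtain ⟨a, b, ⟨c, d⟩, e⟩ := ht
    exact ⟨c, d, b, e, F.noU e (key t c d a)⟩
  · intro t ht
    simp only [Finset.mem_erase, Finset.mem_filter, Finset.mem_Ioo] at ht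
    obtain ⟨a, b, ⟨c, d⟩, e⟩ := ht
    exact key t c d a
  · have hτA : c τ ∈ A := h3 ▸ F.hα
    have a1 := Finset.card_erase_add_one
      (show j ∈ (Finset.Ioo i (i + (m : ℤ))).filter fun t => c t ∈ A by simp [h, h', hj])
    have a2 := Finset.card_erase_add_one
      (show τ ∈ ((Finset.Ioo i (i + (m : ℤ))).filter fun t => c t ∈ A).erase j by
        simp only [Finset.mem_erase, Finset.mem_filter, Finset.mem_Ioo]
        exact ⟨hτj, ⟨h1, by omega⟩, hτA⟩)
    have a3 := F.card_index hi
    omega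

theorem exists_index_zero {j : ℤ} (hj : c j ∈ A) (h : α < j) (h' : j < α + m) :
    ∃ Λ : Finset ℤ, (∀ t ∈ Λ, α < t ∧ t < α + m ∧ t ≠ j ∧ c t ∈ A ∧ ¬ Om G m c (c (t + 1))) ∧
      Λ.card + 2 = A.card := by
  refine ⟨((Finset.Ioo α (α + m)).filter fun t => c t ∈ A).erase j, ?_, ?_⟩
  · intro t ht
    simp only [Finset.mem_erase, Finset.mem_filter, Finset.mem_Ioo] at ht
    exact ⟨ht.2.1.1, ht.2.1.2, ht.1, ht.2.2,
      F.noU ht.2.2 (F.ne_of ht.2.1.1 ht.2.1.2).symm⟩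
  · have a1 := Finset.card_erase_add_one
      (show j ∈ (Finset.Ioo α (α + (m : ℤ))).filter fun t => c t ∈ A by simp [h, h', hj])
    have a2 := F.card_index F.hα
    omega

theorem ki_zero {r : ℤ} (hr : c r ∉ A) (h : c r ≠ c (α + 1)) (h' : ¬ G.Adj (c (α + 1)) (c r)) :
    m + 1 ≤ deg G (c (α + 1)) + deg G (c r) + A.card :=
  F.ki _ _ F.one_notMem hr h.symm h'

theorem nadj_zero {j : ℤ} (hj : c j ∈ A) (hjα : c j ≠ c α) :
    c (j + 1) ≠ c (α + 1) ∧ ¬ G.Adj (c (α + 1)) (c (j + 1)) := by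
  obtain ⟨s, h1, h2, h3⟩ := F.rep α j
  rw [← F.same h3 1]
  have h4 : s ≠ α + m := by
    rintro rfl
    exact hjα (by rw [← h3, F.per])
  exact ⟨(F.ne_of (by omega) (by omega)).symm, F.uu F.hα (h3 ▸ hj) h1 (by omega)⟩

theorem num {i j : ℤ} (hi : c i ∈ A) (hj : c j ∈ A) (h : i < j) (h' : j < i + m)
    (hiα : c i ≠ c α) (hjα : c j ≠ c α) (E : Finset ℤ)
    (hE : ∀ t ∈ E, LI G m c i j t ∧ (c (t - 1) ∈ A → c (t - 1) = c α)) :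
    m + E.card ≤ 3 * A.card + 1 := by
  obtain ⟨Λ, h1, h2, h3⟩ := F.exists_index hi hj h h' hiα hjα
  have h4 := F.pair_count hi hj h h' (F.nbrC (F.no_two hi)) (F.nbrC (F.no_two hj)) Λ h1 E
    (fun t ht => ⟨(hE t ht).1, fun h => h2 _ h ((hE t ht).2 (h1 _ h).2.2.2.1)⟩)
  have h5 := F.ki_zero (F.no_two hi) (F.nadj_zero hi hiα).1 (F.nadj_zero hi hiα).2
  have h6 := F.ki_zero (F.no_two hj) (F.nadj_zero hj hjα).1 (F.nadj_zero hj hjα).2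
  have h7 := F.deg_le
  omega

theorem not_lost (hm : m = 3 * A.card + 1) {i j t : ℤ} (hi : c i ∈ A) (hj : c j ∈ A) (h : i < j)
    (h' : j < i + m) (hiα : c i ≠ c α) (hjα : c j ≠ c α)
    (ht : c (t - 1) ∈ A → c (t - 1) = c α) : ¬ LI G m c i j t := by
  intro h1
  have := F.num hi hj h h' hiα hjα {t} (by
    intro s hs
    rw [Finset.mem_singleton] at hs
    subst hs
    exact ⟨h1, ht⟩)
  rw [Finset.card_singleton] at this
  omega

theorem card_ex (E : Finset V) (hE : ∀ v ∈ E, ∃ t, c t = v ∧ Ex c A t) :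
    3 * A.card + E.card ≤ m + 1 := by
  have := F.three_mul_le {c (α + 1)} E (fun t ht ht' => by
    rw [Finset.mem_singleton]
    exact F.same (F.eq_of_om ht (F.om_single ht ht')) 1) hE
  simpa using this

theorem card_ex' (h : c (α + 2) ∉ A) (E : Finset V) (hE : ∀ v ∈ E, ∃ t, c t = v ∧ Ex c A t) :
    3 * A.card + E.card ≤ m := by
  have := F.three_mul_le ∅ E (fun t ht ht' => by
    rw [F.same (F.eq_of_om ht (F.om_single ht ht')) 2] at ht'
    exact (h ht').elim) hE
  simpa using this

theorem ww' {s t : ℤ} (hs : c s ∈ A) (ht : c t ∈ A) (h : c s ≠ c t) :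
    ¬ G.Adj (c (s - 1)) (c (t - 1)) := by
  obtain ⟨r, h1, h2, h3⟩ := F.rep s t
  have h4 : r ≠ s + m := by
    rintro rfl
    exact h (by rw [← h3, F.per])
  have := F.same h3 (-1)
  rw [← sub_eq_add_neg, ← sub_eq_add_neg] at this
  rw [← this]
  exact F.ww hs (h3 ▸ ht) h1 (by omega)

theorem uu' {s t : ℤ} (hs : c s ∈ A) (ht : c t ∈ A) (h : c s ≠ c t) :
    ¬ G.Adj (c (s + 1)) (c (t + 1)) := by
  obtain ⟨r, h1, h2, h3⟩ := F.rep s t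
  have h4 : r ≠ s + m := by
    rintro rfl
    exact h (by rw [← h3, F.per])
  rw [← F.same h3 1]
  exact F.uu hs (h3 ▸ ht) h1 (by omega)

theorem om_of_adj_two {i j : ℤ} (hi : c i ∈ A) (hj : c j ∈ A) (hij : c i ≠ c j)
    (h : G.Adj (c (i + 1)) (c (j + 2))) : c j = c α := by
  obtain ⟨r, h1, h2, h3⟩ := F.rep i j
  have h4 : r ≠ i + m := by
    rintro rfl
    exact hij (by rw [← h3, F.per])
  rw [← F.same h3 2] at h
  by_contra h5
  rw [← h3] at h5 hj
  exact F.r2' hi hj h1 (by omega) (F.noU hj h5) h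

theorem om_of_adj_two_left {i j : ℤ} (hi : c i ∈ A) (hj : c j ∈ A) (hij : c i ≠ c j)
    (h : G.Adj (c (i - 1)) (c (j - 2))) : Om G m c (c (j - 1)) := by
  obtain ⟨r, h1, h2, h3⟩ := F.rep j i
  have h4 : r ≠ j + m := by
    rintro rfl
    exact hij (by rw [← h3, F.per])
  have e := F.same h3 (-1)
  rw [← sub_eq_add_neg, ← sub_eq_add_neg] at e
  rw [← e] at h
  by_contra h5
  have := F.toFr.mirror.r2' (α := -r) (β := -j) (by rw [neg_neg, h3]; exact hi) (by rwa [neg_neg])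
    (by omega) (by omega) (fun ho => h5 (by
      rw [show j - 1 = -(-j + 1) by ring]; exact ho.mirror))
  rw [show -(-r + 1) = r - 1 by ring, show -(-j + 2) = j - 2 by ring] at this
  exact this h

/-- If all segments have two vertices, then no first vertex is adjacent to a last one. -/
theorem first_last {i j : ℤ} (hi : c i ∈ A) (hj : c j ∈ A) (hi' : c (i + 3) ∈ A)
    (hj' : c (j + 3) ∈ A) (hij : c i ≠ c j) (hα2 : c (α + 2) ∉ A) :
    ¬ G.Adj (c (i + 1)) (c (j + 2)) := by
  intro h
  have h1 := F.om_of_adj_two hi hj hij h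
  have h2 := F.om_of_adj_two_left (i := j + 3) (j := i + 3) hj' hi' (fun e => hij (by
    simpa using (F.same e (-3)).symm))
    (by rw [show j + 3 - 1 = j + 2 by ring, show i + 3 - 2 = i + 1 by ring]; exact h.symm)
  rw [show i + 3 - 1 = i + 2 by ring] at h2
  have h3 : c (i + 2) ∉ A := by
    have := F.two_notMem_left hi'
    rwa [show i + 3 - 1 = i + 2 by ring] at this
  have h4 : G.Adj (c (j + 1)) (c (i + 2)) := by
    rw [F.same h1 1]
    refine F.om_adj F.one_notMem h3 (fun e => ?_) F.hom h2
    have e1 := F.same e 1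
    rw [add_assoc, add_assoc] at e1
    exact hα2 (by rw [show α + 2 = α + (1 + 1) by ring, e1]; exact hi')
  have h5 := F.om_of_adj_two hj hi hij.symm h4
  exact hij (h5.trans h1.symm)

end Ug

namespace Ug
variable [Fintype V] {G : SimpleGraph V} {m : ℕ} {c : ℤ → V} {H A : Finset V} {α : ℤ}
  (F : Ug G m c H A α)
include F

theorem ex_of_first (hα2 : c (α + 2) ∈ A) {s t : ℤ} (ht : c t ∉ A) (h : G.Adj (c s) (c t))
    (hs : c (s - 1) ∈ A) (h1 : c s ≠ c (t - 1)) : Ex c A (t - 1) := by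
  refine ⟨fun h2 => ?_, fun h2 => ?_, by rwa [sub_add_cancel]⟩
  · refine F.uu' hs h2 (fun e => ?_) (by rwa [sub_add_cancel, sub_add_cancel])
    have := F.same e 1
    rw [sub_add_cancel, sub_add_cancel] at this
    exact h.ne this
  · have e := F.om_of_adj_two (i := s - 1) (j := t - 1 - 1) hs h2 (fun e => ?_)
      (by rwa [sub_add_cancel, show t - 1 - 1 + 2 = t by ring])
    · have := F.same e 2
      rw [show t - 1 - 1 + 2 = t by ring] at this
      exact ht (this ▸ hα2)
    · have := F.same e 1
      rw [sub_add_cancel, sub_add_cancel] at this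
      exact h1 this

theorem ex_of_last (hα2 : c (α + 2) ∈ A) {s t : ℤ} (ht : c t ∉ A) (h : G.Adj (c s) (c t))
    (hs : c (s + 1) ∈ A) (h1 : c s ≠ c (t + 1)) : Ex c A (t + 1) := by
  have h3 : c (t + 1) ∉ A := fun h2 => by
    refine F.ww' hs h2 (fun e => ?_) (by rwa [add_sub_cancel_right, add_sub_cancel_right])
    have := F.same e (-1)
    rw [add_neg_cancel_right, add_neg_cancel_right] at this
    exact h.ne this
  refine ⟨h3, by rwa [add_sub_cancel_right], fun h2 => ?_⟩
  have e := F.om_of_adj_two_left (i := s + 1) (j := t + 1 + 1) hs h2 (fun e => ?_)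
    (by rwa [add_sub_cancel_right, show t + 1 + 1 - 2 = t by ring])
  · rw [add_sub_cancel_right] at e
    have h4 : c (α + 1) ≠ c (t + 1) := fun e => by
      have := F.same e (-1)
      rw [add_neg_cancel_right, add_neg_cancel_right] at this
      exact ht (this ▸ F.hα)
    refine F.ww' (s := α + 2) hα2 h2 (fun e => h4 ?_) ?_
    · have := F.same e (-1)
      rwa [show α + 2 + -1 = α + 1 by ring, add_neg_cancel_right] at this
    · rw [show α + 2 - 1 = α + 1 by ring, add_sub_cancel_right]
      exact F.om_adj F.one_notMem h3 h4 F.hom e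
  · have := F.same e (-1)
    rw [add_neg_cancel_right, add_neg_cancel_right] at this
    exact h1 this

theorem two_ex (hα2 : c (α + 2) ∈ A) {i j s t : ℤ} (hi : c i ∈ A) (hj : c j ∈ A) (h1 : i < s)
    (h2 : s < j) (h3 : j < t) (h4 : t < i + m) (hs : c s ∉ A) (ht : c t ∉ A)
    (h : G.Adj (c s) (c t)) : 3 * A.card + 1 ≤ m := by
  have hi' := F.memA_add hi
  suffices ∃ p q, i < p ∧ p < q ∧ q < i + m ∧ Ex c A p ∧ Ex c A q by
    obtain ⟨p, q, a1, a2, a3, a4, a5⟩ := this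
    have h5 := F.card_ex {c p, c q} (by
      intro v hv
      simp only [Finset.mem_insert, Finset.mem_singleton] at hv
      rcases hv with rfl | rfl
      exacts [⟨_, rfl, a4⟩, ⟨_, rfl, a5⟩])
    rw [Finset.card_pair (F.ne_of a2 (by omega))] at h5
    omega
  have b1 : c (s - 1) ∈ A → Ex c A (t - 1) := fun hU =>
    F.ex_of_first hα2 ht h hU (F.ne_of (by omega) (by omega))
  have b2 : c (s + 1) ∈ A → Ex c A (t + 1) := fun hW =>
    F.ex_of_last hα2 ht h hW (F.ne_of (by omega) (by omega))
  have b3 : c (t - 1) ∈ A → Ex c A (s - 1) := fun hU =>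
    F.ex_of_first hα2 hs h.symm hU (F.ne_of (by omega) (by omega)).symm
  have b4 : c (t + 1) ∈ A → Ex c A (s + 1) := fun hW =>
    F.ex_of_last hα2 hs h.symm hW (F.ne_of (by omega) (by omega)).symm
  have lo : ∀ {p}, i ≤ p → Ex c A p → i < p := fun {p} hp he =>
    lt_of_le_of_ne hp (fun e => he.1 (e ▸ hi))
  have up : ∀ {p}, p ≤ i + m → Ex c A p → p < i + m := fun {p} hp he =>
    lt_of_le_of_ne hp (fun e => he.1 (e ▸ hi'))
  have mid : ∀ {p}, j ≤ p → Ex c A p → j < p := fun {p} hp he =>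
    lt_of_le_of_ne hp (fun e => he.1 (e ▸ hj))
  have mid' : ∀ {p}, p ≤ j → Ex c A p → p < j := fun {p} hp he =>
    lt_of_le_of_ne hp (fun e => he.1 (e ▸ hj))
  by_cases k1 : c (s - 1) ∈ A
  · have e1 := b1 k1
    have l1 := mid (by omega) e1
    by_cases k4 : c (t + 1) ∈ A
    · have e4 := b4 k4
      have l4 := mid' (by omega) e4
      exact ⟨s + 1, t - 1, by omega, by omega, by omega, e4, e1⟩
    · exact ⟨t - 1, t, by omega, by omega, by omega, e1, ht, e1.1, k4⟩
  · by_cases k2 : c (s + 1) ∈ A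
    · have e2 := b2 k2
      have l2 := up (by omega) e2
      by_cases k3 : c (t - 1) ∈ A
      · have e3 := b3 k3
        have l3 := lo (by omega) e3
        exact ⟨s - 1, t + 1, by omega, by omega, by omega, e3, e2⟩
      · exact ⟨t, t + 1, by omega, by omega, by omega, ⟨ht, k3, e2.1⟩, e2⟩
    · have e : Ex c A s := ⟨hs, k1, k2⟩
      by_cases k3 : c (t - 1) ∈ A
      · have e3 := b3 k3
        have l3 := lo (by omega) e3
        exact ⟨s - 1, s, by omega, by omega, by omega, e3, e⟩
      · by_cases k4 : c (t + 1) ∈ A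
        · have e4 := b4 k4
          have l4 := mid' (by omega) e4
          exact ⟨s, s + 1, by omega, by omega, by omega, e, e4⟩
        · exact ⟨s, t, by omega, by omega, by omega, e, ht, k3, k4⟩

theorem nbr_mem (hm : m ≤ 3 * A.card + 1) (hα2 : c (α + 2) ∈ A) {w : V}
    (h : G.Adj (c (α + 1)) w) : w ∈ A := by
  obtain ⟨t, rfl⟩ := F.nbrC F.one_notMem w h
  by_contra ht
  have h1 := F.ex_of_first hα2 ht h (by rw [add_sub_cancel_right]; exact F.hα) (fun e => by
    have := F.same e 1
    rw [sub_add_cancel, add_assoc] at this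
    exact ht (this ▸ hα2))
  have h2 := F.ex_of_last hα2 ht h (by rwa [add_assoc]) (fun e => by
    have := F.same e (-1)
    rw [add_neg_cancel_right, add_neg_cancel_right] at this
    exact ht (this ▸ F.hα))
  have h3 := F.card_ex {c (t - 1), c t, c (t + 1)} (by
    intro v hv
    simp only [Finset.mem_insert, Finset.mem_singleton] at hv
    rcases hv with rfl | rfl | rfl
    exacts [⟨_, rfl, h1⟩, ⟨_, rfl, ht, h1.1, h2.1⟩, ⟨_, rfl, h2⟩])
  have h4 := F.three
  rw [Finset.card_insert_of_notMem, Finset.card_pair (F.ne_of (by omega) (by omega))] at h3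
  · omega
  · simp only [Finset.mem_insert, Finset.mem_singleton, not_or]
    exact ⟨F.ne_of (by omega) (by omega), F.ne_of (by omega) (by omega)⟩

theorem next_adj (hm : m = 3 * A.card + 1) (hα2 : c (α + 2) ∈ A) {i j t : ℤ} (hi : c i ∈ A)
    (hj : c j ∈ A) (h1 : i < t) (h2 : t < j) (h' : j < i + m) (hiα : c i ≠ c α) (hjα : c j ≠ c α)
    (h3 : ∀ r, i < r → r ≤ t → c r ∉ A) : G.Adj (c (i + 1)) (c (t + 1)) := by
  by_contra hbad
  have hN := fun w => F.nbr_mem hm.le hα2 (w := w)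
  have ht1 : t ≠ i + 1 := by
    rintro rfl
    exact hbad (F.adj _)
  have hut : G.Adj (c (j + 1)) (c t) := by
    by_contra hu
    exact F.not_lost hm hi hj (by omega) h' hiα hjα (t := t)
      (fun h => (h3 _ (by omega) (by omega) h).elim) (Or.inl ⟨h1, h2, hu, hbad⟩)
  have hdeg := F.deg_le
  have hki : ∀ b, c b ∉ A → c b ≠ c (α + 1) → A.card + 2 ≤ deg G (c b) := fun b hb hb' => by
    have := F.ki_zero hb hb' (fun h => hb (hN _ h))
    omega
  have hut' : ¬ G.Adj (c (j + 1)) (c (t + 1)) := by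
    intro hu
    obtain ⟨Λ, a1, a2, a3⟩ := F.exists_index hi hj (by omega) h' hiα hjα
    refine F.r3_aux hi hj h' h1 h2 h3 Λ a1 (fun b b1 b2 b3 b4 => ?_) hut hu
    have d1 := hki (i + 1) (F.no_two hi) (F.nadj_zero hi hiα).1
    have d2 := hki b (b3 b b1 le_rfl) (fun e => by
      have e1 := F.same e (-1)
      rw [add_neg_cancel_right] at e1
      have e2 : c (b + -1) ∈ A := e1 ▸ F.hα
      obtain rfl | e3 : b = j + 1 ∨ j < b + -1 := by omega
      · rw [add_neg_cancel_right] at e1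
        exact hjα e1
      · exact b3 _ e3 (by omega) e2)
    omega
  have htj : t + 1 ≠ j := by
    rintro rfl
    exact hut' (F.adj _).symm
  have ht2 : G.Adj (c (i + 1)) (c (t + 2)) := by
    by_contra hu
    exact F.not_lost hm hi hj (by omega) h' hiα hjα (t := t + 1)
      (fun h => by rw [add_sub_cancel_right] at h; exact (h3 _ h1 le_rfl h).elim)
      (Or.inl ⟨by omega, by omega, hut', by rwa [add_assoc]⟩)
  by_cases hA : c (t + 1) ∈ A
  · exact F.uu hi hA (by omega) (by omega) (by rwa [add_assoc])
  · have ho := (F.basic hi hj (by omega) h').excl_om F.toFr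
      (infix_ivl_three c (r := t) (by omega) (by omega)) hut ht2
    have hne : c (α + 1) ≠ c (t + 1) := fun e => by
      have e1 := F.same e (-1)
      rw [add_neg_cancel_right, add_neg_cancel_right] at e1
      exact h3 t h1 le_rfl (e1 ▸ F.hα)
    exact hA (hN _ (F.om_adj F.one_notMem hA hne F.hom ho))

theorem false_of_two_mem (hm : m ≤ 3 * A.card + 1) (hα2 : c (α + 2) ∈ A) : False := by
  obtain ⟨i, j, s, t, k1, k2, k3, k4, hi, hj, hs, ht, hst⟩ := F.crossing
    (fun v hv => ((F.memA v).1 hv).1) subset_rfl (fun t ht => F.no_two ht)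
  have sA := hs s k1 le_rfl
  have tA := ht t k3 le_rfl
  have hm' : m = 3 * A.card + 1 :=
    le_antisymm hm (F.two_ex hα2 hi hj k1 k2 k3 k4 sA tA hst)
  have key : ∀ {i s t : ℤ}, c i ∈ A → i < s → (∀ r, i < r → r ≤ s → c r ∉ A) → c t ∉ A →
      G.Adj (c s) (c t) → c i ≠ c α := by
    intro i s t hi h1 h2 h3 h4 e
    have : s = i + 1 := by
      by_contra h5
      have e1 := F.same e 2
      exact h2 (i + 2) (by omega) (by omega) (e1 ▸ hα2)
    rw [this, F.same e 1] at h4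
    exact h3 (F.nbr_mem hm hα2 h4)
  have hiα := key hi k1 hs tA hst
  have hjα := key hj k3 ht sA hst.symm
  refine F.split hi hj k1 k2 k3 k4 (F.next_adj hm' hα2 hi hj k1 k2 (by omega) hiα hjα hs) ?_ hst
  exact F.next_adj hm' hα2 hj (F.memA_add hi) k3 k4 (by omega) hjα (by rwa [F.per]) ht

theorem false_of_three_mul (hm : m = 3 * A.card) (hα2 : c (α + 2) ∉ A) : False := by
  obtain ⟨i, j, s, t, k1, k2, k3, k4, hi, hj, hs, ht, hst⟩ := F.crossing
    (fun v hv => ((F.memA v).1 hv).1) subset_rfl (fun t ht => F.no_two ht)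
  have two : ∀ {i}, c i ∈ A → c (i + 2) ∉ A := fun {i} hi h => by
    rw [F.same (F.eq_of_om hi (F.om_single hi h)) 2] at h
    exact hα2 h
  have three : ∀ {i}, c i ∈ A → c (i + 3) ∈ A := fun {i} hi => by
    by_contra h
    have := F.card_ex' hα2 {c (i + 2)} (by
      intro v hv
      rw [Finset.mem_singleton] at hv
      refine ⟨_, hv.symm, two hi, ?_, by rwa [add_assoc]⟩
      rw [show i + 2 - 1 = i + 1 by ring]
      exact F.no_two hi)
    rw [Finset.card_singleton] at this
    omega
  have pos : ∀ {i s}, c i ∈ A → i < s → (∀ r, i < r → r ≤ s → c r ∉ A) →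
      s = i + 1 ∨ s = i + 2 := by
    intro i s hi h h'
    by_contra h1
    exact h' (i + 3) (by omega) (by omega) (three hi)
  have hij : c i ≠ c j := F.ne_of (by omega) (by omega)
  rcases pos hi k1 hs with rfl | rfl <;> rcases pos hj k3 ht with rfl | rfl
  · exact F.uu' hi hj hij hst
  · exact F.first_last hi hj (three hi) (three hj) hij hα2 hst
  · exact F.first_last hj hi (three hj) (three hi) hij.symm hα2 hst.symm
  · refine F.ww' (three hi) (three hj) (fun e => hij ?_) ?_
    · simpa using F.same e (-3)
    · rwa [show i + 3 - 1 = i + 2 by ring, show j + 3 - 1 = j + 2 by ring]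

end Ug

namespace Ug
variable [Fintype V] {G : SimpleGraph V} {m : ℕ} {c : ℤ → V} {H A : Finset V} {α : ℤ}
  (F : Ug G m c H A α)
include F

theorem pair_adj (hm : m = 3 * A.card + 1) (hα2 : c (α + 2) ∉ A) {i j : ℤ} (hi : c i ∈ A)
    (hj : c j ∈ A) (h1 : α < i) (h2 : i < j) (h3 : j < α + m) :
    (G.Adj (c (i + 1)) (c (α + 2)) ∧ ¬ G.Adj (c (i + 1)) (c (α + 3))) ∧
      G.Adj (c (j + 1)) (c (α + 2)) ∧ ¬ G.Adj (c (j + 1)) (c (α + 3)) := by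
  have hiα : c i ≠ c α := (F.ne_of h1 (by omega)).symm
  have hjα : c j ≠ c α := (F.ne_of (by omega) h3).symm
  have lost := fun t (ht : c (t - 1) ∈ A → c (t - 1) = c α) =>
    F.not_lost hm hi hj h2 (by omega) hiα hjα ht
  have r3 : ∀ j, c j ∈ A → α < j → j < α + m → G.Adj (c (j + 1)) (c (α + 2)) →
      ¬ G.Adj (c (j + 1)) (c (α + 3)) := by
    intro j hj h1 h2 hu hu'
    obtain ⟨Λ, a1, a2⟩ := F.exists_index_zero hj h1 h2
    have h4 := F.lt_of_lt F.hα hj h1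
    have h5 : α + 2 ≠ j := fun e => hα2 (e ▸ hj)
    refine F.r3_aux F.hα hj h2 (t := α + 2) (by omega) (by omega) (fun r b1 b2 => ?_) Λ a1
      (fun b b1 b2 b3 b4 => ?_) hu (by rwa [add_assoc])
    · obtain rfl | rfl : r = α + 1 ∨ r = α + 2 := by omega
      exacts [F.one_notMem, hα2]
    · have := F.ki_zero (b3 b b1 le_rfl) (F.ne_of (by omega) (by omega)).symm b4
      omega
  have hu0 : ∀ l, c l ∈ A → c l ≠ c α → ¬ G.Adj (c (l + 1)) (c (α + 1)) := fun l hl hlα h =>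
    (F.nadj_zero hl hlα).2 h.symm
  have hj2 : G.Adj (c (j + 1)) (c (α + 2)) := by
    by_contra h
    have h4 := F.lt_of_lt F.hα hi h1
    refine lost (α + m + 1) (fun _ => by rw [add_sub_cancel_right, F.per])
      (Or.inr ⟨by omega, by omega, ?_, ?_⟩)
    · rw [add_right_comm, F.per, F.per_add]
      exact hu0 i hi hiα
    · rwa [add_assoc, F.per_add]
  have hj3 := r3 j hj (by omega) h3 hj2
  have hi2 : G.Adj (c (i + 1)) (c (α + 2)) := by
    by_contra h
    have h4 := F.lt_of_lt F.hα hi h1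
    have h5 : α + 2 ≠ i := fun e => hα2 (e ▸ hi)
    refine lost (α + m + 2) (fun h => ?_) (Or.inr ⟨by omega, by omega, ?_, ?_⟩)
    · rw [show α + m + 2 - 1 = α + m + 1 by ring, F.per_add] at h
      exact (F.one_notMem h).elim
    · rwa [add_right_comm, F.per, F.per_add]
    · rwa [add_assoc, F.per_add]
  exact ⟨⟨hi2, r3 i hi h1 (by omega) hi2⟩, hj2, hj3⟩

theorem false_of_two_notMem (hA : 3 ≤ A.card) (hm : m = 3 * A.card + 1) (hα2 : c (α + 2) ∉ A) :
    False := by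
  have hα := F.hα
  have hcard := F.card_index hα
  have all : ∀ j, c j ∈ A → α < j → j < α + m →
      G.Adj (c (j + 1)) (c (α + 2)) ∧ ¬ G.Adj (c (j + 1)) (c (α + 3)) := by
    intro j hj h1 h2
    obtain ⟨i, hi, hij⟩ := Finset.exists_mem_ne (by omega :
      1 < ((Finset.Ioo α (α + (m : ℤ))).filter fun t => c t ∈ A).card) j
    rw [Finset.mem_filter, Finset.mem_Ioo] at hi
    rcases lt_or_gt_of_ne hij with h | h
    · exact (F.pair_adj hm hα2 hi.2 hj hi.1.1 h h2).2
    · exact (F.pair_adj hm hα2 hj hi.2 h1 h hi.1.2).1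
  have hα3 : c (α + 3) ∉ A := fun h =>
    (all _ h (by omega) (by omega)).2 (F.adj (α + 3)).symm
  have hα4 : c (α + 4) ∈ A := by
    by_contra h
    have := F.card_ex' hα2 {c (α + 2), c (α + 3)} (by
      intro v hv
      simp only [Finset.mem_insert, Finset.mem_singleton] at hv
      rcases hv with rfl | rfl
      · refine ⟨_, rfl, hα2, ?_, by rwa [add_assoc]⟩
        rw [show α + 2 - 1 = α + 1 by ring]
        exact F.one_notMem
      · refine ⟨_, rfl, hα3, ?_, by rwa [add_assoc]⟩
        rwa [show α + 3 - 1 = α + 2 by ring])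
    rw [Finset.card_pair (F.ne_of (by omega) (by omega))] at this
    omega
  obtain ⟨j, hj, hj4⟩ := Finset.exists_mem_ne (by omega :
    1 < ((Finset.Ioo α (α + (m : ℤ))).filter fun t => c t ∈ A).card) (α + 4)
  simp only [Finset.mem_filter, Finset.mem_Ioo] at hj
  obtain ⟨⟨j1, j2⟩, hj⟩ := hj
  have j3 : α + 4 < j := by
    have := F.one_notMem
    by_contra h
    obtain rfl | rfl | rfl : j = α + 1 ∨ j = α + 2 ∨ j = α + 3 := by omega
    all_goals contradiction
  have a1 := (all _ hα4 (by omega) (by omega)).1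
  rw [add_assoc, show (4 : ℤ) + 1 = 5 by norm_num] at a1
  have a2 : G.Adj (c (j + 1)) (c (α + 4)) := by
    by_contra h
    refine F.not_lost hm hα4 hj j3 (by omega) (F.ne_of (by omega) (by omega)).symm
      (F.ne_of (by omega) (by omega)).symm (t := α + m + 3) (fun h => ?_)
      (Or.inr ⟨by omega, by omega, ?_, ?_⟩)
    · rw [show α + m + 3 - 1 = α + m + 2 by ring, F.per_add] at h
      exact (hα2 h).elim
    · have := (all _ hα4 (by omega) (by omega)).2
      rwa [show α + 4 + m + 1 = α + m + (4 + 1) by ring, F.per_add, F.per_add, ← add_assoc]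
    · rwa [add_assoc, F.per_add]
  have e23 : G.Adj (c (α + 3)) (c (α + 4)) := by
    have := F.adj (α + 3)
    rwa [add_assoc] at this
  have e12 : G.Adj (c (α + 1)) (c (α + 2)) := by
    have := F.adj (α + 1)
    rwa [add_assoc] at this
  have ho : Om G m c (c (α + 3)) := by
    have hY : LP G (c (j + 1)) (c j) (ivl c (j + 1) (α + m + 2) ++ ivl c (α + 5) j) :=
      (LP.iv F.adj (by omega)).app (by rw [F.per_add]; exact a1.symm) (LP.iv F.adj (by omega))
    refine F.om (LP.single (c (α + 4))).pt hY.pt hα4 hj ?_ a2.symm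
    rw [← F.full (α + 2), ivl_cons c (p := α + 2 + 1) (by omega),
      show α + 2 + 1 = α + 3 by ring, show α + 3 + 1 = α + 4 by ring,
      ivl_cons c (p := α + 4) (by omega), show α + 4 + 1 = α + 5 by ring,
      show α + 2 + m = α + m + 2 by ring, ivl_append c (p := α + 5) (r := j) (q := α + m + 2)
        (by omega) (by omega)]
    simp only [← Multiset.cons_coe, Multiset.coe_nil, ← Multiset.singleton_add,
      ← Multiset.coe_add]
    abel
  have e13 : G.Adj (c (α + 1)) (c (α + 3)) :=
    F.om_adj F.one_notMem hα3 (F.ne_of (by omega) (by omega)) F.hom ho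
  have hY : LP G (c (α + 2)) (c (α + 4)) [c (α + 2), c (α + 1), c (α + 3), c (α + 4)] :=
    (LP.single _).app e12.symm ((LP.single _).app e13 ((LP.single _).app e23 (LP.single _)))
  refine F.sp (LP.iv F.adj (show α + 5 ≤ α + m by omega)).pt hY.pt (F.memA_add hα) hα4 ?_ a1
  rw [← F.full α, ivl_cons c (p := α + 1) (by omega), show α + 1 + 1 = α + 2 by ring,
    ivl_cons c (p := α + 2) (by omega), show α + 2 + 1 = α + 3 by ring,
    ivl_cons c (p := α + 3) (by omega), show α + 3 + 1 = α + 4 by ring,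
    ivl_cons c (p := α + 4) (by omega), show α + 4 + 1 = α + 5 by ring]
  simp only [← Multiset.cons_coe, Multiset.coe_nil, ← Multiset.singleton_add]
  abel

theorem false : False := by
  have h2 := F.two
  rcases Nat.lt_or_ge 2 A.card with h3 | h3
  · have hcard := F.card_index F.hα
    have h1 : 1 < ((Finset.Ioo α (α + (m : ℤ))).filter fun t => c t ∈ A).card := by omega
    obtain ⟨i, j, hij, hi, hj⟩ : ∃ i j, i < j ∧
        i ∈ (Finset.Ioo α (α + (m : ℤ))).filter (fun t => c t ∈ A) ∧
        j ∈ (Finset.Ioo α (α + (m : ℤ))).filter fun t => c t ∈ A := by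
      obtain ⟨i, hi, j, hj, hij⟩ := Finset.one_lt_card.1 h1
      rcases lt_or_gt_of_ne hij with h | h
      exacts [⟨i, j, h, hi, hj⟩, ⟨j, i, h, hj, hi⟩]
    simp only [Finset.mem_filter, Finset.mem_Ioo] at hi hj
    have h4 := F.num hi.2 hj.2 hij (by omega) (F.ne_of hi.1.1 hi.1.2).symm
      (F.ne_of hj.1.1 hj.1.2).symm ∅ (by simp)
    rw [Finset.card_empty] at h4
    have h5 := F.le_m
    by_cases hα2 : c (α + 2) ∈ A
    · exact F.false_of_two_mem h4 hα2
    · rcases (by omega : m = 3 * A.card ∨ m = 3 * A.card + 1) with h6 | h6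
      · exact F.false_of_three_mul h6 hα2
      · exact F.false_of_two_notMem h3 h6 hα2
  · exact F.false_of_card_two (by omega)

end Ug

theorem Mn.false [Fintype V] {G : SimpleGraph V} {m : ℕ} {c : ℤ → V} {H A : Finset V}
    (F : Mn G m c H A) : False := by
  by_cases hU : ∃ t, c t ∈ A ∧ Om G m c (c (t + 1))
  · obtain ⟨t, h1, h2⟩ := hU
    exact Ug.false ⟨F, h1, h2⟩
  · by_cases hW : ∃ t, c t ∈ A ∧ Om G m c (c (t - 1))
    · obtain ⟨t, h1, h2⟩ := hW
      refine Ug.false (α := -t) ⟨F.mirror, by rwa [neg_neg], ?_⟩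
      have := F.toFr.mirror
      refine Om.mirror (c := fun t => c (-t)) ?_
      simpa only [neg_neg, show -(-t + 1) = t - 1 by ring] using h2
    · push Not at hU hW
      exact Rg.false ⟨F, hU, hW⟩

theorem lp_support {G : SimpleGraph V} {u v : V} (p : G.Walk u v) : LP G u v p.support := by
  refine ⟨p.isChain_adj_support, ?_, ?_⟩
  · rw [List.head?_eq_some_head p.support_ne_nil, p.head_support]
  · rw [List.getLast?_eq_some_getLast p.support_ne_nil, p.getLast_support]

theorem LP.exists_walk {G : SimpleGraph V} {u v : V} {l : List V} (h : LP G u v l) :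
    ∃ p : G.Walk u v, p.support = l := by
  obtain ⟨h1, h2, h3⟩ := h
  have hne : l ≠ [] := by rintro rfl; simp at h2
  rw [List.head?_eq_some_head hne, Option.some.injEq] at h2
  rw [List.getLast?_eq_some_getLast hne, Option.some.injEq] at h3
  exact ⟨(SimpleGraph.Walk.ofSupport l hne h1).copy h2 h3, by simp⟩

theorem Cl.of_walk {G : SimpleGraph V} {b : V} {w : G.Walk b b} (h : w.IsCycle) :
    ∃ M, Cl G M ∧ M.card = w.length ∧ ∀ v, v ∈ M ↔ v ∈ w.support := by
  have h3 := h.three_le_length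
  have hn := h.support_nodup
  cases w with
  | nil => simp at h3
  | cons a p =>
    simp only [SimpleGraph.Walk.support_cons, List.tail_cons] at hn
    refine ⟨p.support, ⟨hn, ?_, _, _, (lp_support p).pt, a⟩, by simp, fun v => ?_⟩
    · simpa using h3
    · simp only [Multiset.mem_coe, SimpleGraph.Walk.support_cons, List.mem_cons]
      refine ⟨Or.inr, ?_⟩
      rintro (rfl | h)
      · exact p.end_mem_support
      · exact h

theorem Cl.exists_walk {G : SimpleGraph V} {M : Multiset V} (h : Cl G M) :
    ∃ (b : V) (w : G.Walk b b), w.IsCycle ∧ w.length = M.card ∧ ∀ v, v ∈ w.support ↔ v ∈ M := by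
  obtain ⟨h1, h2, u, v, ⟨l, hl, rfl⟩, a⟩ := h
  obtain ⟨p, rfl⟩ := hl.exists_walk
  have hp : p.IsPath := (SimpleGraph.Walk.isPath_def p).2 (by simpa using h1)
  simp only [Multiset.coe_card, SimpleGraph.Walk.length_support] at h2
  refine ⟨v, .cons a p, ?_, by simp, fun w => ?_⟩
  · rw [SimpleGraph.Walk.cons_isCycle_iff]
    refine ⟨hp, fun he => ?_⟩
    rw [Sym2.eq_swap] at he
    have := hp.length_eq_one_of_mem_edges he
    omega
  · simp only [Multiset.mem_coe, SimpleGraph.Walk.support_cons, List.mem_cons]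
    refine ⟨?_, Or.inr⟩
    rintro (rfl | h)
    · exact p.end_mem_support
    · exact h

/-- The bi-infinite sequence `c` runs periodically along a cycle of length `m`. -/
structure Cy (G : SimpleGraph V) (m : ℕ) (c : ℤ → V) : Prop where
  per : ∀ t, c (t + m) = c t
  inj : ∀ s t, c s = c t → (m : ℤ) ∣ s - t
  adj : ∀ t, G.Adj (c t) (c (t + 1))

theorem Cl.exists_cy {G : SimpleGraph V} {M : Multiset V} (h : Cl G M) :
    ∃ c : ℤ → V, Cy G M.card c ∧ ∀ v, v ∈ M ↔ ∃ t, c t = v := by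
  obtain ⟨h1, h2, u, v, ⟨l, ⟨hc, hh, ht⟩, rfl⟩, a⟩ := h
  simp only [Multiset.coe_card, Multiset.coe_nodup, Multiset.mem_coe] at h1 h2 ⊢
  have hm (t : ℤ) : (t % l.length).toNat < l.length := by
    have := Int.emod_lt_of_pos t (show (0 : ℤ) < l.length by omega)
    have := Int.emod_nonneg t (show (l.length : ℤ) ≠ 0 by omega)
    omega
  have hcong {i j : ℕ} (hi : i < l.length) (hj : j < l.length) (e : i = j) : l[i] = l[j] := by
    subst e; rfl
  refine ⟨fun t => l[(t % l.length).toNat]'(hm t), ⟨fun t => ?_, fun s t e => ?_, fun t => ?_⟩,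
    fun w => ⟨fun hw => ?_, ?_⟩⟩
  · exact hcong _ _ (by rw [Int.add_emod_right])
  · have e' := (List.Nodup.getElem_inj_iff h1).1 e
    have p1 := Int.emod_nonneg t (show (l.length : ℤ) ≠ 0 by omega)
    have p2 := Int.emod_nonneg s (show (l.length : ℤ) ≠ 0 by omega)
    exact (Int.emod_eq_emod_iff_emod_sub_eq_zero.1 (by omega : s % l.length = t % l.length)) |>
      Int.dvd_of_emod_eq_zero
  · have p1 := Int.emod_nonneg t (show (l.length : ℤ) ≠ 0 by omega)
    have p2 := Int.emod_lt_of_pos t (show (0 : ℤ) < l.length by omega)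
    have p3 := Int.emod_add_mul_ediv t l.length
    set r := t % l.length with hr
    rcases lt_or_ge (r + 1) l.length with h4 | h4
    · have e : (t + 1) % l.length = r + 1 := by
        rw [← Int.emod_eq_of_lt (show 0 ≤ r + 1 by omega) h4, hr, Int.emod_add_emod]
      have := List.isChain_iff_getElem.1 hc r.toNat (by omega)
      convert this using 2
      omega
    · have e : (t + 1) % l.length = 0 := by
        have : t + 1 = l.length * (t / l.length + 1) := by rw [mul_add]; omega
        rw [this, Int.mul_emod_right]
      have hne : l ≠ [] := by rintro rfl; simp at h2
      rw [List.head?_eq_some_head hne, Option.some.injEq] at hh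
      rw [List.getLast?_eq_some_getLast hne, Option.some.injEq] at ht
      have e1 : l[r.toNat]'(hm t) = v := by
        rw [← ht, List.getLast_eq_getElem]
        exact hcong _ _ (by omega)
      have e2 : l[((t + 1) % l.length).toNat]'(hm _) = u := by
        rw [← hh, List.head_eq_getElem]
        exact hcong _ _ (by omega)
      rw [e1, e2]; exact a
  · obtain ⟨i, hi, rfl⟩ := List.getElem_of_mem hw
    refine ⟨i, hcong _ _ ?_⟩
    rw [Int.emod_eq_of_lt (by omega) (by omega)]; simp
  · rintro ⟨t, rfl⟩; exact List.getElem_mem _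

/-- The graph `G` without the edges meeting `S`. -/
def offG (G : SimpleGraph V) (S : Set V) : SimpleGraph V where
  Adj v w := G.Adj v w ∧ v ∉ S ∧ w ∉ S
  symm := ⟨fun _ _ h => ⟨h.1.symm, h.2.2, h.2.1⟩⟩
  loopless := ⟨fun v h => G.loopless.irrefl v h.1⟩

theorem offG.exists_pt {G : SimpleGraph V} {S : Set V} {x y : V} (h : (offG G S).Reachable x y) :
    ∃ M, PT G x y M ∧ M.Nodup ∧ ∀ z ∈ M, (offG G S).Reachable x z := by
  obtain ⟨p, hp⟩ := h.exists_isPath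
  obtain ⟨h1, h2, h3⟩ := lp_support p
  exact ⟨_, ⟨_, ⟨h1.imp fun _ _ h => h.1, h2, h3⟩, rfl⟩,
    by simpa using hp.support_nodup, fun z hz => ⟨p.takeUntil z (by simpa using hz)⟩⟩

theorem offG.not_mem {G : SimpleGraph V} {S : Set V} {x y : V} (h : (offG G S).Reachable x y)
    (hx : x ∉ S) : y ∉ S := by
  obtain ⟨p⟩ := h
  induction p with
  | nil => exact hx
  | cons a _ ih => exact ih a.2.2

theorem Cy.exists_fr [Fintype V] {G : SimpleGraph V} {m : ℕ} {c : ℤ → V} (C : Cy G m c)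
    (h3 : 3 ≤ m) (hmx : ∀ M, Cl G M → M.card ≤ m) {x : V} (hx : ∀ t, c t ≠ x) :
    ∃ H A, (∀ y, y ∈ H ↔ (offG G (Set.range c)).Reachable x y) ∧ Fr G m c H A := by
  set S : Set V := Set.range c
  have hxS : x ∉ S := by rintro ⟨t, ht⟩; exact hx t ht
  refine ⟨Finset.univ.filter fun y => (offG G S).Reachable x y,
    Finset.univ.filter fun v => (∃ t, c t = v) ∧ ∃ y, (offG G S).Reachable x y ∧ G.Adj v y,
    by simp, ⟨h3, C.per, C.inj, C.adj, hmx, fun t ht => ?_, fun v => by simp,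
      fun y hy z hz => ?_, fun y hy z hz => ?_⟩⟩
  · simp only [Finset.mem_filter, Finset.mem_univ, true_and] at ht
    exact offG.not_mem ht hxS ⟨t, rfl⟩
  · simp only [Finset.mem_filter, Finset.mem_univ, true_and] at hy hz ⊢
    obtain ⟨M, h1, h2, h3⟩ := offG.exists_pt (hy.symm.trans hz)
    exact ⟨M, h1, h2, fun w hw => hy.trans (h3 w hw)⟩
  · simp only [Finset.mem_filter, Finset.mem_univ, true_and] at hy ⊢
    by_cases hzS : z ∈ S
    · exact Or.inr hzS
    · exact Or.inl (hy.trans (SimpleGraph.Adj.reachable ⟨hz, offG.not_mem hy hxS, hzS⟩))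

theorem OneTough.exists_cl [Fintype V] {G : SimpleGraph V} (h : OneTough G)
    (hn : 3 ≤ Fintype.card V) : ∃ M, Cl G M := by
  have two (x : V) : ∃ y z, y ≠ z ∧ G.Adj x y ∧ G.Adj x z := by
    by_contra! hcon
    obtain ⟨y, hyx, hy⟩ : ∃ y, y ≠ x ∧ ∀ z, G.Adj x z → z = y := by
      by_cases he : ∃ y, G.Adj x y
      · obtain ⟨y, hy⟩ := he
        exact ⟨y, hy.ne', fun z hz => by_contra fun hne => hcon z y hne hz hy⟩
      · push Not at he
        have : Nontrivial V := Fintype.one_lt_card_iff_nontrivial.1 (by omega)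
        obtain ⟨y, hy⟩ := exists_ne x
        exact ⟨y, hy, fun z hz => absurd hz (he z)⟩
    obtain ⟨z, hz⟩ : ∃ z, z ∉ ({x, y} : Finset V) := by
      by_contra! hall
      have := Finset.card_le_card (fun v _ => hall v : (Finset.univ : Finset V) ⊆ {x, y})
      have := Finset.card_le_two (a := x) (b := y)
      rw [Finset.card_univ] at *
      omega
    simp only [Finset.mem_insert, Finset.mem_singleton, not_or] at hz
    have := h.card_image_le (T := {y}) (by simp) (fun v => v = x) (fun v w hv hw a => by
      simp only [Finset.mem_singleton] at hv hw
      refine propext ⟨?_, ?_⟩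
      · rintro rfl; exact absurd (hy w a) hw
      · rintro rfl; exact absurd (hy v a.symm) hv) {True, False} (fun b hb => by
      simp only [Finset.mem_insert, Finset.mem_singleton] at hb
      rcases hb with rfl | rfl
      · exact ⟨x, by simpa using hyx.symm, by simp⟩
      · exact ⟨z, by simpa using hz.2, by simpa using hz.1⟩)
    rw [Finset.card_pair (by simp)] at this
    simp at this
  obtain ⟨x⟩ : Nonempty V := Fintype.card_pos_iff.1 (by omega)
  obtain ⟨y, z, hyz, hy, hz⟩ := two x
  have hr : (offG G {x}).Reachable y z := by
    by_contra hr
    have := h.card_image_le (T := {x}) (by simp) (fun v => (offG G {x}).Reachable y v)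
      (fun v w hv hw a => by
        have a' : (offG G {x}).Reachable v w :=
          SimpleGraph.Adj.reachable ⟨a, by simpa using hv, by simpa using hw⟩
        exact propext ⟨fun h => h.trans a', fun h => h.trans a'.symm⟩) {True, False} (fun b hb => by
      simp only [Finset.mem_insert, Finset.mem_singleton] at hb
      rcases hb with rfl | rfl
      · exact ⟨y, by simpa using hy.ne', by simp⟩
      · exact ⟨z, by simpa using hz.ne', by simpa using hr⟩)
    rw [Finset.card_pair (by simp)] at this
    simp at this
  obtain ⟨M, h1, h2, h3⟩ := offG.exists_pt hr
  have hxM : x ∉ M := fun hx => offG.not_mem (h3 x hx) (by simpa using hy.ne') rfl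
  refine ⟨_, ?_, ?_, x, z, (LP.single x).pt.app hy h1, hz.symm⟩
  · simpa using ⟨hxM, h2⟩
  · obtain ⟨l, hl, rfl⟩ := h1
    have e : ({y, z} : Finset V) ⊆ l.toFinset := by
      intro w hw
      simp only [Finset.mem_insert, Finset.mem_singleton] at hw
      rcases hw with rfl | rfl
      · simpa using hl.mem_left
      · simpa using hl.mem_right
    have := Finset.card_le_card e
    rw [Finset.card_pair hyz] at this
    have := l.toFinset_card_le
    simp
    omega

/-- Every longest cycle (of length `m`) misses only vertices of low degree. -/
structure Lo [Fintype V] (G : SimpleGraph V) (m : ℕ) : Prop where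
  tough : OneTough G
  tri : ∀ x y z, x ≠ y → x ≠ z → y ≠ z → ¬ G.Adj x y → ¬ G.Adj x z → ¬ G.Adj y z →
    Fintype.card V ≤ deg G x + deg G y + deg G z
  low : ∀ M, Cl G M → m ≤ M.card → ∀ v ∉ M, 3 * deg G v < Fintype.card V

namespace Fr
variable {G : SimpleGraph V} {m : ℕ} {c : ℤ → V} {H A : Finset V} (F : Fr G m c H A)
include F

theorem nadj {x y : V} (hx : x ∈ H) (hy : y ∉ H) (hyA : y ∉ A) : ¬ G.Adj x y := fun a => by
  rcases F.nbr x hx y a with h | ⟨t, rfl⟩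
  · exact hy h
  · exact hyA ((F.memA _).2 ⟨⟨t, rfl⟩, x, hx, a.symm⟩)

theorem deg_add_one_le [Fintype V] {x : V} (hx : x ∈ H) : deg G x + 1 ≤ A.card + H.card := by
  have h1 := deg_add_le (G := G) (v := x) (X := A ∪ H) (B := {x}) (fun w hw => by
    rw [Finset.mem_union]
    by_contra! h
    exact F.nadj hx h.2 h.1 hw) (fun b hb => by
      rw [Finset.mem_singleton] at hb
      subst hb
      exact ⟨Finset.mem_union_right _ hx, G.loopless.irrefl _⟩)
  have := Finset.card_union_le A H
  rw [Finset.card_singleton] at h1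
  omega

theorem cl : Cl G (CM m c) := by
  have h3 := F.three
  refine ⟨F.nodup_CM, by rw [card_CM m c]; exact h3, _, _,
    (LP.iv F.adj (show (1 : ℤ) ≤ m by omega)).pt, ?_⟩
  have := F.adj m
  rw [← F.per 1]
  convert this using 2
  ring

theorem low [Fintype V] (L : Lo G m) {v : V} (hv : ∀ t, c t ≠ v) : 3 * deg G v < Fintype.card V :=
  L.low _ F.cl (card_CM m c).ge v fun h => by
    obtain ⟨t, ht⟩ := F.mem_CM.1 h
    exact hv t ht

theorem low_of_mem [Fintype V] (L : Lo G m) {x : V} (hx : x ∈ H) :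
    3 * deg G x < Fintype.card V :=
  F.low L fun t ht => F.off t (ht ▸ hx)

theorem two [Fintype V] (ht : OneTough G) (hH : H.Nonempty) : 2 ≤ A.card := by
  by_contra hA
  obtain ⟨τ, hτ⟩ : ∃ τ, ∀ v ∈ A, v = c τ := by
    rcases A.eq_empty_or_nonempty with rfl | ⟨a, ha⟩
    · exact ⟨0, by simp⟩
    · obtain ⟨⟨τ, rfl⟩, -⟩ := (F.memA a).1 ha
      exact ⟨τ, fun v hv => Finset.card_le_one.1 (by omega) _ hv _ ha⟩
  have key {v w : V} (hw : w ∉ ({c τ} : Finset V)) (a : G.Adj v w) (hv : v ∈ H) : w ∈ H := by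
    by_contra hwH
    exact F.nadj hv hwH (fun h => hw (by simpa using hτ w h)) a
  have h3 := F.three
  obtain ⟨x, hx⟩ := hH
  have := ht.card_image_le (T := {c τ}) (by simp) (fun v => v ∈ H) (fun v w hv hw a =>
      propext ⟨key hw a, key hv a.symm⟩) {True, False} (fun b hb => by
    simp only [Finset.mem_insert, Finset.mem_singleton] at hb
    rcases hb with rfl | rfl
    · refine ⟨x, ?_, by simpa using hx⟩
      rw [Finset.mem_singleton]
      rintro rfl
      exact F.off τ hx
    · refine ⟨c (τ + 1), ?_, by simpa using F.off _⟩
      rw [Finset.mem_singleton]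
      exact fun e => F.ne_of (s := τ) (t := τ + 1) (by omega) (by omega) e.symm)
  rw [Finset.card_pair (by simp)] at this
  simp at this

theorem exists_index {α β : ℤ} (h : c α ≠ c β) : ∃ γ, α < γ ∧ γ < α + m ∧ c γ = c β := by
  obtain ⟨γ, h1, h2, h3⟩ := F.rep α β
  refine ⟨γ, h1, lt_of_le_of_ne h2 ?_, h3⟩
  rintro rfl
  rw [F.per] at h3
  exact h h3

end Fr

/-- `H` and `O` are two different components off the cycle. -/
structure Tw [Fintype V] (G : SimpleGraph V) (m : ℕ) (c : ℤ → V) (H A O B : Finset V) : Prop where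
  lo : Lo G m
  fh : Fr G m c H A
  fo : Fr G m c O B
  hH : H.Nonempty
  hO : O.Nonempty
  disj : ∀ x ∈ H, x ∉ O

namespace Tw
variable [Fintype V] {G : SimpleGraph V} {m : ℕ} {c : ℤ → V} {H A O B : Finset V}
  (F : Tw G m c H A O B)
include F

theorem symm : Tw G m c O B H A := ⟨F.lo, F.fo, F.fh, F.hO, F.hH, fun x hx h => F.disj x h hx⟩

theorem mirror : Tw G m (fun t => c (-t)) H A O B :=
  ⟨F.lo, F.fh.mirror, F.fo.mirror, F.hH, F.hO, F.disj⟩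

theorem xo {x o : V} (hx : x ∈ H) (ho : o ∈ O) : ¬ G.Adj x o := by
  refine F.fh.nadj hx (fun h => F.disj o h ho) fun h => ?_
  obtain ⟨⟨t, rfl⟩, -⟩ := (F.fh.memA _).1 h
  exact F.fo.off t ho

theorem not_low {z : V} (hz : z ∉ H) (hzA : z ∉ A) (hz' : z ∉ O) (hzB : z ∉ B) :
    Fintype.card V ≤ 3 * deg G z := by
  obtain ⟨x, hx⟩ := F.hH
  obtain ⟨o, ho⟩ := F.hO
  have h1 := F.fh.low_of_mem F.lo hx
  have h2 := F.fo.low_of_mem F.lo ho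
  have := F.lo.tri x o z (fun e => F.disj x hx (e ▸ ho)) (fun e => hz (e ▸ hx))
    (fun e => hz' (e ▸ ho)) (F.xo hx ho) (F.fh.nadj hx hz hzA) (F.fo.nadj ho hz' hzB)
  omega

theorem all (v : V) : v ∈ H ∨ v ∈ O ∨ ∃ t, c t = v := by
  by_contra! h
  have h1 := F.fh.low F.lo h.2.2
  have := F.not_low h.1 (fun hv => by
    obtain ⟨⟨t, ht⟩, -⟩ := (F.fh.memA _).1 hv; exact h.2.2 t ht) h.2.1 (fun hv => by
    obtain ⟨⟨t, ht⟩, -⟩ := (F.fo.memA _).1 hv; exact h.2.2 t ht)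
  omega

theorem card_eq : Fintype.card V = m + H.card + O.card := by
  have e : (Finset.univ : Finset V) = (CM m c).toFinset ∪ (H ∪ O) := by
    ext v
    simp only [Finset.mem_univ, Finset.mem_union, Multiset.mem_toFinset, F.fh.mem_CM, true_iff]
    rcases F.all v with h | h | h <;> simp [h]
  rw [← Finset.card_univ, e, Finset.card_union_of_disjoint, Finset.card_union_of_disjoint,
    Multiset.toFinset_card_of_nodup F.fh.nodup_CM, card_CM m c, add_assoc]
  · exact Finset.disjoint_left.2 F.disj
  · refine Finset.disjoint_left.2 fun v hv => ?_
    rw [Multiset.mem_toFinset, F.fh.mem_CM] at hv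
    obtain ⟨t, rfl⟩ := hv
    simpa using ⟨F.fh.off t, F.fo.off t⟩

theorem sp {p a q b : V} {X Y : Multiset V} (hX : PT G p a X) (hY : PT G q b Y)
    (ha : a ∈ A) (hb : b ∈ A) (h : X + Y = CM m c) (hp : p ∈ B) : q ∉ B := by
  intro hq
  obtain ⟨M, N, h1, h2, h3, h4, h5⟩ :=
    F.fh.join hX hY ha hb (h ▸ F.fh.nodup_CM) (fun x hx => h ▸ hx)
  obtain ⟨x, y, K, k1, k2, k3, k4, k5⟩ := F.fo.through hp hq
  have hc : M.card = m + N.card := by rw [← h3, h, Multiset.card_add, card_CM m c]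
  have hm := F.fh.three
  have hd : (M + K).Nodup := by
    refine Multiset.nodup_add.2 ⟨h2, k2, Multiset.disjoint_left.2 fun {z} hz hz' => ?_⟩
    rw [← h3, h, Multiset.mem_add] at hz
    rcases hz with hz | hz
    · obtain ⟨t, rfl⟩ := F.fh.mem_CM.1 hz
      exact F.fo.off t (k3 _ hz')
    · exact F.disj z (h5 z hz) (k3 z hz')
  have := F.fh.mx (M + K) ⟨hd, by rw [Multiset.card_add]; omega, p, x, h1.app k5 k1.rev, k4.symm⟩
  rw [Multiset.card_add] at this
  omega

theorem one_u {s t : ℤ} (hs : c s ∈ A) (ht : c t ∈ A) (hs' : c (s + 1) ∈ B)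
    (ht' : c (t + 1) ∈ B) : c s = c t := by
  by_contra hne
  obtain ⟨γ, h1, h2, h3⟩ := F.fh.exists_index hne
  rw [← F.fh.same h3] at ht'
  rw [← h3] at ht
  have S := F.fh.basic hs ht h1 h2
  exact F.sp S.hp.pt S.hq.pt S.ha S.hb S.eq hs' ht'

theorem one_w {s t : ℤ} (hs : c s ∈ A) (ht : c t ∈ A) (hs' : c (s - 1) ∈ B)
    (ht' : c (t - 1) ∈ B) : c s = c t := by
  have := F.mirror.one_u (s := -s) (t := -t) (by simpa) (by simpa)
    (by simpa [neg_add_eq_sub] using hs') (by simpa [neg_add_eq_sub] using ht')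
  simpa using this

theorem mem_B_of_om {t : ℤ} (ht : c t ∈ A) (ho : Om G m c (c (t + 1))) : c (t + 1) ∈ B := by
  obtain ⟨M, h1, h2, h3, -⟩ := ho
  have := F.lo.low M h1 h2 _ h3
  by_contra hB
  have := F.not_low (F.fh.off (t + 1)) (F.fh.no_two ht) (F.fo.off _) hB
  omega

theorem exists_u : ∃ α, c α ∈ A ∧ c (α + 1) ∉ B := by
  obtain ⟨a, ha, b, hb, hab⟩ := Finset.one_lt_card.1 (F.fh.two F.lo.tough F.hH)
  obtain ⟨⟨s, rfl⟩, -⟩ := (F.fh.memA a).1 ha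
  obtain ⟨⟨t, rfl⟩, -⟩ := (F.fh.memA b).1 hb
  by_contra! h
  exact hab (F.one_u ha hb (h s ha) (h t hb))

theorem nbr_on {v : V} (hv : ∃ t, c t = v) (hA : v ∉ A) (hB : v ∉ B) (w : V) (h : G.Adj v w) :
    ∃ t, c t = w := by
  obtain ⟨t, rfl⟩ := hv
  rcases F.all w with hw | hw | hw
  · exact absurd h.symm (F.fh.nadj hw (F.fh.off t) hA)
  · exact absurd h.symm (F.fo.nadj hw (F.fo.off t) hB)
  · exact hw

theorem pair_bound {α β : ℤ} (hα : c α ∈ A) (hβ : c β ∈ A) (h : α < β) (h' : β < α + m)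
    (hα' : c (α + 1) ∉ B) (hβ' : c (β + 1) ∉ B) (Λ : Finset ℤ)
    (hΛ : ∀ t ∈ Λ, α < t ∧ t < α + m ∧ t ≠ β ∧ c t ∈ A ∧ ¬ Om G m c (c (t + 1)))
    {x o : V} (hx : x ∈ H) (ho : o ∈ O) :
    2 * Fintype.card V + Λ.card ≤ 2 * deg G x + 2 * deg G o + m := by
  have h1 := F.fh.pair_count hα hβ h h' (F.nbr_on ⟨_, rfl⟩ (F.fh.no_two hα) hα')
    (F.nbr_on ⟨_, rfl⟩ (F.fh.no_two hβ) hβ') Λ hΛ ∅ (by simp)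
  have tr {s : ℤ} (hs : c s ∈ A) (hs' : c (s + 1) ∉ B) :
      Fintype.card V ≤ deg G x + deg G o + deg G (c (s + 1)) :=
    F.lo.tri _ _ _ (fun e => F.disj x hx (e ▸ ho)) (fun e => F.fh.off (s + 1) (e ▸ hx))
      (fun e => F.fo.off (s + 1) (e ▸ ho)) (F.xo hx ho)
      (F.fh.nadj hx (F.fh.off _) (F.fh.no_two hs)) (F.fo.nadj ho (F.fo.off _) hs')
  have := tr hα hα'
  have := tr hβ hβ'
  simp only [Finset.card_empty] at h1
  omega

theorem extremal (hk : 3 ≤ A.card) {x o : V} (hx : x ∈ H) (ho : o ∈ O) :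
    O.card = 1 ∧ 3 * deg G x + 1 = Fintype.card V ∧ 3 * deg G o + 1 = Fintype.card V ∧
      deg G x + 1 = A.card + H.card ∧ ∃ t, c t ∈ A ∧ c (t + 1) ∈ B := by
  obtain ⟨α, hα, hα'⟩ := F.exists_u
  set I := (Finset.Ioo α (α + m)).filter fun t => c t ∈ A with hI
  have hIm {t : ℤ} : t ∈ I ↔ (α < t ∧ t < α + m) ∧ c t ∈ A := by simp [hI]
  have hIc : I.card + 1 = A.card := by
    rw [← F.fh.card_index hα, hI]
  have h1 : (I.filter fun t => c (t + 1) ∈ B).card ≤ 1 := by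
    rw [Finset.card_le_one]
    intro s hs t ht
    rw [Finset.mem_filter, hIm] at hs ht
    exact F.fh.inj_of (F.one_u hs.1.2 ht.1.2 hs.2 ht.2) (by omega) (by omega)
  have h2 := Finset.card_filter_add_card_filter_not (s := I) fun t => c (t + 1) ∈ B
  obtain ⟨β, hβ⟩ : (I.filter fun t => c (t + 1) ∉ B).Nonempty := by
    rw [← Finset.card_pos]; omega
  rw [Finset.mem_filter, hIm] at hβ
  set Λ := (I.erase β).filter fun t => ¬ Om G m c (c (t + 1)) with hΛ
  have h3 := F.pair_bound hα hβ.1.2 hβ.1.1.1 hβ.1.1.2 hα' hβ.2 Λ (fun t ht => by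
    rw [hΛ, Finset.mem_filter, Finset.mem_erase, hIm] at ht
    exact ⟨ht.1.2.1.1, ht.1.2.1.2, ht.1.1, ht.1.2.2, ht.2⟩) hx ho
  have h4 : (I.erase β).card ≤ Λ.card + (I.filter fun t => c (t + 1) ∈ B).card := by
    rw [hΛ, ← Finset.card_filter_add_card_filter_not (s := I.erase β)
      fun t => ¬ Om G m c (c (t + 1))]
    gcongr
    intro t ht
    simp only [Finset.mem_filter, Finset.mem_erase, not_not] at ht ⊢
    exact ⟨ht.1.2, F.mem_B_of_om (hIm.1 ht.1.2).2 ht.2⟩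
  rw [Finset.card_erase_of_mem (hIm.2 hβ.1)] at h4
  have h5 := F.fh.deg_add_one_le hx
  have h6 := F.card_eq
  have h7 := F.fh.low_of_mem F.lo hx
  have h8 := F.fo.low_of_mem F.lo ho
  have h9 := Finset.card_pos.2 F.hO
  have h10 : (I.filter fun t => c (t + 1) ∈ B).card = 1 := by omega
  refine ⟨by omega, by omega, by omega, by omega, ?_⟩
  obtain ⟨t, ht⟩ := Finset.card_pos.1 (h10 ▸ Nat.one_pos)
  rw [Finset.mem_filter, hIm] at ht
  exact ⟨t, ht.1.2, ht.2⟩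

end Tw

namespace Fr
variable {G : SimpleGraph V} {m : ℕ} {c : ℤ → V} {H A : Finset V} (F : Fr G m c H A)
include F

theorem exists_shift (i : ℤ) :
    ∃ U : Finset V, U.card = A.card ∧ ∀ v, v ∈ U ↔ ∃ t, c t ∈ A ∧ c (t + i) = v := by
  choose! idx hidx using fun v (hv : v ∈ A) => ((F.memA v).1 hv).1
  refine ⟨A.image fun v => c (idx v + i), Finset.card_image_of_injOn fun v hv w hw e => ?_,
    fun v => ?_⟩
  · have := F.same e (-i)
    rw [← hidx v hv, ← hidx w hw]
    simpa using this
  · rw [Finset.mem_image]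
    constructor
    · rintro ⟨w, hw, rfl⟩
      exact ⟨idx w, by rwa [hidx w hw], rfl⟩
    · rintro ⟨t, ht, rfl⟩
      exact ⟨c t, ht, F.same (hidx _ ht) i⟩

theorem no_two_pred {t : ℤ} (ht : c t ∈ A) : c (t - 1) ∉ A := fun h =>
  F.no_two h (by simpa using ht)

end Fr

namespace Tw
variable [Fintype V] {G : SimpleGraph V} {m : ℕ} {c : ℤ → V} {H A O B : Finset V}
  (F : Tw G m c H A O B)
include F

theorem mem_of_mem_shift {α : ℤ} (hα : c α ∈ A) (hu : c (α + 1) ∈ B)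
    (hm : m + 1 = 3 * A.card) : c (α + 2) ∈ A ∧ ∀ v, (∃ t, c t = v) →
      v ∈ A ∨ (∃ t, c t ∈ A ∧ c (t + 1) = v) ∨ ∃ t, c t ∈ A ∧ c (t - 1) = v := by
  obtain ⟨U, hUc, hU⟩ := F.fh.exists_shift 1
  obtain ⟨W, hWc, hW⟩ := F.fh.exists_shift (-1)
  have hUW : U ∩ W ⊆ {c (α + 1)} := by
    intro v hv
    rw [Finset.mem_inter, hU, hW] at hv
    obtain ⟨⟨s, hs, rfl⟩, t, ht, e⟩ := hv
    have e' := F.fh.same e 1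
    have e1 : t + -1 + 1 = t := by ring
    have e2 : s + 1 + 1 = s + 2 := by ring
    rw [e1, e2] at e'
    rw [e'] at ht
    have := F.mem_B_of_om hs (F.fh.om_single hs ht)
    simpa using F.fh.same (F.one_u hs hα this hu) 1
  have h1 : Disjoint A (U ∪ W) := by
    refine Finset.disjoint_left.2 fun v hv hv' => ?_
    rw [Finset.mem_union, hU, hW] at hv'
    rcases hv' with ⟨t, ht, rfl⟩ | ⟨t, ht, rfl⟩
    · exact F.fh.no_two ht hv
    · exact F.fh.no_two_pred ht hv
  have h2 : A ∪ (U ∪ W) ⊆ (CM m c).toFinset := by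
    intro v hv
    rw [Multiset.mem_toFinset, F.fh.mem_CM]
    simp only [Finset.mem_union, hU, hW] at hv
    rcases hv with hv | ⟨t, -, rfl⟩ | ⟨t, -, rfl⟩
    · exact ((F.fh.memA v).1 hv).1
    · exact ⟨_, rfl⟩
    · exact ⟨_, rfl⟩
  have h3 := Finset.card_union_of_disjoint h1
  have h4 := Finset.card_union_add_card_inter U W
  have h5 := Finset.card_le_card hUW
  have h6 := Finset.card_le_card h2
  have h7 : (CM m c).toFinset.card = m := by
    rw [Multiset.toFinset_card_of_nodup F.fh.nodup_CM, card_CM m c]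
  rw [Finset.card_singleton] at h5
  have h8 := Finset.eq_of_subset_of_card_le h2 (by omega)
  have h9 := Finset.eq_of_subset_of_card_le hUW (by rw [Finset.card_singleton]; omega)
  constructor
  · have := Finset.mem_singleton_self (c (α + 1))
    rw [← h9, Finset.mem_inter, hW] at this
    obtain ⟨-, t, ht, e⟩ := this
    have e' := F.fh.same e 1
    have e1 : t + -1 + 1 = t := by ring
    have e2 : α + 1 + 1 = α + 2 := by ring
    rw [e1, e2] at e'
    rwa [e'] at ht
  · intro v hv
    rw [← F.fh.mem_CM, ← Multiset.mem_toFinset, ← h8] at hv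
    simpa only [Finset.mem_union, hU, hW, sub_eq_add_neg] using hv

theorem card_lt_three : A.card < 3 := by
  by_contra! hk
  obtain ⟨x, hx⟩ := F.hH
  obtain ⟨o, ho⟩ := F.hO
  obtain ⟨h1, h2, h3, h4, α, hα, hu⟩ := F.extremal hk hx ho
  have h5 := F.fo.deg_add_one_le ho
  have := Finset.card_pos.2 F.hH
  obtain ⟨h6, -, -, h7, -⟩ := F.symm.extremal (by omega) ho hx
  have h8 := F.card_eq
  obtain ⟨h9, h10⟩ := F.mem_of_mem_shift hα hu (by omega)
  have hm := F.fh.three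
  have hB : B ⊆ insert (c (α + 1)) ((A.erase (c α)).erase (c (α + 2))) := by
    intro v hv
    rw [Finset.mem_insert, Finset.mem_erase, Finset.mem_erase]
    rcases h10 v ((F.fo.memA v).1 hv).1 with hA | ⟨t, ht, rfl⟩ | ⟨t, ht, rfl⟩
    · refine Or.inr ⟨?_, ?_, hA⟩
      · rintro rfl
        have := F.fo.no_two hu
        rw [add_assoc] at this
        exact this hv
      · rintro rfl
        exact F.fo.no_two hv hu
    · exact Or.inl (F.fh.same (F.one_u ht hα hv hu) 1)
    · left
      have e : α + 2 - 1 = α + 1 := by ring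
      have := F.fh.same (F.one_w ht h9 hv (by rwa [e])) (-1)
      rwa [← sub_eq_add_neg, ← sub_eq_add_neg, e] at this
  have h11 := Finset.card_le_card hB
  have h12 := Finset.card_insert_le (c (α + 1)) ((A.erase (c α)).erase (c (α + 2)))
  rw [Finset.card_erase_of_mem, Finset.card_erase_of_mem hα] at h12
  · omega
  · exact Finset.mem_erase.2 ⟨(F.fh.ne_of (by omega) (by omega)).symm, h9⟩

theorem card_two : A.card = 2 := by
  have := F.card_lt_three
  have := F.fh.two F.lo.tough F.hH
  omega

theorem near {z y y' : V} (hz : ∃ t, c t = z) (hA : z ∉ A) (hB : z ∉ B) (hy : ∃ t, c t = y)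
    (hy' : ∃ t, c t = y') (h1 : z ≠ y) (h2 : z ≠ y') (h3 : y ≠ y') (h : ¬ G.Adj z y) :
    G.Adj z y' := by
  by_contra h'
  obtain ⟨x, hx⟩ := F.hH
  obtain ⟨o, ho⟩ := F.hO
  have e (w : V) : w ∈ (CM m c).toFinset ↔ ∃ t, c t = w := by
    rw [Multiset.mem_toFinset, F.fh.mem_CM]
  have k1 := deg_add_le (G := G) (v := z) (X := (CM m c).toFinset) (B := {z, y, y'})
    (fun w hw => (e w).2 (F.nbr_on hz hA hB w hw)) (fun b hb => by
      rw [e]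
      simp only [Finset.mem_insert, Finset.mem_singleton] at hb
      rcases hb with rfl | rfl | rfl
      · exact ⟨hz, G.loopless.irrefl _⟩
      · exact ⟨hy, h⟩
      · exact ⟨hy', h'⟩)
  rw [Finset.card_eq_three.2 ⟨z, y, y', h1, h2, h3, rfl⟩,
    Multiset.toFinset_card_of_nodup F.fh.nodup_CM, card_CM m c] at k1
  have k2 := F.fh.deg_add_one_le hx
  have k3 := F.fo.deg_add_one_le ho
  have k4 := F.card_eq
  have k5 := F.card_two
  have k6 := F.symm.card_two
  obtain ⟨t, rfl⟩ := hz
  have := F.lo.tri x o (c t) (fun e => F.disj x hx (e ▸ ho)) (fun e => F.fh.off t (e ▸ hx))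
    (fun e => F.fo.off t (e ▸ ho)) (F.xo hx ho) (F.fh.nadj hx (F.fh.off _) hA)
    (F.fo.nadj ho (F.fo.off _) hB)
  omega

theorem u_or {α β : ℤ} (hα : c α ∈ A) (hβ : c β ∈ A) (h : α < β) (h' : β < α + m) :
    c (α + 1) ∈ B ∨ c (β + 1) ∈ B := by
  by_contra! hcon
  obtain ⟨x, hx⟩ := F.hH
  obtain ⟨o, ho⟩ := F.hO
  have h1 := F.pair_bound hα hβ h h' hcon.1 hcon.2 ∅ (by simp) hx ho
  have h2 := F.fh.deg_add_one_le hx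
  have h3 := F.card_eq
  have h4 := F.fh.low_of_mem F.lo hx
  have h5 := F.fo.low_of_mem F.lo ho
  have h6 := F.card_two
  have h7 := Finset.card_pos.2 F.hO
  omega

theorem w_or {α β : ℤ} (hα : c α ∈ A) (hβ : c β ∈ A) (h : α < β) (h' : β < α + m) :
    c (α - 1) ∈ B ∨ c (β - 1) ∈ B := by
  have := F.mirror.u_or (α := -β) (β := -α) (by simpa) (by simpa) (by omega) (by omega)
  simpa [neg_add_eq_sub, or_comm] using this

theorem false_of_index {α β : ℤ} (hα : c α ∈ A) (hβ : c β ∈ A) (h : α < β) (h' : β < α + m)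
    (hu : c (α + 1) ∈ B) : False := by
  have g1 := F.fh.lt_of_lt hα hβ h
  have g2 := F.fh.lt_of_lt hβ (F.fh.memA_add hα) h'
  have hv : c (β + 1) ∉ B := fun hv => F.fh.ne_of h h' (F.one_u hα hβ hu hv)
  have hva : G.Adj (c (β + 1)) (c α) := by
    refine F.near ⟨_, rfl⟩ (F.fh.no_two hβ) hv ⟨_, rfl⟩ ⟨_, rfl⟩
      (F.fh.ne_of (s := α + 1) (t := β + 1) (by omega) (by omega)).symm ?_
      (F.fh.ne_of (s := α) (t := α + 1) (by omega) (by omega)).symm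
      (fun a => F.fh.uu hα hβ h h' a.symm)
    rw [← F.fh.per α]
    exact (F.fh.ne_of (by omega) (by omega))
  have hX : PT G (c (α + 1)) (c β) (ivl c (α + 1) β) :=
    (LP.iv F.fh.adj (by omega)).pt
  have hY : PT G (c (α + m - 1)) (c α) ((ivl c (β + 1) (α + m - 1) : List V) + ([c α] : List V)) :=
    ((LP.iv F.fh.adj (by omega)).pt.rev).app hva (LP.single _).pt
  have eX : ((ivl c (α + 1) β : List V) : Multiset V) +
      ((ivl c (β + 1) (α + m - 1) : List V) + ([c α] : List V)) = CM m c := by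
    rw [← F.fh.full α, ivl_append c (p := α + 1) (r := β) (q := α + m) (by omega) (by omega),
      ivl_concat c (show β + 1 ≤ α + m by omega), F.fh.per]
    simp only [Multiset.coe_add]
  by_cases hw : c (α + m - 1) ∈ B
  · exact F.sp hX hY hβ hα eX hu hw
  have hA' : c (α + m - 1) ∉ A := F.fh.no_two_pred (F.fh.memA_add hα)
  have hw1 : c (β - 1) ∈ B := by
    refine (F.w_or hα hβ h h').resolve_left fun hw' => hw ?_
    rwa [← F.fh.per, show α - 1 + m = α + m - 1 by ring] at hw'
  have hww : ¬ G.Adj (c (α + m - 1)) (c (β - 1)) := by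
    have := F.fh.mirror.uu (α := -(α + m)) (β := -β) (by simpa [F.fh.per] using hα) (by simpa)
      (by omega) (by omega)
    rwa [show -(-(α + m) + 1) = α + m - 1 by ring, show -(-β + 1) = β - 1 by ring] at this
  have hne : c (α + m - 1) ≠ c (β - 1) := (F.fh.ne_of (by omega) (by omega)).symm
  rcases eq_or_ne (α + 2) β with rfl | hβ2
  · obtain ⟨b, hb, hbu⟩ := Finset.exists_mem_ne
      (show 1 < B.card by rw [F.symm.card_two]; omega) (c (α + 1))
    obtain ⟨⟨s, rfl⟩, -⟩ := (F.fo.memA b).1 hb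
    obtain ⟨t, t1, t2, t3⟩ := F.fh.exists_index (α := α + 1) (β := s) hbu.symm
    rw [← t3] at hb hbu
    have n1 : t ≠ α + 2 := by
      rintro rfl
      have := F.fo.no_two hu
      rw [add_assoc] at this
      exact this hb
    have n2 : t ≠ α + m := by
      rintro rfl
      rw [F.fh.per] at hb
      exact F.fo.no_two hb hu
    have n3 : t ≠ α + 2 + 1 := by rintro rfl; exact hv hb
    have n4 : t ≠ α + m - 1 := by rintro rfl; exact hw hb
    have a1 : G.Adj (c (α + m - 1)) (c (t - 1)) :=
      F.near ⟨_, rfl⟩ hA' hw ⟨_, rfl⟩ ⟨_, rfl⟩ hne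
        (F.fh.ne_of (by omega) (by omega)).symm (F.fh.ne_of (by omega) (by omega)) hww
    have hY' := (LP.iv F.fh.adj (show t ≤ α + m - 1 by omega)).pt.app a1
      ((LP.iv F.fh.adj (show α + 2 + 1 ≤ t - 1 by omega)).pt.rev.app hva (LP.single _).pt)
    refine F.sp hX hY' hβ hα ?_ hu hb
    rw [← eX, ivl_append c (p := α + 2 + 1) (r := t - 1) (q := α + m - 1) (by omega) (by omega),
      sub_add_cancel, ← Multiset.coe_add]
    abel
  · have a1 : G.Adj (c (α + m - 1)) (c (α + 1)) :=
      F.near ⟨_, rfl⟩ hA' hw ⟨_, rfl⟩ ⟨_, rfl⟩ hne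
        (F.fh.ne_of (by omega) (by omega)).symm (F.fh.ne_of (by omega) (by omega)).symm hww
    exact F.fh.sp hX hY hβ hα eX a1.symm

theorem false : False := by
  obtain ⟨a, ha, b, hb, hab⟩ := Finset.one_lt_card.1 (F.fh.two F.lo.tough F.hH)
  obtain ⟨⟨α, rfl⟩, -⟩ := (F.fh.memA a).1 ha
  obtain ⟨⟨s, rfl⟩, -⟩ := (F.fh.memA b).1 hb
  obtain ⟨β, h1, h2, h3⟩ := F.fh.exists_index hab
  rw [← h3] at hb
  rcases F.u_or ha hb h1 h2 with hu | hu
  · exact F.false_of_index ha hb h1 h2 hu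
  · exact F.false_of_index hb (F.fh.memA_add ha) h2 (by omega) hu

end Tw

theorem Fr.exists_adj {G : SimpleGraph V} {m : ℕ} {c : ℤ → V} {H A : Finset V}
    (F : Fr G m c H A) {x y : V} (hx : x ∈ H) (hy : y ∈ H) (hxy : x ≠ y) :
    ∃ z ∈ H, G.Adj x z := by
  obtain ⟨M, ⟨l, ⟨h1, h2, h3⟩, rfl⟩, -, h5⟩ := F.conn x hx y hy
  match l, h1, h2, h3, h5 with
  | [], _, h2, _, _ => simp at h2
  | [a], _, h2, h3, _ =>
    simp only [List.head?_cons, Option.some.injEq, List.getLast?_singleton] at h2 h3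
    exact absurd (h2.symm.trans h3) hxy
  | a :: b :: l, h1, h2, _, h5 =>
    simp only [List.head?_cons, Option.some.injEq] at h2
    subst h2
    exact ⟨b, h5 b (by simp), h1.rel⟩

/-- If all vertices missed by longest cycles have low degree, then every vertex off a
longest cycle lies in one component. -/
theorem Lo.exists_fr [Fintype V] {G : SimpleGraph V} {m : ℕ} (L : Lo G m)
    (hmx : ∀ M, Cl G M → M.card ≤ m) {M : Multiset V} (hM : Cl G M) (hm : m ≤ M.card)
    {x : V} (hx : x ∉ M) : ∃ c H A, Fr G m c H A ∧ x ∈ H ∧ (∀ v, v ∈ M ↔ ∃ t, c t = v) ∧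
      ∀ v, v ∈ H ∨ ∃ t, c t = v := by
  obtain ⟨c, C, hc⟩ := hM.exists_cy
  have e : M.card = m := le_antisymm (hmx M hM) hm
  rw [e] at C
  have h3 : 3 ≤ m := e ▸ hM.2.1
  obtain ⟨H, A, hH, F⟩ := C.exists_fr h3 hmx (x := x) fun t ht => hx ((hc x).2 ⟨t, ht⟩)
  refine ⟨c, H, A, F, (hH x).2 (SimpleGraph.Reachable.refl _), hc, fun v => ?_⟩
  by_contra! hv
  obtain ⟨O, B, hO, F'⟩ := C.exists_fr h3 hmx (x := v) hv.2
  exact Tw.false (⟨L, F, F', ⟨x, (hH x).2 (SimpleGraph.Reachable.refl _)⟩,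
    ⟨v, (hO v).2 (SimpleGraph.Reachable.refl _)⟩, fun z h1 h2 =>
      hv.1 ((hH v).2 (((hH z).1 h1).trans ((hO z).1 h2).symm))⟩ : Tw G m c H A O B)

theorem Fr.card_all [Fintype V] {G : SimpleGraph V} {m : ℕ} {c : ℤ → V} {H A : Finset V}
    (F : Fr G m c H A) (h : ∀ v, v ∈ H ∨ ∃ t, c t = v) : Fintype.card V = m + H.card := by
  have e : (Finset.univ : Finset V) = (CM m c).toFinset ∪ H := by
    ext v
    simp only [Finset.mem_univ, Finset.mem_union, Multiset.mem_toFinset, F.mem_CM, true_iff]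
    exact (h v).symm
  rw [← Finset.card_univ, e, Finset.card_union_of_disjoint,
    Multiset.toFinset_card_of_nodup F.nodup_CM, card_CM m c]
  refine Finset.disjoint_left.2 fun v hv => ?_
  rw [Multiset.mem_toFinset, F.mem_CM] at hv
  obtain ⟨t, rfl⟩ := hv
  exact F.off t

theorem Lo.false [Fintype V] {G : SimpleGraph V} {m : ℕ} (L : Lo G m)
    (hmx : ∀ M, Cl G M → M.card ≤ m) (hex : ∃ M, Cl G M ∧ m ≤ M.card)
    (hlt : m < Fintype.card V) : False := by
  obtain ⟨x, hx, hmax⟩ := Finset.exists_max_image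
    (Finset.univ.filter fun x => ∃ M, Cl G M ∧ m ≤ M.card ∧ x ∉ M) (deg G) (by
      obtain ⟨M, h1, h2⟩ := hex
      obtain ⟨x, hx⟩ : ∃ x, x ∉ M.toFinset := by
        by_contra! h
        have := Finset.card_le_card (fun v _ => h v : (Finset.univ : Finset V) ⊆ M.toFinset)
        have := M.toFinset_card_le
        have := hmx M h1
        rw [Finset.card_univ] at *
        omega
      exact ⟨x, by simpa using ⟨M, h1, h2, by simpa using hx⟩⟩)
  simp only [Finset.mem_filter, Finset.mem_univ, true_and] at hx hmax
  obtain ⟨M, hM, hm, hxM⟩ := hx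
  obtain ⟨c, H, A, F, hxH, -, hall⟩ := L.exists_fr hmx hM hm hxM
  have hn := F.card_all hall
  have hdx := F.deg_add_one_le hxH
  have hlow := F.low_of_mem L hxH
  refine Mn.false (⟨F, hall, F.two L.tough ⟨x, hxH⟩, L.tough, fun s t hs ht hst hadj => ?_,
    fun t ht ho => ?_⟩ : Mn G m c H A)
  · have := L.tri x (c s) (c t) (fun e => F.off s (e ▸ hxH)) (fun e => F.off t (e ▸ hxH)) hst
      (F.nadj hxH (F.off s) hs) (F.nadj hxH (F.off t) ht) hadj
    omega
  · obtain ⟨M', h1, h2, h3, h4⟩ := ho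
    have hlow' := L.low M' h1 h2 _ h3
    have hle := hmax _ ⟨M', h1, h2, h3⟩
    obtain ⟨c', H', A', F', ht', hc', hall'⟩ := L.exists_fr hmx h1 h2 h3
    have hn' := F'.card_all hall'
    have hH : H.card = 1 := by
      by_contra hH
      have hpos := Finset.card_pos.2 ⟨x, hxH⟩
      obtain ⟨y, hy, hyt⟩ := Finset.exists_mem_ne (show 1 < H'.card by omega) (c t)
      obtain ⟨z, hz, a⟩ := F'.exists_adj ht' hy hyt.symm
      rcases hall z with hzH | ⟨s, rfl⟩
      · exact ht ((F.memA _).2 ⟨⟨t, rfl⟩, z, hzH, a⟩)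
      · obtain ⟨r, hr⟩ := (hc' _).1 (h4 s a.ne')
        exact F'.off r (hr ▸ hz)
    have hA : A.card ≤ deg G x := by
      rw [deg, ← Set.ncard_coe_finset]
      refine Set.ncard_le_ncard (fun v hv => ?_) (Set.toFinite _)
      obtain ⟨-, y, hy, a⟩ := (F.memA v).1 hv
      rw [Finset.card_le_one.1 hH.le x hxH y hy]
      exact a.symm
    exact ⟨hH, by omega, by omega, by omega⟩

theorem sigma3_le [Fintype V] {G : SimpleGraph V} {x y z : V} (h1 : x ≠ y) (h2 : x ≠ z)
    (h3 : y ≠ z) (h4 : ¬ G.Adj x y) (h5 : ¬ G.Adj x z) (h6 : ¬ G.Adj y z) :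
    sigma3 G ≤ deg G x + deg G y + deg G z := by
  have hT : IsIndepTriple G {x, y, z} := by
    refine ⟨Finset.card_eq_three.2 ⟨x, y, z, h1, h2, h3, rfl⟩, fun a ha b hb _ => ?_⟩
    simp only [Finset.mem_insert, Finset.mem_singleton] at ha hb
    rcases ha with rfl | rfl | rfl <;> rcases hb with rfl | rfl | rfl <;>
      simp_all [G.adj_comm]
  rw [sigma3, if_pos ⟨_, hT⟩]
  refine Nat.sInf_le ⟨_, hT, ?_⟩
  rw [Finset.sum_insert (by simp [h1, h2]), Finset.sum_insert (by simp [h3]),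
    Finset.sum_singleton, add_assoc]

theorem stmt1 {V : Type*} [Fintype V] (G : SimpleGraph V)
    (hn : 3 ≤ Fintype.card V) (htough : OneTough G) (hsig : Fintype.card V ≤ sigma3 G)
    (hham : ¬ G.IsHamiltonian) :
    ∃ (a : V) (c : G.Walk a a), IsLongestCycle G c ∧
      ∃ x : V, x ∉ c.support ∧ Fintype.card V ≤ 3 * deg G x := by
  by_contra! hcon
  have hle (M : Multiset V) (hM : Cl G M) : M.card ≤ Fintype.card V := by
    rw [← Multiset.toFinset_card_of_nodup hM.1]
    exact Finset.card_le_univ _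
  set P : ℕ → Prop := fun k => ∃ M, Cl G M ∧ M.card = k
  set m := Nat.findGreatest P (Fintype.card V)
  obtain ⟨M₀, hM₀⟩ := htough.exists_cl hn
  obtain ⟨M, hM, hm⟩ : P m := Nat.findGreatest_spec (hle M₀ hM₀) ⟨M₀, hM₀, rfl⟩
  have hmx (M : Multiset V) (hM : Cl G M) : M.card ≤ m :=
    Nat.le_findGreatest (hle M hM) ⟨M, hM, rfl⟩
  refine Lo.false (m := m) ⟨htough, fun x y z h1 h2 h3 h4 h5 h6 =>
    hsig.trans (sigma3_le h1 h2 h3 h4 h5 h6), fun M hM hm v hv => ?_⟩ hmx ⟨M, hM, hm.ge⟩ ?_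
  · obtain ⟨b, w, h1, h2, h3⟩ := hM.exists_walk
    refine hcon b w ⟨h1, fun b' w' hw' => ?_⟩ v (fun h => hv ((h3 v).1 h))
    obtain ⟨M', k1, k2, -⟩ := Cl.of_walk hw'
    have := hmx M' k1
    omega
  · refine lt_of_le_of_ne (hm ▸ hle M hM) fun e => hham fun _ => ?_
    obtain ⟨b, w, h1, h2, -⟩ := hM.exists_walk
    exact ⟨b, w, SimpleGraph.Walk.isHamiltonianCycle_iff_isCycle_and_length_eq.2
      ⟨h1, by omega⟩⟩

end
end Paper
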